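/- arXiv:1809.10957 — 3 statements merged into one kernel-verified Lean document; each statement's English description precedes it below -/
import Mathlib

section
/- Let ψ be a 𝕂G-irrep. Then ψ is not tightly induced from any strict subquotient of G if and only if G is a Roquette p-group and ψ is a faithful representation of G. -/
open scoped Classical

noncomputable section

namespace Genotype

variable {k : Type} [Field k] {G : Type} [Group G]

/-- The subfield generated (over the prime field `ℚ`) by the values of a function,
e.g. the field `ℚ[ψ]` generated by the values of a character. -/
def charField {X : Type} {k : Type} [Field k] (f : X → k) : Subfield k :=
  Subfield.closure (Set.range f)

theorem mem_charField {X : Type} {k : Type} [Field k] (f : X → k) (x : X) :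
    f x ∈ charField f :=
  Subfield.subset_closure ⟨x, rfl⟩

/-- Two functions (typically characters of irreps over possibly different
characteristic-zero fields) are Galois conjugate: there is a Galois extension `M` of `ℚ`
containing (copies of) all their values and a field automorphism `α` of `M` with
`α (f g) = f' g` for all `g`. -/
def IsGaloisConj {k l : Type} [Field k] [Field l] {G : Type}
    (f : G → k) (f' : G → l) : Prop :=
  ∃ (M : Type) (_ : Field M) (_ : Algebra ℚ M), IsGalois ℚ M ∧
    ∃ (i : charField f →+* M) (j : charField f' →+* M) (α : M ≃+* M),
      ∀ g : G, α (i ⟨f g, mem_charField f g⟩) = j ⟨f' g, mem_charField f' g⟩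

/-- Irreducibility of a finite-dimensional representation. -/
def IsIrr (V : FDRep k G) : Prop :=
  Nontrivial V ∧
    ∀ U : Submodule k V, (∀ g : G, ∀ x ∈ U, V.ρ g x ∈ U) → U = ⊥ ∨ U = ⊤

/-- Faithfulness of a representation. -/
def IsFaithfulRep (V : FDRep k G) : Prop := Function.Injective V.ρ

/-- `f` (the character of an irrep) occurs in the character `c`,
i.e. `c = f + (character of some representation)`. -/
def CharOccurs (f c : G → k) : Prop :=
  ∃ W : FDRep k G, c = f + W.character

/-- `f` (the character of an irrep) occurs in `c` with multiplicity exactly `m`. -/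
def CharMult (f c : G → k) (m : ℕ) : Prop :=
  ∃ W : FDRep k G, c = m • f + W.character ∧ ¬ CharOccurs f W.character

/-- `f` is the character of an irreducible representation. -/
def IsIrrChar (f : G → k) : Prop := ∃ V : FDRep k G, IsIrr V ∧ f = V.character

/-- Restriction of a character to a subgroup. -/
def resChar (H : Subgroup G) (c : G → k) : H → k := fun h => c h

/-- The induced character `ind_H^G f`. -/
def indChar (H : Subgroup G) (f : H → k) : G → k := fun g =>
  (Nat.card H : k)⁻¹ *
    ∑ᶠ x : G, if h : x⁻¹ * g * x ∈ H then f ⟨x⁻¹ * g * x, h⟩ else 0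

/-- The character `cψ` (of a `kG`-irrep) is tightly induced from the character `cφ`
(of a `kH`-irrep): `cψ` is the induced character of `cφ`, `cφ` occurs with multiplicity
exactly `1` in the restriction of `cψ`, and no Galois conjugate of `cφ` other than `cφ`
itself occurs in the restriction of `cψ`. -/
def TightInd (H : Subgroup G) (cψ : G → k) (cφ : H → k) : Prop :=
  cψ = indChar H cφ ∧ CharMult cφ (resChar H cψ) 1 ∧
    ∀ cφ' : H → k, IsIrrChar cφ' → IsGaloisConj cφ cφ' →
      CharOccurs cφ' (resChar H cψ) → cφ' = cφ

/-- Tight induction from a subquotient `H/K` of `G`: tight induction from `H`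
of the inflation. -/
def TightIndSub (H : Subgroup G) (K : Subgroup H) [K.Normal]
    (cψ : G → k) (cφ : (H ⧸ K) → k) : Prop :=
  TightInd H cψ (fun h => cφ (QuotientGroup.mk h))

/-- A group is Roquette if every normal abelian subgroup of it is cyclic. -/
def IsRoquette (P : Type) [Group P] : Prop :=
  ∀ A : Subgroup P, A.Normal → (∀ x ∈ A, ∀ y ∈ A, x * y = y * x) → IsCyclic A

/-- `χ` is the rational form `ψ_ℚ` of `V`: a rational irrep such that `V` occurs in the
scalar extension `k ⊗_ℚ χ`. -/
def IsRatForm [CharZero k] (χ : FDRep ℚ G) (V : FDRep k G) : Prop :=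
  IsIrr χ ∧ CharOccurs V.character (fun g => algebraMap ℚ k (χ.character g))

/-- Irreps over possibly different characteristic-zero fields are quasiconjugate if they
determine the same rational irrep. -/
def Quasiconj {k l : Type} [Field k] [Field l] [CharZero k] [CharZero l] {G : Type} [Group G]
    (V : FDRep k G) (W : FDRep l G) : Prop :=
  ∃ χ : FDRep ℚ G, IsRatForm χ V ∧ IsRatForm χ W

end Genotype

namespace Genotype

section cut
set_option linter.unusedSectionVars false
variable {k : Type} [Field k] {G : Type} [Group G] {V : Type} [AddCommGroup V] [Module k V]
  [FiniteDimensional k V]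

/-- The subrepresentation on the range of an equivariant idempotent. -/
def cutRep (ρ : G →* (V →ₗ[k] V)) (P : V →ₗ[k] V) (hP : P * P = P)
    (hc : ∀ g, P * ρ g = ρ g * P) : G →* (LinearMap.range P →ₗ[k] LinearMap.range P) where
  toFun g := P.rangeRestrict ∘ₗ ρ g ∘ₗ (LinearMap.range P).subtype
  map_one' := by
    ext ⟨x, y, rfl⟩
    simpa using LinearMap.congr_fun hP y
  map_mul' g h := by
    ext ⟨x, y, rfl⟩
    have h1 := LinearMap.congr_fun (hc h) (P y)
    have h2 := LinearMap.congr_fun hP y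
    simp only [Module.End.mul_apply] at h1 h2
    have h3 : P (ρ h (P y)) = ρ h (P y) := by rw [h1, h2]
    simp only [map_mul, LinearMap.comp_apply, Submodule.subtype_apply, Module.End.mul_apply,
      LinearMap.codRestrict_apply, LinearMap.rangeRestrict, h3]

theorem cutRep_coe (ρ : G →* (V →ₗ[k] V)) (P : V →ₗ[k] V) (hP : P * P = P)
    (hc : ∀ g, P * ρ g = ρ g * P) (g : G) (x : LinearMap.range P) :
    (cutRep ρ P hP hc g x : V) = ρ g x := by
  obtain ⟨x, y, rfl⟩ := x
  have h1 := LinearMap.congr_fun (hc g) (P y)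
  have h2 := LinearMap.congr_fun hP y
  simp only [Module.End.mul_apply] at h1 h2
  simp [cutRep, h1, h2]

theorem cutRep_trace (ρ : G →* (V →ₗ[k] V)) (P : V →ₗ[k] V) (hP : P * P = P)
    (hc : ∀ g, P * ρ g = ρ g * P) (g : G) :
    LinearMap.trace k _ (cutRep ρ P hP hc g) = LinearMap.trace k V (P * ρ g) := by
  simp only [cutRep, MonoidHom.coe_mk, OneHom.coe_mk]
  rw [LinearMap.trace_comp_comm', LinearMap.comp_assoc]
  change LinearMap.trace k V (ρ g * P) = _
  rw [hc]

theorem char_of (ρ : G →* (V →ₗ[k] V)) (g : G) :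
    (FDRep.of ρ).character g = LinearMap.trace k V (ρ g) := rfl

theorem char_def (V : FDRep k G) (g : G) :
    V.character g = LinearMap.trace k V (V.ρ g) := rfl

theorem exists_cut (ρ : G →* (V →ₗ[k] V)) (P : V →ₗ[k] V) (hP : P * P = P)
    (hc : ∀ g, P * ρ g = ρ g * P) :
    ∃ W : FDRep k G, ∀ g, W.character g = LinearMap.trace k V (P * ρ g) :=
  ⟨FDRep.of (cutRep ρ P hP hc), fun g => by rw [char_of, cutRep_trace]⟩

theorem trace_idem (P : V →ₗ[k] V) (hP : P * P = P) :
    LinearMap.trace k V P = (Module.finrank k (LinearMap.range P) : k) := by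
  have h : LinearMap.IsProj (LinearMap.range P) P :=
    ⟨fun x => LinearMap.mem_range_self _ _, by
      rintro _ ⟨y, rfl⟩; exact LinearMap.congr_fun hP y⟩
  exact h.trace

/-- sum over a subgroup -/
def sumN (ρ : G →* (V →ₗ[k] V)) (N : Subgroup G) [Fintype N] : V →ₗ[k] V :=
  ∑ n : N, ρ n

/-- average over a subgroup -/
def avgN (ρ : G →* (V →ₗ[k] V)) (N : Subgroup G) [Fintype N] : V →ₗ[k] V :=
  (Fintype.card N : k)⁻¹ • sumN ρ N

variable [CharZero k]

theorem mul_sumN (ρ : G →* (V →ₗ[k] V)) (N : Subgroup G) [Fintype N] (n : G) (hn : n ∈ N) :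
    ρ n * sumN ρ N = sumN ρ N := by
  simp only [sumN, Finset.mul_sum, ← map_mul]
  exact Fintype.sum_equiv (Equiv.mulLeft (⟨n, hn⟩ : N)) _ _ (fun x => rfl)

theorem sumN_mul (ρ : G →* (V →ₗ[k] V)) (N : Subgroup G) [Fintype N] (n : G) (hn : n ∈ N) :
    sumN ρ N * ρ n = sumN ρ N := by
  simp only [sumN, Finset.sum_mul, ← map_mul]
  exact Fintype.sum_equiv (Equiv.mulRight (⟨n, hn⟩ : N)) _ _ (fun x => rfl)

theorem mul_avgN (ρ : G →* (V →ₗ[k] V)) (N : Subgroup G) [Fintype N] (n : G) (hn : n ∈ N) :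
    ρ n * avgN ρ N = avgN ρ N := by
  rw [avgN, mul_smul_comm, mul_sumN ρ N n hn]

theorem avgN_mul (ρ : G →* (V →ₗ[k] V)) (N : Subgroup G) [Fintype N] (n : G) (hn : n ∈ N) :
    avgN ρ N * ρ n = avgN ρ N := by
  rw [avgN, smul_mul_assoc, sumN_mul ρ N n hn]

theorem avgN_fix (ρ : G →* (V →ₗ[k] V)) (N : Subgroup G) [Fintype N] (T : V →ₗ[k] V)
    (h : ∀ n ∈ N, ρ n * T = T) : avgN ρ N * T = T := by
  have : (Fintype.card N : k) ≠ 0 := by exact_mod_cast Fintype.card_ne_zero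
  rw [avgN, smul_mul_assoc, sumN, Finset.sum_mul, Finset.sum_congr rfl (fun (n : N) _ => h n n.2)]
  simp only [Finset.sum_const, Finset.card_univ]
  rw [← Nat.cast_smul_eq_nsmul k, smul_smul, inv_mul_cancel₀ this, one_smul]

theorem avgN_idem (ρ : G →* (V →ₗ[k] V)) (N : Subgroup G) [Fintype N] :
    avgN ρ N * avgN ρ N = avgN ρ N :=
  avgN_fix ρ N _ (fun n hn => mul_avgN ρ N n hn)

theorem trace_avgN_mul (ρ : G →* (V →ₗ[k] V)) (N : Subgroup G) [Fintype N] (T : V →ₗ[k] V) :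
    LinearMap.trace k V (avgN ρ N * T) =
      (Fintype.card N : k)⁻¹ * ∑ n : N, LinearMap.trace k V (ρ n * T) := by
  rw [avgN, smul_mul_assoc, map_smul, sumN, Finset.sum_mul, map_sum, smul_eq_mul]

theorem eq_one_of_trace (P : V →ₗ[k] V) (hP : P * P = P)
    (h : LinearMap.trace k V P = (Module.finrank k V : k)) : P = 1 := by
  rw [trace_idem P hP] at h
  have h1 := Submodule.eq_top_of_finrank_eq (Nat.cast_injective h)
  ext x
  obtain ⟨y, rfl⟩ := LinearMap.range_eq_top.1 h1 x
  exact LinearMap.congr_fun hP y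

theorem eq_zero_of_trace (P : V →ₗ[k] V) (hP : P * P = P)
    (h : LinearMap.trace k V P = 0) : P = 0 := by
  rw [trace_idem P hP] at h
  have h1 := Submodule.finrank_eq_zero.1 (Nat.cast_eq_zero.1 h)
  exact LinearMap.range_eq_bot.1 h1

/-- if the trace is the dimension on N then N acts trivially -/
theorem triv_of_trace (ρ : G →* (V →ₗ[k] V)) (N : Subgroup G) [Fintype N]
    (h : ∀ n ∈ N, LinearMap.trace k V (ρ n) = (Module.finrank k V : k)) : avgN ρ N = 1 := by
  apply eq_one_of_trace _ (avgN_idem ρ N)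
  have := trace_avgN_mul ρ N 1
  have hc : (Fintype.card N : k) ≠ 0 := by exact_mod_cast Fintype.card_ne_zero
  rw [mul_one] at this
  have h2 : ∀ n : N, LinearMap.trace k V (ρ n * 1) = (Module.finrank k V : k) :=
    fun n => by rw [mul_one]; exact h n n.2
  rw [this]
  simp only [h2, Finset.sum_const, Finset.card_univ, nsmul_eq_mul]
  field_simp

end cut
end Genotype

namespace Genotype

section gen
set_option linter.unusedSectionVars false
variable {k : Type} [Field k] [CharZero k] {G : Type} [Group G] [Fintype G]
  {V : Type} [AddCommGroup V] [Module k V] [FiniteDimensional k V]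

def Irr {k : Type} [Field k] {G : Type} [Group G] {V : Type} [AddCommGroup V] [Module k V]
    (ρ : G →* (V →ₗ[k] V)) : Prop :=
  Nontrivial V ∧ ∀ U : Submodule k V, (∀ g : G, ∀ x ∈ U, ρ g x ∈ U) → U = ⊥ ∨ U = ⊤

theorem irr_span {ρ : G →* (V →ₗ[k] V)} (hρ : Irr ρ) (X : Submodule k V) (hX : X ≠ ⊥) :
    ⨆ g : G, X.map (ρ g) = ⊤ := by
  have h1 : X ≤ ⨆ g : G, X.map (ρ g) := by
    refine le_trans ?_ (le_iSup _ (1 : G))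
    rw [map_one]
    exact fun x hx => ⟨x, hx, rfl⟩
  refine (hρ.2 _ ?_).resolve_left (fun h => hX (le_bot_iff.1 (h ▸ h1)))
  intro g x hx
  have : (⨆ g : G, X.map (ρ g)).map (ρ g) ≤ ⨆ g : G, X.map (ρ g) := by
    rw [Submodule.map_iSup]
    refine iSup_le fun h => ?_
    rw [← Submodule.map_comp]
    refine le_trans (le_of_eq ?_) (le_iSup _ (g * h))
    rw [map_mul]; rfl
  exact this ⟨x, hx, rfl⟩

/-- an operator commuting with an irreducible rep and killing a nonzero vector is zero -/
theorem irr_zero {ρ : G →* (V →ₗ[k] V)} (hρ : Irr ρ) (T : V →ₗ[k] V)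
    (hT : ∀ g, T * ρ g = ρ g * T) (e : V →ₗ[k] V) (he : e ≠ 0) (hTe : T * e = 0) : T = 0 := by
  have := hρ.2 (LinearMap.ker T) (fun g x hx => by
    have h1 := LinearMap.congr_fun (hT g) x
    simp only [Module.End.mul_apply] at h1
    rw [LinearMap.mem_ker] at hx ⊢
    rw [h1, hx, map_zero])
  rcases this with h | h
  · exfalso
    apply he
    ext x
    have : e x ∈ LinearMap.ker T := LinearMap.congr_fun hTe x
    rw [h] at this
    exact this
  · exact LinearMap.ker_eq_top.1 h

theorem rho_inv (ρ : G →* (V →ₗ[k] V)) (g : G) : ρ g * ρ g⁻¹ = 1 := by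
  rw [← map_mul, mul_inv_cancel, map_one]

theorem rho_inv' (ρ : G →* (V →ₗ[k] V)) (g : G) : ρ g⁻¹ * ρ g = 1 := by
  rw [← map_mul, inv_mul_cancel, map_one]

variable (ρ : G →* (V →ₗ[k] V)) (e : V →ₗ[k] V) (H : Subgroup G)

theorem conj_comm (L : Subgroup G) (T : V →ₗ[k] V) (g : G) (hg : g ∈ L) :
    (∑ x : L, ρ x * T * ρ (x : G)⁻¹) * ρ g = ρ g * (∑ x : L, ρ x * T * ρ (x : G)⁻¹) := by
  rw [Finset.sum_mul, Finset.mul_sum]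
  refine Fintype.sum_equiv (Equiv.mulLeft (⟨g⁻¹, L.inv_mem hg⟩ : L)) _ _ (fun x => ?_)
  simp only [Equiv.coe_mulLeft, Subgroup.coe_mul, mul_inv_rev, inv_inv, map_mul]
  simp only [← mul_assoc, rho_inv, one_mul]

theorem conj_mul (L : Subgroup G) (hHL : H ≤ L) (he : e * e = e) (hc : ∀ h ∈ H, e * ρ h = ρ h * e)
    (h0 : ∀ g ∉ H, e * ρ g * e = 0) :
    (∑ x : L, ρ x * e * ρ (x : G)⁻¹) * e = (Fintype.card H : k) • e := by
  have h1 : ∀ x : G, ρ x * e * ρ x⁻¹ * e = if x ∈ H then e else 0 := by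
    intro x
    split_ifs with hx
    · rw [mul_assoc (ρ x * e), ← hc _ (H.inv_mem hx), mul_assoc, ← mul_assoc e, he, hc _ (H.inv_mem hx),
        ← mul_assoc, rho_inv, one_mul]
    · have := h0 x⁻¹ (fun h => hx (by simpa using H.inv_mem h))
      rw [mul_assoc (ρ x), mul_assoc (ρ x), this, mul_zero]
  rw [Finset.sum_mul, Finset.sum_congr rfl (fun (x : L) _ => h1 x), ← Finset.sum_filter,
    Finset.sum_const, ← Nat.cast_smul_eq_nsmul k]
  congr 2
  rw [← Fintype.card_subtype]
  refine Fintype.card_congr ⟨fun x => ⟨x.1, x.2⟩, fun x => ⟨⟨x.1, hHL x.2⟩, x.2⟩, fun x => rfl, fun x => rfl⟩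

theorem sum_conj (hρ : Irr ρ) (he : e * e = e) (hne : e ≠ 0)
    (hc : ∀ h ∈ H, e * ρ h = ρ h * e)
    (h0 : ∀ g ∉ H, e * ρ g * e = 0) :
    ∑ x : G, ρ x * e * ρ x⁻¹ = (Fintype.card H : k) • 1 := by
  have h1 : ∑ x : G, ρ x * e * ρ x⁻¹ = ∑ x : (⊤ : Subgroup G), ρ x * e * ρ (x : G)⁻¹ :=
    Fintype.sum_equiv Subgroup.topEquiv.symm.toEquiv _ _ (fun x => rfl)
  rw [h1, ← sub_eq_zero]
  refine irr_zero hρ _ (fun g => ?_) e hne ?_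
  · rw [sub_mul, mul_sub, conj_comm ρ ⊤ e g trivial]
    simp
  · rw [sub_mul, conj_mul ρ e H ⊤ le_top he hc h0]
    simp

theorem trace_off (he : e * e = e) (h0 : ∀ g ∉ H, e * ρ g * e = 0) (g : G) (hg : g ∉ H) :
    LinearMap.trace k V (e * ρ g) = 0 := by
  rw [← he, mul_assoc, LinearMap.trace_mul_comm, h0 g hg, map_zero]

theorem ind_char (hρ : Irr ρ) (he : e * e = e) (hne : e ≠ 0)
    (hc : ∀ h ∈ H, e * ρ h = ρ h * e)
    (h0 : ∀ g ∉ H, e * ρ g * e = 0) (g : G) :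
    LinearMap.trace k V (ρ g) = indChar H (fun h => LinearMap.trace k V (e * ρ h)) g := by
  have hcard : (Fintype.card H : k) ≠ 0 := by exact_mod_cast Fintype.card_ne_zero
  rw [indChar, Nat.card_eq_fintype_card, finsum_eq_sum_of_fintype, eq_inv_mul_iff_mul_eq₀ hcard]
  have h1 := congrArg (fun T => LinearMap.trace k V (T * ρ g)) (sum_conj ρ e H hρ he hne hc h0)
  simp only [smul_mul_assoc, one_mul, map_smul, smul_eq_mul, Finset.sum_mul, map_sum] at h1
  rw [← h1]
  refine Finset.sum_congr rfl fun x _ => ?_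
  have h2 : LinearMap.trace k V (ρ x * e * ρ x⁻¹ * ρ g) =
      LinearMap.trace k V (e * ρ (x⁻¹ * g * x)) := by
    rw [mul_assoc, mul_assoc, LinearMap.trace_mul_comm, map_mul ρ, map_mul ρ]
    simp only [mul_assoc]
  rw [h2]
  split_ifs with hx
  · rfl
  · exact trace_off ρ e H he h0 _ hx

theorem irr_cut (hρ : Irr ρ) (he : e * e = e)
    (h0 : ∀ g ∉ H, e * ρ g * e = 0) (U : Submodule k V) (hUe : U ≤ LinearMap.range e)
    (hU : ∀ h ∈ H, ∀ x ∈ U, ρ h x ∈ U) (hU0 : U ≠ ⊥) : U = LinearMap.range e := by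
  have hfix : ∀ x ∈ U, e x = x := fun x hx => by
    obtain ⟨y, rfl⟩ := hUe hx
    exact LinearMap.congr_fun he y
  refine le_antisymm hUe ?_
  have h1 := irr_span hρ U hU0
  rw [LinearMap.range_eq_map, ← h1, Submodule.map_iSup]
  refine iSup_le fun g => ?_
  rintro _ ⟨_, ⟨x, hx, rfl⟩, rfl⟩
  by_cases hg : g ∈ H
  · rw [hfix _ (hU g hg x hx)]
    exact hU g hg x hx
  · have := LinearMap.congr_fun (h0 g hg) x
    simp only [Module.End.mul_apply, hfix x hx] at this
    rw [this]
    exact U.zero_mem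

end gen
end Genotype

namespace Genotype

section fwd
set_option linter.unusedSectionVars false
variable {k : Type} [Field k] [CharZero k] {G : Type} [Group G] [Fintype G]

theorem char_avg (W : FDRep k G) (K : Subgroup G) (h : G) :
    (Fintype.card K : k)⁻¹ * ∑ n : K, W.character (n * h) =
      LinearMap.trace k W (avgN W.ρ K * W.ρ h) := by
  rw [trace_avgN_mul]
  simp only [char_def, map_mul]

theorem galConj_eq {X : Type} {f f' : X → k} (h : IsGaloisConj f f') {x y : X} (hxy : f x = f y) :
    f' x = f' y := by
  obtain ⟨M, _, _, _, i, j, α, hα⟩ := h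
  have h1 := hα x
  have h2 := hα y
  have h3 : (⟨f x, mem_charField f x⟩ : charField f) = ⟨f y, mem_charField f y⟩ :=
    Subtype.ext hxy
  rw [h3, h2] at h1
  have := j.injective h1
  exact (congrArg Subtype.val this).symm

theorem galConj_nat {X : Type} {f f' : X → k} (h : IsGaloisConj f f') {x : X} {a b : ℕ}
    (hx : f x = a) (hx' : f' x = b) : a = b := by
  obtain ⟨M, _, _, _, i, j, α, hα⟩ := h
  have h1 := hα x
  have h3 : (⟨f x, mem_charField f x⟩ : charField f) = (a : charField f) :=
    Subtype.ext (by simpa using hx)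
  have h4 : (⟨f' x, mem_charField f' x⟩ : charField f') = (b : charField f') :=
    Subtype.ext (by simpa using hx')
  rw [h3, h4] at h1
  simp only [map_natCast] at h1
  have : CharZero M := algebraRat.charZero M
  exact_mod_cast h1

theorem tight_of_avg (ψ : FDRep k G) (hψ : IsIrr ψ) (H : Subgroup G) (K : Subgroup H)
    (e : ψ →ₗ[k] ψ) (hee : e = avgN (ψ.ρ.comp H.subtype) K)
    (hne : e ≠ 0)
    (hc : ∀ h ∈ H, e * ψ.ρ h = ψ.ρ h * e)
    (h0 : ∀ g ∉ H, e * ψ.ρ g * e = 0) :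
    TightInd H ψ.character (fun h => LinearMap.trace k ψ (e * ψ.ρ h)) := by
  have he : e * e = e := by rw [hee]; exact avgN_idem _ _
  have hKc : (Fintype.card K : k) ≠ 0 := by exact_mod_cast Fintype.card_ne_zero
  have hen : ∀ n : H, n ∈ K → e * ψ.ρ n = e := fun n hn => by
    rw [hee]; exact avgN_mul (ψ.ρ.comp H.subtype) K n hn
  set d := Module.finrank k (LinearMap.range e) with hd
  have htr : LinearMap.trace k ψ e = d := trace_idem e he
  have hd0 : d ≠ 0 := fun h => hne (eq_zero_of_trace e he (by rw [htr, h, Nat.cast_zero]))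
  refine ⟨?_, ?_, ?_⟩
  · ext g
    exact ind_char ψ.ρ e H hψ he hne hc h0 g
  · obtain ⟨W, hW⟩ := exists_cut (ψ.ρ.comp H.subtype) (1 - e)
      (by simp [sub_mul, mul_sub, he]) (fun g => by
        simp only [sub_mul, mul_sub, one_mul, mul_one]
        congr 1
        exact hc g g.2)
    have hW' : ∀ h : H, W.character h =
        ψ.character h - LinearMap.trace k ψ (e * ψ.ρ h) := fun h => by
      rw [hW, sub_mul, map_sub, one_mul]; rfl
    refine ⟨W, ?_, ?_⟩
    · ext h
      simp only [Pi.add_apply, one_smul, hW', resChar]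
      ring
    · rintro ⟨W', h'⟩
      have h1 := char_avg W' K 1
      have h2 : ∀ n : K, W'.character (n * 1) = W.character n - d := fun n => by
        rw [mul_one, h', Pi.add_apply, hen n n.2, htr]; ring
      have h3 : ∑ n : K, W.character n = 0 := by
        have : (Fintype.card K : k)⁻¹ * ∑ n : K, W.character n =
            LinearMap.trace k ψ (e * (1 - e)) := by
          rw [hee, trace_avgN_mul, ← hee]
          congr 1
          refine Finset.sum_congr rfl fun n _ => ?_
          rw [hW, LinearMap.trace_mul_comm]
        rw [mul_sub, mul_one, he, sub_self, map_zero] at this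
        exact (mul_eq_zero.1 this).resolve_left (inv_ne_zero hKc)
      rw [map_one, mul_one, trace_idem _ (avgN_idem _ _)] at h1
      simp only [h2, Finset.sum_sub_distrib, h3, Finset.sum_const, Finset.card_univ,
        nsmul_eq_mul, zero_sub, mul_neg] at h1
      rw [inv_mul_cancel_left₀ hKc, neg_eq_iff_add_eq_zero] at h1
      norm_cast at h1
      omega
  · rintro _ ⟨V', hV', rfl⟩ hgal ⟨W', hW'⟩
    have h1 : ∀ n ∈ K, LinearMap.trace k V' (V'.ρ n) = (Module.finrank k V' : k) := by
      intro n hn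
      have : V'.character n = V'.character 1 := galConj_eq hgal (by
        rw [hen n hn, hen 1 K.one_mem])
      rw [← char_def, this, char_def, map_one, LinearMap.trace_one]
    have h2 := triv_of_trace V'.ρ K h1
    have h3 : d = Module.finrank k V' := galConj_nat hgal (x := 1)
      (by rw [hen 1 K.one_mem, htr]) (by rw [char_def, map_one, LinearMap.trace_one])
    have key : ∀ h : H, LinearMap.trace k ψ (e * ψ.ρ h) = V'.character h +
        LinearMap.trace k W' (avgN W'.ρ K * W'.ρ h) := by
      intro h
      have a2 := char_avg V' K h
      rw [h2, one_mul, ← char_def] at a2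
      rw [← char_avg W' K h, ← a2, ← mul_add, ← Finset.sum_add_distrib, hee, trace_avgN_mul]
      congr 1
      refine Finset.sum_congr rfl fun n _ => ?_
      have := congrFun hW' (n * h)
      rw [Pi.add_apply] at this
      rw [← this]
      simp only [resChar, char_def, Subgroup.coe_mul, map_mul]
      rfl
    have h4 : avgN W'.ρ K = 0 := by
      apply eq_zero_of_trace _ (avgN_idem _ _)
      have := key 1
      rw [hen 1 K.one_mem, htr, char_def, map_one, LinearMap.trace_one, map_one, mul_one, ← h3] at this
      simpa using this
    ext h
    rw [key h, h4, zero_mul, map_zero, add_zero]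

theorem fwd_N (ψ : FDRep k G) (hψ : IsIrr ψ) (N : Subgroup G) (hN : N ≠ ⊥)
    (hne : avgN ψ.ρ N ≠ 0)
    (h0 : ∀ g ∉ Subgroup.normalizer (N : Set G), avgN ψ.ρ N * ψ.ρ g * avgN ψ.ρ N = 0) :
    ∃ (H : Subgroup G) (K : Subgroup H) (_ : K.Normal) (φ : FDRep k (H ⧸ K)),
        (H ≠ ⊤ ∨ K ≠ ⊥) ∧ IsIrr φ ∧ TightIndSub H K ψ.character φ.character := by
  set H := Subgroup.normalizer (N : Set G) with hH
  have hNH : N ≤ H := Subgroup.le_normalizer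
  set K := N.subgroupOf H with hK
  have hKn : K.Normal := Subgroup.normal_in_normalizer
  have hee : avgN ψ.ρ N = avgN (ψ.ρ.comp H.subtype) K := by
    rw [avgN, avgN]
    have : Fintype.card N = Fintype.card K :=
      Fintype.card_congr (Subgroup.subgroupOfEquivOfLe hNH).symm.toEquiv
    rw [this]
    congr 1
    exact Fintype.sum_equiv (Subgroup.subgroupOfEquivOfLe hNH).symm.toEquiv _ _ (fun x => rfl)
  set e := avgN ψ.ρ N with he_def
  have he : e * e = e := avgN_idem _ _
  have hc : ∀ h ∈ H, e * ψ.ρ h = ψ.ρ h * e := by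
    intro h hh
    rw [he_def, avgN, smul_mul_assoc, mul_smul_comm, sumN, Finset.sum_mul, Finset.mul_sum]
    congr 1
    have hh' := fun n => (Subgroup.mem_normalizer_iff.1 (H.inv_mem hh)) n
    refine Fintype.sum_equiv ⟨fun n : N => (⟨h⁻¹ * n * h, by simpa using (hh' n).1 n.2⟩ : N),
      fun n => ⟨h * n * h⁻¹, ((Subgroup.mem_normalizer_iff.1 hh) n).1 n.2⟩,
      fun n => Subtype.ext (by simp [mul_assoc]), fun n => Subtype.ext (by simp [mul_assoc])⟩ _ _
      (fun n => ?_)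
    simp only [Equiv.coe_fn_mk, ← map_mul, mul_assoc, mul_inv_cancel_left]
  have hc' : ∀ g : H, e * (ψ.ρ.comp H.subtype) g = (ψ.ρ.comp H.subtype) g * e := fun g => hc g g.2
  have hen : ∀ n : H, n ∈ K → ψ.ρ n * e = e := fun n hn => by
    rw [hee]; exact mul_avgN (ψ.ρ.comp H.subtype) K n hn
  let σ := cutRep (ψ.ρ.comp H.subtype) e he hc'
  have hσ : ∀ n ∈ K, σ n = 1 := by
    intro n hn
    ext ⟨x, y, rfl⟩
    rw [cutRep_coe]
    exact LinearMap.congr_fun (hen n hn) y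
  let τ : (H ⧸ K) →* (LinearMap.range e →ₗ[k] LinearMap.range e) := QuotientGroup.lift K σ hσ
  have hτ : ∀ h : H, ∀ x, ((τ (QuotientGroup.mk h)) x : ψ) = ψ.ρ h x := fun h x =>
    cutRep_coe (ψ.ρ.comp H.subtype) e he hc' h x
  refine ⟨H, K, hKn, FDRep.of τ, Or.inr ?_, ?_, ?_⟩
  · intro hb
    apply hN
    rw [hK, Subgroup.subgroupOf_eq_bot] at hb
    exact hb.eq_bot_of_le hNH
  · have : Irr τ := by
      refine ⟨?_, ?_⟩
      · rw [Submodule.nontrivial_iff_ne_bot]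
        exact fun h => hne (LinearMap.range_eq_bot.1 h)
      · intro U hU
        by_cases hU0 : U = ⊥
        · exact Or.inl hU0
        right
        have := irr_cut ψ.ρ e H hψ he h0 (U.map (LinearMap.range e).subtype)
          (Submodule.map_subtype_le _ _) (by
            rintro h hh _ ⟨x, hx, rfl⟩
            exact ⟨_, hU (QuotientGroup.mk ⟨h, hh⟩) x hx, hτ ⟨h, hh⟩ x⟩)
          (fun h => hU0 (Submodule.map_injective_of_injective (Submodule.injective_subtype _)
            (by rw [h, Submodule.map_bot])))
        rw [eq_top_iff]
        intro x _
        have hx : (x : ψ) ∈ U.map (LinearMap.range e).subtype := by rw [this]; exact x.2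
        obtain ⟨y, hy, hyx⟩ := hx
        rwa [← Subtype.ext hyx]
    exact this
  · have h1 := tight_of_avg ψ hψ H K e hee hne hc h0
    have h2 : (fun h : H => (FDRep.of τ).character (QuotientGroup.mk h)) =
        fun h : H => LinearMap.trace k ψ (e * ψ.ρ h) := by
      ext h
      exact cutRep_trace (ψ.ρ.comp H.subtype) e he hc' h
    unfold TightIndSub
    rw [h2]
    exact h1

end fwd
end Genotype

namespace Genotype

section fwd2
set_option linter.unusedSectionVars false
variable {k : Type} [Field k] [CharZero k] {G : Type} [Group G] [Fintype G]

theorem fwd_faithful (ψ : FDRep k G) (hψ : IsIrr ψ) (hf : ¬ IsFaithfulRep ψ) :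
    ∃ (H : Subgroup G) (K : Subgroup H) (_ : K.Normal) (φ : FDRep k (H ⧸ K)),
        (H ≠ ⊤ ∨ K ≠ ⊥) ∧ IsIrr φ ∧ TightIndSub H K ψ.character φ.character := by
  have hnt : Nontrivial ψ := hψ.1
  have h1 : avgN ψ.ρ (MonoidHom.ker ψ.ρ) = 1 := by
    have := avgN_fix ψ.ρ (MonoidHom.ker ψ.ρ) 1 (fun n hn => by
      rw [mul_one]; exact hn)
    rwa [mul_one] at this
  refine fwd_N ψ hψ (MonoidHom.ker ψ.ρ) ?_ ?_ ?_
  · intro h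
    exact hf ((MonoidHom.ker_eq_bot_iff ψ.ρ).1 h)
  · intro h0
    apply one_ne_zero (α := Module.End k ψ)
    refine Eq.trans h1.symm ?_
    convert h0
  · intro g hg
    rw [Subgroup.normalizer_eq_top] at hg
    exact absurd trivial hg

theorem cyclic_of_free {V : Type} [AddCommGroup V] [Module k V] [FiniteDimensional k V] [Nontrivial V]
    (ρ : G →* (V →ₗ[k] V)) (A : Subgroup G) (hA : ∀ x ∈ A, ∀ y ∈ A, x * y = y * x)
    (h : ∀ N ≤ A, avgN ρ N ≠ 0 → N = ⊥) : IsCyclic A := by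
  let s : Set (Module.End k V) := ρ '' A
  let R := Algebra.adjoin k s
  letI : CommRing R := Algebra.adjoinCommRingOfComm k (by
    rintro _ ⟨x, hx, rfl⟩ _ ⟨y, hy, rfl⟩
    rw [← map_mul, ← map_mul, hA x hx y hy])
  obtain ⟨m, hm⟩ := Ideal.exists_maximal R
  let f0 : A →* R :=
    { toFun := fun a => ⟨ρ a, Algebra.subset_adjoin ⟨a, a.2, rfl⟩⟩
      map_one' := Subtype.ext (by simp)
      map_mul' := fun a b => Subtype.ext (by simp) }
  let f : A →* R ⧸ m := (Ideal.Quotient.mk m : R →* R ⧸ m).comp f0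
  have hfe : ∀ a, f a = Ideal.Quotient.mk m (f0 a) := fun a => rfl
  haveI : IsDomain (R ⧸ m) := Ideal.Quotient.isDomain m
  refine isCyclic_of_injective_ringHom f ((MonoidHom.ker_eq_bot_iff f).1 ?_)
  have h1 := h (f.ker.map A.subtype) (Subgroup.map_subtype_le _) ?_
  · exact (Subgroup.map_eq_bot_iff_of_injective _ (Subgroup.subtype_injective A)).1 h1
  · intro h0
    have hs : sumN ρ (f.ker.map A.subtype) = 0 := by
      have hc : (Fintype.card (f.ker.map A.subtype) : k) ≠ 0 := by
        exact_mod_cast Fintype.card_ne_zero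
      rw [avgN] at h0
      exact (smul_eq_zero.1 h0).resolve_left (inv_ne_zero hc)
    have hs2 : ∑ n : f.ker, f0 n = 0 := by
      apply Subtype.ext
      rw [AddSubmonoidClass.coe_finsetSum]
      rw [sumN] at hs
      rw [ZeroMemClass.coe_zero, ← hs]
      exact Fintype.sum_equiv
        (Subgroup.equivMapOfInjective f.ker A.subtype (Subgroup.subtype_injective A)).toEquiv
        _ _ (fun x => rfl)
    have hs3 := congrArg (Ideal.Quotient.mk m) hs2
    rw [map_sum, map_zero] at hs3
    have hs4 : ∀ n : f.ker, Ideal.Quotient.mk m (f0 n) = 1 := fun n => n.2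
    simp only [hs4, Finset.sum_const, Finset.card_univ, nsmul_eq_mul, mul_one] at hs3
    rw [← map_natCast (Ideal.Quotient.mk m), Ideal.Quotient.eq_zero_iff_mem] at hs3
    have hc : (Fintype.card f.ker : k) ≠ 0 := by exact_mod_cast Fintype.card_ne_zero
    have hu := (IsUnit.mk0 _ hc).map (algebraMap k R)
    rw [map_natCast] at hu
    exact hm.ne_top (m.eq_top_of_isUnit_mem hs3 hu)

theorem fwd_roquette (ψ : FDRep k G) (hψ : IsIrr ψ) (hf : ¬ IsRoquette G) :
    ∃ (H : Subgroup G) (K : Subgroup H) (_ : K.Normal) (φ : FDRep k (H ⧸ K)),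
        (H ≠ ⊤ ∨ K ≠ ⊥) ∧ IsIrr φ ∧ TightIndSub H K ψ.character φ.character := by
  have hnt : Nontrivial ψ := hψ.1
  unfold IsRoquette at hf
  push Not at hf
  obtain ⟨A, hAn, hAc, hA⟩ := hf
  have h1 : ∃ N ≤ A, avgN ψ.ρ N ≠ 0 ∧ N ≠ ⊥ := by
    by_contra hcon
    push Not at hcon
    exact hA (cyclic_of_free ψ.ρ A hAc hcon)
  obtain ⟨N0, hN0⟩ := h1
  obtain ⟨N, hle, hN⟩ := (Set.toFinite {N : Subgroup G | N ≤ A ∧ avgN ψ.ρ N ≠ 0}).exists_le_maximal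
    (show N0 ∈ {N : Subgroup G | N ≤ A ∧ avgN ψ.ρ N ≠ 0} from ⟨hN0.1, hN0.2.1⟩)
  refine fwd_N ψ hψ N (fun h => hN0.2.2 (le_bot_iff.1 (h ▸ hle))) hN.prop.2 ?_
  intro g hg
  by_contra hne
  apply hg
  -- the conjugate
  set e := avgN ψ.ρ N
  set T := e * ψ.ρ g * e with hT
  have hTN : ∀ n ∈ N, ψ.ρ n * T = T := fun n hn => by
    rw [hT, mul_assoc, ← mul_assoc, mul_avgN ψ.ρ N n hn]
  have hA' : ∀ n ∈ N, g * n * g⁻¹ ∈ A := fun n hn => hAn.conj_mem n (hN.prop.1 hn) g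
  have hTg : ∀ n ∈ N, ψ.ρ (g * n * g⁻¹) * T = T := fun n hn => by
    have hcomm : ψ.ρ (g * n * g⁻¹) * e = e * ψ.ρ (g * n * g⁻¹) := by
      rw [show e = avgN ψ.ρ N from rfl, avgN, mul_smul_comm, smul_mul_assoc, sumN, Finset.mul_sum,
        Finset.sum_mul]
      congr 1
      refine Finset.sum_congr rfl fun m _ => ?_
      rw [← map_mul, ← map_mul, hAc _ (hA' n hn) _ (hN.prop.1 m.2)]
    have : ψ.ρ (g * n * g⁻¹) * ψ.ρ g = ψ.ρ g * ψ.ρ n := by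
      rw [← map_mul, ← map_mul]; simp
    rw [hT, ← mul_assoc, ← mul_assoc, hcomm, mul_assoc e, this, mul_assoc, mul_assoc, mul_avgN ψ.ρ N n hn,
      mul_assoc]
  set L := N ⊔ N.map (MulAut.conj g).toMonoidHom with hL
  have hfix : ∀ x ∈ L, ψ.ρ x * T = T := by
    have : L ≤ { carrier := {x | ψ.ρ x * T = T}
                 mul_mem' := fun {a b} ha hb => by
                  simp only [Set.mem_ofPred_eq] at *
                  rw [map_mul, mul_assoc, hb, ha]
                 one_mem' := by simp
                 inv_mem' := fun {a} ha => by
                  simp only [Set.mem_ofPred_eq] at *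
                  nth_rw 1 [← ha]
                  rw [← mul_assoc, rho_inv', one_mul] : Subgroup G } := by
      refine sup_le (fun n hn => hTN n hn) ?_
      rintro _ ⟨n, hn, rfl⟩
      exact hTg n hn
    exact fun x hx => this hx
  have hLA : L ≤ A := by
    refine sup_le hN.prop.1 ?_
    rintro _ ⟨n, hn, rfl⟩
    exact hA' n hn
  have hLe : avgN ψ.ρ L ≠ 0 := by
    intro h
    have := avgN_fix ψ.ρ L T hfix
    rw [h, zero_mul] at this
    exact hne this.symm
  have hLN : L ≤ N := hN.le_of_ge ⟨hLA, hLe⟩ le_sup_left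
  have hmap : N.map (MulAut.conj g).toMonoidHom ≤ N := le_sup_right.trans hLN
  rw [Subgroup.mem_normalizer_iff_map_conj_eq]
  refine Subgroup.eq_of_le_of_card_ge hmap (le_of_eq ?_)
  exact (Nat.card_congr (Subgroup.equivMapOfInjective N _ (MulAut.conj g).injective).toEquiv)

end fwd2
end Genotype

namespace Genotype

section ct
set_option linter.unusedSectionVars false
variable {k : Type} [Field k] [CharZero k] {H : Type} [Group H] [Fintype H]

theorem hom_zero (φ U : FDRep k H) (hφ : IsIrr φ) (hno : ¬ CharOccurs φ.character U.character)
    (T : φ →ₗ[k] U) (hT : ∀ h, T ∘ₗ φ.ρ h = U.ρ h ∘ₗ T) : T = 0 := by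
  by_contra hT0
  apply hno
  have hc : (Fintype.card H : k) ≠ 0 := by exact_mod_cast Fintype.card_ne_zero
  have hker : LinearMap.ker T = ⊥ := by
    refine (hφ.2 (LinearMap.ker T) (fun g x hx => ?_)).resolve_right
      (fun h => hT0 (LinearMap.ker_eq_top.1 h))
    have := LinearMap.congr_fun (hT g) x
    simp only [LinearMap.comp_apply] at this
    rw [LinearMap.mem_ker] at hx ⊢
    rw [this, hx, map_zero]
  obtain ⟨S, hS⟩ := LinearMap.exists_leftInverse_of_injective T hker
  let S' : U →ₗ[k] φ := (Fintype.card H : k)⁻¹ • ∑ h : H, φ.ρ h⁻¹ ∘ₗ S ∘ₗ U.ρ h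
  have hφi : ∀ h : H, φ.ρ h⁻¹ ∘ₗ φ.ρ h = LinearMap.id := fun h => rho_inv' φ.ρ h
  have hS'T : S' ∘ₗ T = LinearMap.id := by
    have h1 : ∀ h : H, (φ.ρ h⁻¹ ∘ₗ S ∘ₗ U.ρ h) ∘ₗ T = LinearMap.id := by
      intro h
      rw [LinearMap.comp_assoc, LinearMap.comp_assoc, ← hT h, ← LinearMap.comp_assoc _ T S, hS,
        LinearMap.id_comp, hφi]
    ext x
    have h2 : ∀ h : H, φ.ρ h⁻¹ (S (U.ρ h (T x))) = x := fun h => LinearMap.congr_fun (h1 h) x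
    simp only [S', LinearMap.comp_apply, LinearMap.smul_apply, LinearMap.sum_apply, h2,
      Finset.sum_const, Finset.card_univ, LinearMap.id_apply]
    rw [← Nat.cast_smul_eq_nsmul k, smul_smul, inv_mul_cancel₀ hc, one_smul]
  have hS'e : ∀ g, S' ∘ₗ U.ρ g = φ.ρ g ∘ₗ S' := by
    intro g
    ext x
    simp only [S', LinearMap.comp_apply, LinearMap.smul_apply, LinearMap.sum_apply, map_smul, map_sum]
    congr 1
    refine Fintype.sum_equiv (Equiv.mulRight g) _ _ (fun h => ?_)
    simp only [Equiv.coe_mulRight, mul_inv_rev, map_mul, Module.End.mul_apply]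
    have := LinearMap.congr_fun (rho_inv φ.ρ g) (φ.ρ h⁻¹ (S (U.ρ h (U.ρ g x))))
    simp only [Module.End.mul_apply, Module.End.one_apply] at this
    rw [this]
  have hTS : ∀ x, S' (T x) = x := fun x => LinearMap.congr_fun hS'T x
  obtain ⟨W, hW⟩ := exists_cut U.ρ (1 - T ∘ₗ S' : U →ₗ[k] U)
    (by
      ext x
      simp [hTS])
    (by
      intro g
      have h1 : (T ∘ₗ S') * U.ρ g = U.ρ g * (T ∘ₗ S') := by
        change (T ∘ₗ S') ∘ₗ U.ρ g = U.ρ g ∘ₗ (T ∘ₗ S')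
        rw [LinearMap.comp_assoc, hS'e, ← LinearMap.comp_assoc, hT, LinearMap.comp_assoc]
      rw [sub_mul, mul_sub, h1, one_mul, mul_one])
  refine ⟨W, ?_⟩
  ext h
  rw [Pi.add_apply, hW, sub_mul, one_mul, map_sub]
  have : LinearMap.trace k U ((T ∘ₗ S') * U.ρ h) = φ.character h := by
    change LinearMap.trace k U ((T ∘ₗ S') ∘ₗ U.ρ h) = _
    rw [LinearMap.comp_assoc, hS'e, LinearMap.trace_comp_comm', LinearMap.comp_assoc, hS'T,
      LinearMap.comp_id]
    rfl
  rw [this, char_def U]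
  ring

theorem z_zero (φ U : FDRep k H) (hφ : IsIrr φ) (hno : ¬ CharOccurs φ.character U.character) :
    ∑ x : H, φ.character x⁻¹ • U.ρ x = 0 := by
  have h1 : ∀ T : φ →ₗ[k] U, ∑ x : H, U.ρ x ∘ₗ T ∘ₗ φ.ρ x⁻¹ = 0 := by
    intro T
    refine hom_zero φ U hφ hno _ (fun g => ?_)
    ext v
    simp only [LinearMap.comp_apply, LinearMap.sum_apply, map_sum]
    refine Fintype.sum_equiv (Equiv.mulLeft g⁻¹) _ _ (fun h => ?_)
    simp only [Equiv.coe_mulLeft, mul_inv_rev, inv_inv, map_mul, Module.End.mul_apply]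
    have := LinearMap.congr_fun (rho_inv U.ρ g) (U.ρ h (T (φ.ρ h⁻¹ (φ.ρ g v))))
    simp only [Module.End.mul_apply, Module.End.one_apply] at this
    rw [this]
  let b := Module.finBasis k φ
  ext u
  have h2 : ∀ i, ∑ x : H, b.repr (φ.ρ x⁻¹ (b i)) i • U.ρ x u = 0 := by
    intro i
    have := LinearMap.congr_fun (h1 ((b.coord i).smulRight u)) (b i)
    simpa [LinearMap.sum_apply] using this
  have h3 : ∀ x : H, φ.character x⁻¹ = ∑ i, b.repr (φ.ρ x⁻¹ (b i)) i := by
    intro x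
    rw [char_def, LinearMap.trace_eq_matrix_trace k b, Matrix.trace]
    simp [LinearMap.toMatrix_apply]
  simp only [LinearMap.sum_apply, LinearMap.smul_apply, h3, Finset.sum_smul, LinearMap.zero_apply]
  rw [Finset.sum_comm]
  exact Finset.sum_eq_zero fun i _ => h2 i

theorem conv_zero (φ U : FDRep k H) (hφ : IsIrr φ) (hno : ¬ CharOccurs φ.character U.character)
    (h : H) : ∑ x : H, φ.character x⁻¹ * U.character (x * h) = 0 := by
  have := congrArg (fun T => LinearMap.trace k U (T * U.ρ h)) (z_zero φ U hφ hno)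
  simp only [Finset.sum_mul, smul_mul_assoc, map_sum, map_smul, zero_mul, map_zero, smul_eq_mul] at this
  rw [← this]
  simp only [char_def U, map_mul U.ρ]

theorem char_one_fd (Y : FDRep k H) : Y.character 1 = (Module.finrank k Y : k) := by
  rw [char_def, map_one, LinearMap.trace_one]

theorem decomp (φ : FDRep k H) (hφ : IsIrr φ) (d : ℕ) : ∀ Y : FDRep k H, Module.finrank k Y = d →
    ∃ (n : ℕ) (Y' : FDRep k H), Y.character = n • φ.character + Y'.character ∧
      ¬ CharOccurs φ.character Y'.character := by
  have hnt : Nontrivial φ := hφ.1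
  induction d using Nat.strong_induction_on with
  | _ d ih =>
    intro Y hY
    by_cases h : CharOccurs φ.character Y.character
    · obtain ⟨W, hW⟩ := h
      have h1 := congrFun hW 1
      rw [Pi.add_apply, char_one_fd, char_one_fd, char_one_fd] at h1
      norm_cast at h1
      have h2 : 0 < Module.finrank k φ := Module.finrank_pos
      obtain ⟨n, Y', h3, h4⟩ := ih (Module.finrank k W) (by omega) W rfl
      refine ⟨n + 1, Y', ?_, h4⟩
      rw [hW, h3, add_smul, one_smul]
      abel
    · exact ⟨0, Y, by simp, h⟩

theorem exists_reg : ∃ R : FDRep k H, ∀ h, R.character h = if h = 1 then (Fintype.card H : k) else 0 := by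
  let ρ : H →* ((H → k) →ₗ[k] (H → k)) :=
    { toFun := fun h => LinearMap.funLeft k k (fun x => h⁻¹ * x)
      map_one' := by ext; simp [LinearMap.funLeft_apply]
      map_mul' := fun a b => by
        refine LinearMap.ext fun f => funext fun x => ?_
        simp [LinearMap.funLeft_apply, mul_assoc] }
  refine ⟨FDRep.of ρ, fun h => ?_⟩
  rw [char_of, LinearMap.trace_eq_matrix_trace k (Pi.basisFun k H), Matrix.trace]
  have : ∀ i : H, Matrix.diag (LinearMap.toMatrix (Pi.basisFun k H) (Pi.basisFun k H) (ρ h)) i =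
      if h = 1 then 1 else 0 := by
    intro i
    simp [LinearMap.toMatrix_apply, ρ, LinearMap.funLeft_apply, Pi.single_apply]
  simp only [this]
  split_ifs <;> simp

theorem conv_self (φ : FDRep k H) (hφ : IsIrr φ) : ∃ n : ℕ, n ≠ 0 ∧ ∀ h,
    (n : k) * ∑ x : H, φ.character x⁻¹ * φ.character (x * h) = (Fintype.card H : k) * φ.character h := by
  have hnt : Nontrivial φ := hφ.1
  obtain ⟨R, hR⟩ := exists_reg (k := k) (H := H)
  obtain ⟨n, Y', h1, h2⟩ := decomp φ hφ _ R rfl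
  have key : ∀ h, (n : k) * ∑ x : H, φ.character x⁻¹ * φ.character (x * h) =
      (Fintype.card H : k) * φ.character h := by
    intro h
    have h3 : ∑ x : H, φ.character x⁻¹ * R.character (x * h) = (Fintype.card H : k) * φ.character h := by
      rw [Finset.sum_eq_single h⁻¹]
      · rw [hR]; simp [mul_comm]
      · intro x _ hx
        rw [hR, if_neg (fun h' => hx (eq_inv_of_mul_eq_one_left h')), mul_zero]
      · simp
    rw [← h3, h1]
    simp only [Pi.add_apply, Pi.smul_apply, mul_add, Finset.sum_add_distrib, conv_zero φ Y' hφ h2,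
      add_zero, nsmul_eq_mul, Finset.mul_sum, Pi.mul_apply, Pi.natCast_apply]
    exact Finset.sum_congr rfl fun x _ => by ring
  refine ⟨n, ?_, key⟩
  rintro rfl
  have := key 1
  rw [char_one_fd] at this
  simp only [Nat.cast_zero, zero_mul] at this
  norm_cast at this
  have h5 : 0 < Module.finrank k φ := Module.finrank_pos
  have h6 : 0 < Fintype.card H := Fintype.card_pos
  exact (Nat.mul_pos h6 h5).ne this

end ct
end Genotype

namespace Genotype

section ls
set_option linter.unusedSectionVars false
variable {k : Type} [Field k] [CharZero k] {G : Type} [Group G] [Fintype G]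
  {V : Type} [AddCommGroup V] [Module k V] [FiniteDimensional k V]
  (ρ : G →* (V →ₗ[k] V)) (H : Subgroup G)

theorem pre_exists (e : V →ₗ[k] V) (hc : ∀ h ∈ H, e * ρ h = ρ h * e) (g : G) (v : V) :
    ∃ u : G ⧸ H → LinearMap.range e, ∑ q : G ⧸ H, ρ q.out (u q) = ρ g (e v) ∧
      ∀ q, q ≠ QuotientGroup.mk g → u q = 0 := by
  have h1 : (Quotient.out (QuotientGroup.mk g : G ⧸ H))⁻¹ * g ∈ H :=
    QuotientGroup.eq.1 (QuotientGroup.out_eq' _)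
  have h2 : ρ ((Quotient.out (QuotientGroup.mk g : G ⧸ H))⁻¹ * g) (e v) ∈ LinearMap.range e :=
    ⟨ρ ((Quotient.out (QuotientGroup.mk g : G ⧸ H))⁻¹ * g) v, LinearMap.congr_fun (hc _ h1) v⟩
  refine ⟨Pi.single (QuotientGroup.mk g) ⟨_, h2⟩, ?_, fun q hq => Pi.single_eq_of_ne hq _⟩
  rw [Finset.sum_eq_single (QuotientGroup.mk g : G ⧸ H)]
  · rw [Pi.single_eq_same]
    rw [← Module.End.mul_apply, ← map_mul, mul_inv_cancel_left]
  · intro q _ hq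
    rw [Pi.single_eq_of_ne hq]
    simp
  · simp

theorem off_zero (e : V →ₗ[k] V) (hρ : Irr ρ) (he : e * e = e) (hne : e ≠ 0)
    (hc : ∀ h ∈ H, e * ρ h = ρ h * e) (c : H → k) (hec : e = ∑ x : H, c x • ρ x)
    (hd : Fintype.card H * Module.finrank k V = Fintype.card G * Module.finrank k (LinearMap.range e))
    (g : G) (hg : g ∉ H) : e * ρ g * e = 0 := by
  let Φ : (G ⧸ H → LinearMap.range e) →ₗ[k] V :=
    ∑ q : G ⧸ H, ρ q.out ∘ₗ (LinearMap.range e).subtype ∘ₗ LinearMap.proj q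
  have hΦ : ∀ u, Φ u = ∑ q : G ⧸ H, ρ q.out (u q) := by
    intro u; simp [Φ, LinearMap.sum_apply]
  have hsur : Function.Surjective Φ := by
    rw [← LinearMap.range_eq_top, ← top_le_iff, ← irr_span hρ (LinearMap.range e)
      (fun h => hne (LinearMap.range_eq_bot.1 h))]
    refine iSup_le fun g => ?_
    rintro _ ⟨_, ⟨v, rfl⟩, rfl⟩
    obtain ⟨u, hu, -⟩ := pre_exists ρ H e hc g v
    exact ⟨u, (hΦ u).trans hu⟩
  have hdim : Module.finrank k (G ⧸ H → LinearMap.range e) = Module.finrank k V := by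
    rw [Module.finrank_pi_fintype]
    simp only [Finset.sum_const, Finset.card_univ, smul_eq_mul]
    have h1 := Subgroup.card_eq_card_quotient_mul_card_subgroup H
    simp only [Nat.card_eq_fintype_card] at h1
    rw [h1] at hd
    have h2 : 0 < Fintype.card H := Fintype.card_pos
    apply Nat.eq_of_mul_eq_mul_left h2
    rw [hd]; ring
  have hinj : Function.Injective Φ :=
    (LinearMap.injective_iff_surjective_of_finrank_eq_finrank hdim).2 hsur
  ext v
  obtain ⟨u1, h1, h1'⟩ := pre_exists ρ H e hc 1 (ρ g (e v))
  have h2 : ∀ x : H, _ := fun x => pre_exists ρ H e hc (x * g) v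
  choose u2 h2 h2' using h2
  have h3 : u1 = ∑ x : H, c x • u2 x := by
    apply hinj
    rw [map_sum]
    simp only [map_smul]
    rw [hΦ, h1]
    simp only [hΦ, h2]
    rw [map_one, Module.End.one_apply]
    generalize e v = w
    rw [hec]
    simp [LinearMap.sum_apply]
  have h4 : u1 (QuotientGroup.mk 1) = 0 := by
    rw [h3, Finset.sum_apply]
    refine Finset.sum_eq_zero fun x _ => ?_
    rw [Pi.smul_apply, h2', smul_zero]
    intro h
    rw [QuotientGroup.eq] at h
    simp only [inv_one, one_mul] at h
    exact hg ((H.mul_mem_cancel_left x.2).1 h)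
  have h5 : u1 = 0 := by
    ext q
    by_cases hq : q = QuotientGroup.mk 1
    · rw [hq, h4]; rfl
    · rw [h1' q hq]; rfl
  rw [h5] at h1
  simpa using h1.symm

/-- central idempotent attached to a class function -/
def eF (f : H → k) (lam : k) : V →ₗ[k] V := lam⁻¹ • ∑ x : H, f x⁻¹ • ρ x

variable (f : H → k) (lam : k)

theorem eF_comm (hcl : ∀ x y, f (x * y) = f (y * x)) (h : G) (hh : h ∈ H) :
    eF ρ H f lam * ρ h = ρ h * eF ρ H f lam := by
  rw [eF, smul_mul_assoc, mul_smul_comm, Finset.sum_mul, Finset.mul_sum]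
  congr 1
  refine Fintype.sum_equiv (MulAut.conj (⟨h, hh⟩ : H)⁻¹).toEquiv _ _ (fun x => ?_)
  have h1 : f ((MulAut.conj (⟨h, hh⟩ : H)⁻¹).toEquiv x)⁻¹ = f x⁻¹ := by
    simp only [MulEquiv.toEquiv_eq_coe, EquivLike.coe_coe, MulAut.conj_apply, mul_inv_rev, inv_inv]
    rw [← mul_assoc, hcl]; simp
  rw [h1, smul_mul_assoc, mul_smul_comm, ← map_mul, ← map_mul]
  congr 2
  simp [mul_assoc]

theorem eF_idem (hl : lam ≠ 0) (hcl : ∀ x y, f (x * y) = f (y * x))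
    (h2 : ∀ h, ∑ x : H, f x⁻¹ * f (x * h) = lam * f h) :
    eF ρ H f lam * eF ρ H f lam = eF ρ H f lam := by
  have h3 : (∑ x : H, f x⁻¹ • ρ x) * (∑ x : H, f x⁻¹ • ρ x) = lam • ∑ x : H, f x⁻¹ • ρ x := by
    rw [Finset.sum_mul]
    have : ∀ x : H, f x⁻¹ • ρ x * (∑ y : H, f y⁻¹ • ρ y) = ∑ z : H, (f x⁻¹ * f (x * z⁻¹)) • ρ z := by
      intro x
      rw [Finset.mul_sum]
      refine Fintype.sum_equiv (Equiv.mulLeft x) _ _ (fun y => ?_)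
      rw [smul_mul_smul_comm, ← map_mul]
      simp only [Equiv.coe_mulLeft, mul_inv_rev, Subgroup.coe_mul]
      congr 2
      rw [← mul_assoc, hcl, ← mul_assoc]; simp
    simp only [this]
    rw [Finset.sum_comm, Finset.smul_sum]
    refine Finset.sum_congr rfl fun z _ => ?_
    rw [← Finset.sum_smul, h2, smul_smul]
  rw [eF, smul_mul_smul_comm, h3, smul_smul]
  congr 1
  field_simp

theorem eF_trace (hl : lam ≠ 0) 
    (h3 : ∀ h : H, ∑ x : H, f x⁻¹ * LinearMap.trace k V (ρ (x * h)) = lam * f h) (h : H) :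
    LinearMap.trace k V (eF ρ H f lam * ρ h) = f h := by
  rw [eF, smul_mul_assoc, map_smul, Finset.sum_mul, map_sum, smul_eq_mul, inv_mul_eq_iff_eq_mul₀ hl, ← h3]
  refine Finset.sum_congr rfl fun x _ => ?_
  rw [smul_mul_assoc, map_smul, map_mul ρ, smul_eq_mul]

theorem eF_all (hρ : Irr ρ) (hl : lam ≠ 0) (hcl : ∀ x y, f (x * y) = f (y * x))
    (h2 : ∀ h, ∑ x : H, f x⁻¹ * f (x * h) = lam * f h)
    (h3 : ∀ h : H, ∑ x : H, f x⁻¹ * LinearMap.trace k V (ρ (x * h)) = lam * f h)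
    (h4 : (Fintype.card H : k) * Module.finrank k V = Fintype.card G * f 1) (h5 : f 1 ≠ 0) :
    eF ρ H f lam ≠ 0 ∧ ∀ g ∉ H, eF ρ H f lam * ρ g * eF ρ H f lam = 0 := by
  have he := eF_idem ρ H f lam hl hcl h2
  have ht : LinearMap.trace k V (eF ρ H f lam) = f 1 := by
    have := eF_trace ρ H f lam hl h3 1
    simpa using this
  have hne : eF ρ H f lam ≠ 0 := by
    intro h; rw [h, map_zero] at ht; exact h5 ht.symm
  refine ⟨hne, fun g hg => off_zero ρ H _ hρ he hne (eF_comm ρ H f lam hcl) (fun x => lam⁻¹ * f x⁻¹) ?_ ?_ g hg⟩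
  · rw [eF, Finset.smul_sum]; simp only [smul_smul]
  · rw [← ht, trace_idem _ he] at h4
    exact_mod_cast h4

theorem eF_irrChar (hρ : Irr ρ) (hl : lam ≠ 0) (hcl : ∀ x y, f (x * y) = f (y * x))
    (h2 : ∀ h, ∑ x : H, f x⁻¹ * f (x * h) = lam * f h)
    (h3 : ∀ h : H, ∑ x : H, f x⁻¹ * LinearMap.trace k V (ρ (x * h)) = lam * f h)
    (h4 : (Fintype.card H : k) * Module.finrank k V = Fintype.card G * f 1) (h5 : f 1 ≠ 0) :
    IsIrrChar f ∧ CharOccurs f (resChar H (fun g => LinearMap.trace k V (ρ g))) := by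
  obtain ⟨hne, h0⟩ := eF_all ρ H f lam hρ hl hcl h2 h3 h4 h5
  have he := eF_idem ρ H f lam hl hcl h2
  have hc := eF_comm ρ H f lam hcl
  have htr := eF_trace ρ H f lam hl h3
  set e := eF ρ H f lam with hedef
  have hc' : ∀ h : H, e * (ρ.comp H.subtype) h = (ρ.comp H.subtype) h * e := fun h => hc h h.2
  constructor
  · refine ⟨FDRep.of (cutRep (ρ.comp H.subtype) e he hc'), ⟨?_, ?_⟩, ?_⟩
    · change Nontrivial (LinearMap.range e)
      rw [Submodule.nontrivial_iff_ne_bot]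
      exact fun h => hne (LinearMap.range_eq_bot.1 h)
    · intro U hU
      change Submodule k (LinearMap.range e) at U
      by_cases hU0 : U = ⊥
      · exact Or.inl hU0
      right
      have h6 := irr_cut ρ e H hρ he h0 (U.map (LinearMap.range e).subtype)
        (by rintro _ ⟨x, _, rfl⟩; exact x.2)
        (by
          rintro h hh _ ⟨x, hx, rfl⟩
          refine ⟨_, hU ⟨h, hh⟩ x hx, ?_⟩
          exact cutRep_coe (ρ.comp H.subtype) e he hc' ⟨h, hh⟩ x)
        (by
          intro h
          exact hU0 (Submodule.map_injective_of_injective (Submodule.injective_subtype _) (h.trans (Submodule.map_bot _).symm)))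
      rw [eq_top_iff]
      rintro ⟨x, hx⟩ -
      rw [← h6] at hx
      obtain ⟨y, hy, hyx⟩ := hx
      have : y = ⟨x, by rw [← hyx]; exact y.2⟩ := Subtype.ext hyx
      rw [← this]; exact hy
    · ext h
      rw [char_of, cutRep_trace]
      exact (htr h).symm
  · obtain ⟨W, hW⟩ := exists_cut (ρ.comp H.subtype) (1 - e)
      (by rw [sub_mul, mul_sub, mul_sub, he]; simp)
      (fun h => by rw [sub_mul, mul_sub, hc' h, one_mul, mul_one])
    refine ⟨W, ?_⟩
    ext h
    rw [Pi.add_apply, hW, sub_mul, one_mul, map_sub]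
    have : LinearMap.trace k V (e * (ρ.comp H.subtype) h) = f h := htr h
    rw [this]
    simp [resChar]

end ls
end Genotype

namespace Genotype

section gal
set_option linter.unusedSectionVars false

theorem tr_pow {K : Type} [Field K] [CharZero K] {V : Type} [AddCommGroup V] [Module K V]
    [FiniteDimensional K V] (n : ℕ) (hn : n ≠ 0) (ω : K) (hω : IsPrimitiveRoot ω n)
    (T : V →ₗ[K] V) (hT : T ^ n = 1) :
    ∃ d : ℕ → ℕ, ∀ s, LinearMap.trace K V (T ^ s) = ∑ i ∈ Finset.range n, ω ^ (i * s) * d i := by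
  have hω0 : ω ≠ 0 := hω.ne_zero hn
  have hnK : (n : K) ≠ 0 := by exact_mod_cast hn
  let P : ℕ → (V →ₗ[K] V) := fun i => (n : K)⁻¹ • ∑ j ∈ Finset.range n, (ω⁻¹) ^ (i * j) • T ^ j
  have hTP : ∀ i, T * P i = ω ^ i • P i := by
    intro i
    simp only [P, mul_smul_comm, Finset.mul_sum]
    rw [smul_comm (ω ^ i)]
    congr 1
    have h1 : ∀ j, ω⁻¹ ^ (i * j) • (T * T ^ j) = ω ^ i • (ω⁻¹ ^ (i * (j + 1)) • T ^ (j + 1)) := by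
      intro j
      rw [smul_smul, pow_succ' T, mul_add, pow_add, mul_one]
      congr 1
      rw [mul_left_comm, ← mul_pow, mul_inv_cancel₀ hω0, one_pow, mul_one]
    simp only [h1]
    rw [← Finset.smul_sum]
    congr 1
    have h2 := Finset.sum_range_succ (fun j => ω⁻¹ ^ (i * j) • T ^ j) n
    rw [Finset.sum_range_succ'] at h2
    have h3 : ω⁻¹ ^ (i * n) • T ^ n = ω⁻¹ ^ (i * 0) • T ^ 0 := by
      rw [hT, mul_comm i n, pow_mul, inv_pow, hω.pow_eq_one]; simp
    rw [h3] at h2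
    exact add_right_cancel h2
  have hTsP : ∀ s i, T ^ s * P i = ω ^ (i * s) • P i := by
    intro s i
    induction s with
    | zero => simp
    | succ s ih => rw [pow_succ, mul_assoc, hTP, mul_smul_comm, ih, smul_smul, ← pow_add, mul_add, mul_one, add_comm]
  have hidem : ∀ i, P i * P i = P i := by
    intro i
    conv_lhs => rw [show P i = (n : K)⁻¹ • ∑ j ∈ Finset.range n, (ω⁻¹) ^ (i * j) • T ^ j from rfl]
    rw [smul_mul_assoc, Finset.sum_mul]
    have : ∀ j, (ω⁻¹) ^ (i * j) • T ^ j * P i = P i := by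
      intro j
      rw [smul_mul_assoc, hTsP, smul_smul, ← mul_pow, inv_mul_cancel₀ hω0, one_pow, one_smul]
    change (n : K)⁻¹ • ∑ j ∈ Finset.range n, (ω⁻¹) ^ (i * j) • T ^ j * P i = P i
    simp only [this, Finset.sum_const, Finset.card_range]
    rw [← Nat.cast_smul_eq_nsmul K, smul_smul, inv_mul_cancel₀ hnK, one_smul]
  have hsum : ∑ i ∈ Finset.range n, P i = 1 := by
    simp only [P]
    rw [← Finset.smul_sum, Finset.sum_comm]
    rw [Finset.sum_eq_single 0]
    · simp only [mul_zero, pow_zero, one_smul, Finset.sum_const, Finset.card_range]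
      rw [← Nat.cast_smul_eq_nsmul K, smul_smul, inv_mul_cancel₀ hnK, one_smul]
    · intro j hj hj0
      rw [← Finset.sum_smul]
      have h1 : ∑ i ∈ Finset.range n, ω⁻¹ ^ (i * j) = 0 := by
        have h2 : ω⁻¹ ^ j ≠ 1 := hω.inv.pow_ne_one_of_pos_of_lt hj0 (Finset.mem_range.1 hj)
        have h3 := mul_neg_geom_sum (ω⁻¹ ^ j) n
        rw [← pow_mul, mul_comm j n, pow_mul, hω.inv.pow_eq_one, one_pow, sub_self] at h3
        simp only [← pow_mul] at h3
        simp only [mul_comm _ j]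
        exact (mul_eq_zero.1 h3).resolve_left (sub_ne_zero.2 h2.symm)
      rw [h1, zero_smul]
    · intro h
      exact absurd (Finset.mem_range.2 (Nat.pos_of_ne_zero hn)) h
  refine ⟨fun i => Module.finrank K (LinearMap.range (P i)), fun s => ?_⟩
  rw [← mul_one (T ^ s), ← hsum, Finset.mul_sum, map_sum]
  refine Finset.sum_congr rfl fun i _ => ?_
  rw [hTsP, map_smul, trace_idem _ (hidem i), smul_eq_mul]

variable (k : Type) [Field k] [CharZero k]

theorem exists_gal (n : ℕ) (hn : n ≠ 0) (r : ℕ) (hr : r.Coprime n) :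
    ∃ (M : Type) (_ : Field M) (_ : Algebra ℚ M) (_ : IsGalois ℚ M) (σ : M →+* AlgebraicClosure k)
      (α : M ≃+* M), ∀ (V : Type) [AddCommGroup V] [Module k V] [FiniteDimensional k V]
      (T : V →ₗ[k] V), T ^ n = 1 → ∃ m : M,
        σ m = algebraMap k (AlgebraicClosure k) (LinearMap.trace k V T) ∧
        σ (α m) = algebraMap k (AlgebraicClosure k) (LinearMap.trace k V (T ^ r)) := by
  have : NeZero n := ⟨hn⟩
  obtain ⟨M, _, _, _⟩ : ∃ (M : Type) (_ : Field M) (_ : Algebra ℚ M), IsCyclotomicExtension {n} ℚ M :=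
    ⟨CyclotomicField n ℚ, inferInstance, CyclotomicField.algebra n ℚ,
      CyclotomicField.isCyclotomicExtension n ℚ⟩
  have hirr := Polynomial.cyclotomic.irreducible_rat (Nat.pos_of_ne_zero hn)
  let ζ : M := IsCyclotomicExtension.zeta n ℚ M
  have hζ : IsPrimitiveRoot ζ n := IsCyclotomicExtension.zeta_spec n ℚ M
  have hζr : IsPrimitiveRoot (ζ ^ r) n := hζ.pow_of_coprime r hr
  let α : Gal(M/ℚ) := IsCyclotomicExtension.fromZetaAut hζr hirr
  have hα : α ζ = ζ ^ r := IsCyclotomicExtension.fromZetaAut_spec hζr hirr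
  have : Module.Finite ℚ M := IsCyclotomicExtension.finite {n} ℚ M
  obtain ⟨σ⟩ : Nonempty (M →ₐ[ℚ] AlgebraicClosure k) := ⟨IsAlgClosed.lift⟩
  refine ⟨M, inferInstance, inferInstance, IsCyclotomicExtension.isGalois {n} ℚ M, σ.toRingHom,
    α.toRingEquiv, ?_⟩
  intro V _ _ _ T hT
  have hσζ : IsPrimitiveRoot (σ ζ) n := hζ.map_of_injective σ.toRingHom.injective
  have hbc : ∀ s, LinearMap.trace (AlgebraicClosure k) _ ((T.baseChange (AlgebraicClosure k)) ^ s) =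
      algebraMap k (AlgebraicClosure k) (LinearMap.trace k V (T ^ s)) := by
    intro s
    rw [← LinearMap.trace_baseChange, LinearMap.baseChange_pow]
  have hTn : (T.baseChange (AlgebraicClosure k)) ^ n = 1 := by
    rw [← LinearMap.baseChange_pow, hT, LinearMap.baseChange_one]
  obtain ⟨d, hd⟩ := tr_pow n hn (σ ζ) hσζ _ hTn
  refine ⟨∑ i ∈ Finset.range n, ζ ^ i * d i, ?_, ?_⟩
  · have := hd 1
    rw [hbc, pow_one] at this
    rw [this]
    simp
  · have := hd r
    rw [hbc] at this
    rw [this]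
    simp [hα, ← pow_mul, mul_comm r]

theorem exists_lift {M L : Type} [Field M] [Field L] (σ : M →+* L) (ι : k →+* L) {X : Type} (f : X → k)
    (h : ∀ x, ∃ m, σ m = ι (f x)) :
    ∃ i : charField f →+* M, ∀ x, σ (i x) = ι x := by
  have hle : charField f ≤ σ.fieldRange.comap ι := by
    rw [charField, Subfield.closure_le]
    rintro _ ⟨x, rfl⟩
    exact h x
  let e : M ≃+* σ.fieldRange := RingEquiv.ofBijective σ.rangeRestrictField
    ⟨σ.rangeRestrictField.injective, σ.rangeRestrictField_bijective.2⟩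
  let j : charField f →+* σ.fieldRange :=
    (ι.comp (charField f).subtype).codRestrict σ.fieldRange (fun x => hle x.2)
  refine ⟨e.symm.toRingHom.comp j, fun x => ?_⟩
  have : e (e.symm (j x)) = j x := e.apply_symm_apply _
  exact congrArg Subtype.val this

variable {k}

theorem gal_transfer {H : Type} [Group H] [Fintype H] (φ U : FDRep k H) (n : ℕ) (hn : n ≠ 0)
    (hH : ∀ h : H, h ^ n = 1) (r : ℕ) (hr : r.Coprime n)
    (hU : ∀ h, U.character (h ^ r) = U.character h) (a b : ℕ)
    (h2 : ∀ h, (a : k) * ∑ x : H, φ.character x⁻¹ * φ.character (x * h) = b * φ.character h)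
    (h3 : ∀ h, (a : k) * ∑ x : H, φ.character x⁻¹ * U.character (x * h) = b * φ.character h) :
    IsGaloisConj φ.character (fun h => φ.character (h ^ r)) ∧
    (∀ h, (a : k) * ∑ x : H, φ.character (x⁻¹ ^ r) * φ.character ((x * h) ^ r) =
      b * φ.character (h ^ r)) ∧
    (∀ h, (a : k) * ∑ x : H, φ.character (x⁻¹ ^ r) * U.character (x * h) =
      b * φ.character (h ^ r)) := by
  obtain ⟨M, _, _, hgal, σ, α, hM⟩ := exists_gal k n hn r hr
  let ι := algebraMap k (AlgebraicClosure k)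
  have hlift : ∀ (Y : FDRep k H), ∃ χ : H → M, (∀ h, σ (χ h) = ι (Y.character h)) ∧
      (∀ h, σ (α (χ h)) = ι (Y.character (h ^ r))) := by
    intro Y
    have : ∀ h : H, ∃ m : M, σ m = ι (Y.character h) ∧ σ (α m) = ι (Y.character (h ^ r)) := by
      intro h
      obtain ⟨m, h1, h2⟩ := hM Y (Y.ρ h) (by rw [← map_pow, hH, map_one])
      refine ⟨m, h1, ?_⟩
      rw [h2, char_def, map_pow Y.ρ]
    choose χ h1 h2 using this
    exact ⟨χ, h1, h2⟩
  obtain ⟨χ, hχ, hχ'⟩ := hlift φ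
  obtain ⟨τ, hτ, hτ'⟩ := hlift U
  refine ⟨?_, ?_, ?_⟩
  · obtain ⟨i, hi⟩ := exists_lift k σ ι φ.character (fun h => ⟨_, hχ h⟩)
    obtain ⟨j, hj⟩ := exists_lift k σ ι (fun h => φ.character (h ^ r)) (fun h => ⟨_, hχ' h⟩)
    refine ⟨M, _, _, hgal, i, j, α, fun g => ?_⟩
    apply σ.injective
    rw [hj]
    have : i ⟨φ.character g, mem_charField _ g⟩ = χ g := σ.injective (by rw [hi, hχ])
    rw [this, hχ']
  · intro h
    apply ι.injective
    have h4 : (a : M) * ∑ x : H, χ x⁻¹ * χ (x * h) = b * χ h := by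
      apply σ.injective
      simp only [map_mul, map_sum, map_natCast, hχ]
      have := congrArg ι (h2 h)
      simpa only [map_mul, map_sum, map_natCast] using this
    have h5 := congrArg (fun z => σ (α z)) h4
    simpa only [map_mul, map_sum, map_natCast, hχ'] using h5
  · intro h
    apply ι.injective
    have h4 : (a : M) * ∑ x : H, χ x⁻¹ * τ (x * h) = b * χ h := by
      apply σ.injective
      simp only [map_mul, map_sum, map_natCast, hχ, hτ]
      have := congrArg ι (h3 h)
      simpa only [map_mul, map_sum, map_natCast] using this
    have h5 := congrArg (fun z => σ (α z)) h4
    simpa only [map_mul, map_sum, map_natCast, hχ', hτ', hU] using h5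

end gal
end Genotype

namespace Genotype

section pg
set_option linter.unusedSectionVars false

theorem meet_center {p : ℕ} (hp : p.Prime) {Q : Type} [Group Q] [Finite Q] (hQ : IsPGroup p Q)
    (N : Subgroup Q) [N.Normal] (hN : N ≠ ⊥) : ∃ x ∈ N, x ≠ 1 ∧ ∀ g, g * x = x * g := by
  have : Fact p.Prime := ⟨hp⟩
  have hdvd : p ∣ Nat.card N := by
    have : Nontrivial N := (Subgroup.nontrivial_iff_ne_bot N).2 hN
    obtain ⟨n, hn0, hn⟩ := (hQ.to_subgroup N).nontrivial_iff_card.mp inferInstance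
    exact hn.symm ▸ dvd_pow_self _ (ne_of_gt hn0)
  obtain ⟨b, hb, hb1⟩ := (hQ.of_equiv ConjAct.toConjAct).exists_fixed_point_of_prime_dvd_card_of_fixed_point
    N hdvd (a := 1) (fun g => smul_one g)
  refine ⟨b, b.2, fun h => hb1 (Subtype.ext h.symm), fun g => ?_⟩
  have h1 := congrArg Subtype.val (hb (ConjAct.toConjAct g))
  rw [ConjAct.Subgroup.val_conj_smul, ConjAct.toConjAct_smul] at h1
  exact mul_inv_eq_iff_eq_mul.1 h1

theorem exists_A {p : ℕ} (hp : p.Prime) {G : Type} [Group G] [Fintype G] (hG : IsPGroup p G)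
    (hR : IsRoquette G) (M : Subgroup G) (hM : M.Normal) :
    ∃ a ∈ M, (Subgroup.zpowers a).Normal ∧ ∀ m ∈ M, m * a = a * m → m ∈ Subgroup.zpowers a := by
  let S : Set (Subgroup G) := {A | A.Normal ∧ A ≤ M ∧ ∀ x ∈ A, ∀ y ∈ A, x * y = y * x}
  have hS : S.Nonempty := ⟨⊥, inferInstance, bot_le, by
    intro x hx y hy
    rw [Subgroup.mem_bot.1 hx, Subgroup.mem_bot.1 hy]⟩
  obtain ⟨A, hA⟩ := (Set.toFinite S).exists_maximal hS
  obtain ⟨⟨hAn, hAM, hAc⟩, hmax⟩ := hA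
  have hcyc := hR A hAn hAc
  obtain ⟨a0, ha0⟩ := hcyc.exists_generator
  have hA0 : A = Subgroup.zpowers (a0 : G) := by
    ext x
    constructor
    · intro hx
      obtain ⟨j, hj⟩ := ha0 ⟨x, hx⟩
      exact ⟨j, congrArg Subtype.val hj⟩
    · rintro ⟨j, rfl⟩
      exact A.zpow_mem a0.2 j
  refine ⟨a0, hAM a0.2, hA0 ▸ hAn, fun m hm hma => ?_⟩
  rw [← hA0]
  by_contra hmA
  let C := Subgroup.centralizer (A : Set G) ⊓ M
  have hCn : C.Normal := inferInstance
  have hmC : m ∈ C := by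
    refine ⟨Subgroup.mem_centralizer_iff.2 fun x hx => ?_, hm⟩
    have hx' : x ∈ Subgroup.zpowers (a0 : G) := hA0 ▸ hx
    obtain ⟨j, rfl⟩ := hx'
    have : Commute m a0 := hma
    exact (this.zpow_right j).eq.symm
  let N := C.map (QuotientGroup.mk' A)
  have hNn : N.Normal := hCn.map _ (QuotientGroup.mk'_surjective A)
  have hNb : N ≠ ⊥ := by
    intro h
    have : QuotientGroup.mk' A m ∈ N := ⟨m, hmC, rfl⟩
    rw [h, Subgroup.mem_bot] at this
    exact hmA ((QuotientGroup.eq_one_iff m).1 this)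
  obtain ⟨_, ⟨x, hxC, rfl⟩, hx1, hxc⟩ := meet_center hp (hG.to_quotient A) N hNb
  have hxA : x ∉ A := fun h => hx1 ((QuotientGroup.eq_one_iff x).2 h)
  let A' := (Subgroup.zpowers (QuotientGroup.mk' A x)).comap (QuotientGroup.mk' A)
  have hmem : ∀ y ∈ A', ∃ (j : ℤ) (b : G), b ∈ A ∧ y = x ^ j * b := by
    rintro y ⟨j, hj⟩
    refine ⟨j, (x ^ j)⁻¹ * y, ?_, by group⟩
    rw [← QuotientGroup.eq]
    exact hj
  have hxb : ∀ b ∈ A, Commute x b := fun b hb => (Subgroup.mem_centralizer_iff.1 hxC.1 b hb).symm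
  have hA' : A' ∈ S := by
    refine ⟨?_, ?_, ?_⟩
    · have : (Subgroup.zpowers (QuotientGroup.mk' A x)).Normal := by
        refine ⟨fun n hn g => ?_⟩
        obtain ⟨j, rfl⟩ := hn
        have h1 : Commute g (QuotientGroup.mk' A x) := hxc g
        have := (h1.zpow_right j).eq
        simp only [this]
        rw [mul_inv_cancel_right]
        exact ⟨j, rfl⟩
      exact this.comap _
    · intro y hy
      obtain ⟨j, b, hb, rfl⟩ := hmem y hy
      exact M.mul_mem (M.zpow_mem hxC.2 j) (hAM hb)
    · intro y hy z hz
      obtain ⟨j, b, hb, rfl⟩ := hmem y hy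
      obtain ⟨i, c, hc, rfl⟩ := hmem z hz
      have h1 : Commute b c := hAc b hb c hc
      have h2 : Commute (x ^ j * b) (x ^ i * c) := by
        refine Commute.mul_left (Commute.mul_right ?_ ?_) (Commute.mul_right ?_ h1)
        · exact (Commute.refl x).zpow_zpow j i
        · exact (hxb c hc).zpow_left j
        · exact ((hxb b hb).zpow_left i).symm
      exact h2
  have hle : A ≤ A' := by
    intro b hb
    refine ⟨0, ?_⟩
    simp only [zpow_zero]
    exact ((QuotientGroup.eq_one_iff b).2 hb).symm
  exact hxA (hmax hA' hle (⟨1, by simp⟩ : x ∈ A'))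

theorem exists_r {p : ℕ} (hp : p.Prime) {G : Type} [Group G] [Fintype G] (hG : IsPGroup p G)
    (a : G) (ha : (Subgroup.zpowers a).Normal) (g : G) :
    ∃ r : ℕ, r.Coprime (Fintype.card G) ∧ ∀ x ∈ Subgroup.zpowers a, g⁻¹ * x * g = x ^ r := by
  have : Fact p.Prime := ⟨hp⟩
  by_cases ha1 : a = 1
  · refine ⟨1, by simp, ?_⟩
    intro x hx
    rw [ha1, Subgroup.zpowers_one_eq_bot, Subgroup.mem_bot] at hx
    simp [hx]
  have h1 : g⁻¹ * a * g ∈ Subgroup.zpowers a := by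
    have := ha.conj_mem a (Subgroup.mem_zpowers a) g⁻¹
    simpa using this
  rw [← mem_powers_iff_mem_zpowers] at h1
  obtain ⟨r, hr⟩ := h1
  have hr : a ^ r = g⁻¹ * a * g := hr
  refine ⟨r, ?_, ?_⟩
  · obtain ⟨n, hn⟩ := IsPGroup.iff_card.1 hG
    rw [← Nat.card_eq_fintype_card, hn]
    apply Nat.Coprime.pow_right
    rw [Nat.coprime_comm, hp.coprime_iff_not_dvd]
    intro hpr
    obtain ⟨j, hj⟩ := (IsPGroup.iff_orderOf.1 hG) a
    have hj0 : j ≠ 0 := by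
      rintro rfl
      rw [pow_zero, orderOf_eq_one_iff] at hj
      exact ha1 hj
    have h2 : orderOf (a ^ r) = orderOf a := by
      rw [hr]
      exact orderOf_injective (MulAut.conj g⁻¹).toMonoidHom (MulAut.conj g⁻¹).injective a |> fun h => by
        simpa using h
    have h3 : (orderOf a).Coprime r := by
      rw [orderOf_pow] at h2
      have hpos := orderOf_pos a
      have hd := Nat.gcd_dvd_left (orderOf a) r
      have := Nat.div_mul_cancel hd
      rw [h2] at this
      exact Nat.eq_of_mul_eq_mul_left hpos (by rw [this, mul_one])
    have h4 : p ∣ Nat.gcd (orderOf a) r := Nat.dvd_gcd (hj ▸ dvd_pow_self p hj0) hpr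
    rw [h3] at h4
    exact hp.one_lt.ne' (Nat.dvd_one.1 h4)
  · rintro _ ⟨j, rfl⟩
    have h5 : (g⁻¹ * a * g) ^ j = g⁻¹ * a ^ j * g := by
      have := map_zpow (MulAut.conj g⁻¹) a j
      simpa using this.symm
    simp only
    rw [← h5, ← hr, ← zpow_natCast, ← zpow_natCast, ← zpow_mul, ← zpow_mul, mul_comm]

variable {k : Type} [Field k] [CharZero k] {G : Type} [Group G] [Fintype G]
  {V : Type} [AddCommGroup V] [Module k V] [FiniteDimensional k V]

theorem avgN_zero (ρ : G →* (V →ₗ[k] V)) (hρ : Irr ρ) (hf : Function.Injective ρ)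
    (B : Subgroup G) [hB : B.Normal] (z : G) (hz : z ∈ B) (hz1 : z ≠ 1) : avgN ρ B = 0 := by
  by_contra hne
  have hcomm : ∀ g, avgN ρ B * ρ g = ρ g * avgN ρ B := by
    intro g
    rw [avgN, smul_mul_assoc, mul_smul_comm]
    congr 1
    simp only [sumN, Finset.sum_mul, Finset.mul_sum, ← map_mul]
    refine Fintype.sum_equiv (MulAut.conjNormal (H := B) g⁻¹).toEquiv _ _ (fun x => ?_)
    congr 1
    simp [MulAut.conjNormal_apply, mul_assoc]
  have h1 := irr_zero hρ (1 - avgN ρ B) (fun g => by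
    rw [sub_mul, mul_sub, hcomm, one_mul, mul_one]) (avgN ρ B) hne (by
    rw [sub_mul, one_mul, avgN_idem, sub_self])
  have h2 : avgN ρ B = 1 := (sub_eq_zero.1 h1).symm
  have h3 := mul_avgN ρ B z hz
  rw [h2, mul_one, ← map_one ρ] at h3
  exact hz1 (hf h3)

theorem vanish (ρ : G →* (V →ₗ[k] V)) (hρ : Irr ρ) (hf : Function.Injective ρ) (a : G)
    (ha : (Subgroup.zpowers a).Normal) (m : G) (hm : m * a ≠ a * m) (S : V →ₗ[k] V)
    (hS : S * ρ a = ρ a * S) : LinearMap.trace k V (S * ρ m) = 0 := by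
  set w := m * a⁻¹ * m⁻¹ with hw
  have hwA : w ∈ Subgroup.zpowers a := ha.conj_mem _ (Subgroup.inv_mem _ (Subgroup.mem_zpowers a)) m
  set z := a * w with hz
  have hzA : z ∈ Subgroup.zpowers a := Subgroup.mul_mem _ (Subgroup.mem_zpowers a) hwA
  have hz1 : z ≠ 1 := by
    intro h
    apply hm
    have : a * m * (m * a)⁻¹ = 1 := by rw [← h, hz, hw]; group
    exact (mul_inv_eq_one.1 this).symm
  have haw : Commute a w := by
    obtain ⟨j, hj⟩ := hwA
    simp only at hj
    rw [← hj]
    exact (Commute.refl a).zpow_right j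
  have hBn : (Subgroup.zpowers z).Normal := by
    refine ⟨fun n hn g => ?_⟩
    obtain ⟨i, hi⟩ := hzA
    obtain ⟨j, rfl⟩ := hn
    obtain ⟨t, ht⟩ := ha.conj_mem a (Subgroup.mem_zpowers a) g
    simp only at hi ht ⊢
    refine ⟨t * j, ?_⟩
    simp only
    rw [← hi, ← conj_zpow, ← conj_zpow, ← ht, ← zpow_mul, ← zpow_mul, ← zpow_mul]
    congr 1; ring
  have hconj : ∀ j : ℤ, a ^ j * m * (a ^ j)⁻¹ = z ^ j * m := by
    intro j
    rw [hz, haw.mul_zpow, hw, conj_zpow, inv_zpow]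
    group
  have hSj : ∀ x ∈ Subgroup.zpowers a, S * ρ x = ρ x * S := by
    intro x hx
    rw [← mem_powers_iff_mem_zpowers] at hx
    obtain ⟨j, rfl⟩ := hx
    simp only [map_pow]
    have : Commute S (ρ a) := hS
    exact (this.pow_right j).eq
  have htr : ∀ x ∈ Subgroup.zpowers z, LinearMap.trace k V (ρ x * (ρ m * S)) =
      LinearMap.trace k V (S * ρ m) := by
    rintro _ ⟨j, rfl⟩
    simp only
    rw [← mul_assoc, ← map_mul ρ, ← hconj, map_mul ρ, map_mul ρ, mul_assoc,
      ← hSj _ (Subgroup.inv_mem _ ⟨j, rfl⟩), LinearMap.trace_mul_comm, mul_assoc,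
      ← mul_assoc (ρ (a ^ j)⁻¹), rho_inv', one_mul]
  have h1 := trace_avgN_mul ρ (Subgroup.zpowers z) (ρ m * S)
  rw [avgN_zero ρ hρ hf (Subgroup.zpowers z) z (Subgroup.mem_zpowers z) hz1, zero_mul, map_zero,
    Finset.sum_congr rfl (fun (x : Subgroup.zpowers z) _ => htr x x.2)] at h1
  have hc : (Fintype.card (Subgroup.zpowers z) : k) ≠ 0 := by exact_mod_cast Fintype.card_ne_zero
  simp only [Finset.sum_const, Finset.card_univ, nsmul_eq_mul] at h1
  rw [inv_mul_cancel_left₀ hc] at h1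
  exact h1.symm

end pg
end Genotype

namespace Genotype

section fin
set_option linter.unusedSectionVars false
variable {k : Type} [Field k] [CharZero k] {G : Type} [Group G] [Fintype G]

theorem pow_mem_cop {G : Type} [Group G] [Fintype G] (r : ℕ) (hr : r.Coprime (Fintype.card G))
    (H : Subgroup G) (u : G) : u ^ r ∈ H ↔ u ∈ H := by
  refine ⟨fun h => ?_, fun h => H.pow_mem h r⟩
  obtain ⟨s, hs⟩ := exists_pow_eq_self_of_coprime (hr.coprime_dvd_right (orderOf_dvd_card (x := u)))
  rw [← hs]
  exact H.pow_mem h s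

theorem final_contra {V : Type} [AddCommGroup V] [Module k V] [FiniteDimensional k V]
    (ρ : G →* (V →ₗ[k] V)) (hρ : Irr ρ) (hf : Function.Injective ρ)
    (M : Subgroup G) (hM : M.Normal) (H : Subgroup G) (hHM : H ≤ M) (g : G) (hg : g ∉ M)
    (a : G) (haM : a ∈ M) (ha : (Subgroup.zpowers a).Normal)
    (hC : ∀ m ∈ M, m * a = a * m → m ∈ Subgroup.zpowers a)
    (r : ℕ) (hr : r.Coprime (Fintype.card G))
    (hgr : ∀ x ∈ Subgroup.zpowers a, g⁻¹ * x * g = x ^ r)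
    (f : H → k) (lam : k) (e : V →ₗ[k] V) (hdef : e = eF ρ H f lam)
    (he : e * e = e) (hc : ∀ h ∈ H, e * ρ h = ρ h * e) (h0 : ∀ g ∉ H, e * ρ g * e = 0)
    (hne : e ≠ 0) (htr : ∀ h : H, LinearMap.trace k V (e * ρ h) = f h)
    (hfr : ∀ h : H, f (h ^ r) = f h) : False := by
  have hoff := trace_off ρ e H he h0
  have he2 : e = lam⁻¹ • ∑ y : G, LinearMap.trace k V (e * ρ y⁻¹) • ρ y := by
    conv_lhs => rw [hdef, eF]
    congr 1
    have h1 : ∑ x : H, f x⁻¹ • ρ x = ∑ x : H, LinearMap.trace k V (e * ρ (x : G)⁻¹) • ρ (x : G) := by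
      refine Finset.sum_congr rfl fun x _ => ?_
      rw [← htr x⁻¹]; rfl
    rw [h1]
    rw [← Finset.sum_subtype (Finset.univ.filter (· ∈ H)) (by simp)
      (fun x : G => LinearMap.trace k V (e * ρ x⁻¹) • ρ x)]
    refine Finset.sum_subset (Finset.subset_univ _) (fun x _ hx => ?_)
    have hx' : x⁻¹ ∉ H := fun h => hx (by simpa using h)
    rw [hoff _ hx', zero_smul]
  set S := ∑ x : M, ρ x * e * ρ (x : G)⁻¹ with hS
  have hSc : ∀ m ∈ M, S * ρ m = ρ m * S := fun m hm => conj_comm ρ M e m hm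
  have hTh : ∀ y, LinearMap.trace k V (S * ρ y) =
      ∑ x : M, LinearMap.trace k V (e * ρ ((x : G)⁻¹ * y * x)) := by
    intro y
    rw [hS, Finset.sum_mul, map_sum]
    refine Finset.sum_congr rfl fun x _ => ?_
    rw [mul_assoc, mul_assoc, LinearMap.trace_mul_comm, map_mul ρ, map_mul ρ]
    simp only [mul_assoc]
  have hS2 : S = lam⁻¹ • ∑ y : G, LinearMap.trace k V (S * ρ y⁻¹) • ρ y := by
    have h1 : ∀ x : M, ρ x * e * ρ (x : G)⁻¹ =
        lam⁻¹ • ∑ y : G, LinearMap.trace k V (e * ρ ((x : G)⁻¹ * y⁻¹ * x)) • ρ y := by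
      intro x
      conv_lhs => rw [he2]
      rw [mul_smul_comm, smul_mul_assoc, Finset.mul_sum, Finset.sum_mul]
      congr 1
      refine Fintype.sum_equiv (MulAut.conj (x : G)).toEquiv _ _ (fun y => ?_)
      rw [mul_smul_comm, smul_mul_assoc, ← map_mul ρ, ← map_mul ρ]
      simp [mul_assoc]
    conv_lhs => rw [hS]
    rw [Finset.sum_congr rfl (fun (x : M) _ => h1 x), ← Finset.smul_sum, Finset.sum_comm]
    congr 1
    refine Finset.sum_congr rfl fun y _ => ?_
    rw [hTh, Finset.sum_smul]
  have hv : ∀ y, y ∉ Subgroup.zpowers a → LinearMap.trace k V (S * ρ y) = 0 := by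
    intro y hy
    by_cases hyM : y ∈ M
    · exact vanish ρ hρ hf a ha y (fun h => hy (hC y hyM h)) S (hSc a haM)
    · rw [hTh]
      refine Finset.sum_eq_zero fun x _ => hoff _ (fun h => hyM ?_)
      have := hM.conj_mem _ (hHM h) x
      simpa [mul_assoc] using this
  have hFr : ∀ u, LinearMap.trace k V (e * ρ (u ^ r)) = LinearMap.trace k V (e * ρ u) := by
    intro u
    by_cases hu : u ∈ H
    · have h1 := htr ⟨u, hu⟩
      have h2 := htr (⟨u, hu⟩ ^ r)
      rw [hfr] at h2
      exact h2.trans h1.symm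
    · rw [hoff _ hu, hoff _ (fun h => hu ((pow_mem_cop r hr H u).1 h))]
  have hinv : ∀ y, LinearMap.trace k V (S * ρ (g⁻¹ * y * g)) = LinearMap.trace k V (S * ρ y) := by
    intro y
    by_cases hy : y ∈ Subgroup.zpowers a
    · rw [hgr y hy, hTh, hTh]
      refine Finset.sum_congr rfl fun x _ => ?_
      rw [← hFr ((x : G)⁻¹ * y * x)]
      congr 3
      have := conj_pow (i := r) (a := (x : G)⁻¹) (b := y)
      simpa using this.symm
    · rw [hv y hy, hv]
      intro h
      apply hy
      have := ha.conj_mem _ h g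
      simpa [mul_assoc] using this
  have hgS : ρ g * S * ρ g⁻¹ = S := by
    conv_lhs => rw [hS2]
    conv_rhs => rw [hS2]
    rw [mul_smul_comm, smul_mul_assoc, Finset.mul_sum, Finset.sum_mul]
    congr 1
    refine Fintype.sum_equiv (MulAut.conj g).toEquiv _ _ (fun y => ?_)
    rw [mul_smul_comm, smul_mul_assoc, ← map_mul ρ, ← map_mul ρ]
    have : LinearMap.trace k V (S * ρ ((MulAut.conj g).toEquiv y)⁻¹) =
        LinearMap.trace k V (S * ρ y⁻¹) := by
      rw [← hinv]
      congr 3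
      simp [mul_assoc]
    rw [this]
    simp
  have hSgS : S * ρ g * S = 0 := by
    rw [hS, Finset.sum_mul, Finset.sum_mul]
    refine Finset.sum_eq_zero fun x _ => ?_
    rw [Finset.mul_sum]
    refine Finset.sum_eq_zero fun y _ => ?_
    have h1 : (x : G)⁻¹ * g * y ∉ H := by
      intro h
      apply hg
      have := M.mul_mem (M.mul_mem x.2 (hHM h)) (M.inv_mem y.2)
      simpa [mul_assoc] using this
    have h2 := h0 _ h1
    have h3 : ρ x * e * ρ (x : G)⁻¹ * ρ g * (ρ y * e * ρ (y : G)⁻¹) =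
        ρ x * (e * ρ ((x : G)⁻¹ * g * y) * e) * ρ (y : G)⁻¹ := by
      rw [map_mul ρ, map_mul ρ]
      simp only [mul_assoc]
    rw [h3, h2, mul_zero, zero_mul]
  have hSS : S * S = 0 := by
    have : S * S = S * (ρ g * S * ρ g⁻¹) := by rw [hgS]
    rw [this, ← mul_assoc, ← mul_assoc, hSgS, zero_mul]
  have hSe : S * e = (Fintype.card H : k) • e := conj_mul ρ e H M hHM he hc h0
  have hfin : (Fintype.card H : k) • ((Fintype.card H : k) • e) = 0 := by
    rw [← hSe, ← mul_smul_comm, ← hSe, ← mul_assoc, hSS, zero_mul]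
  have hcard : (Fintype.card H : k) ≠ 0 := by exact_mod_cast Fintype.card_ne_zero
  exact hne ((smul_eq_zero.1 ((smul_eq_zero.1 hfin).resolve_left hcard)).resolve_left hcard)

theorem bwd_lt {p : ℕ} (hp : p.Prime) (hG : IsPGroup p G) (ψ : FDRep k G) (hψ : IsIrr ψ)
    (hR : IsRoquette G) (hf : IsFaithfulRep ψ) (H : Subgroup G) (hH : H ≠ ⊤)
    (φ : FDRep k H) (hφ : IsIrr φ) (hT : TightInd H ψ.character φ.character) : False := by
  have : Fact p.Prime := ⟨hp⟩
  have hnt : Nontrivial φ := hφ.1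
  obtain ⟨hind, ⟨W, hW, hno⟩, hgalc⟩ := hT
  have hψ' : Irr ψ.ρ := hψ
  have hcardH : (Fintype.card H : k) ≠ 0 := by exact_mod_cast Fintype.card_ne_zero
  -- the maximal subgroup
  obtain ⟨M, hMco, hHM⟩ := (eq_top_or_exists_le_coatom H).resolve_left hH
  have hnil : Group.IsNilpotent G := hG.isNilpotent
  have hM : M.Normal := Subgroup.NormalizerCondition.normal_of_coatom M
    Group.normalizerCondition_of_isNilpotent hMco
  obtain ⟨g, hg⟩ : ∃ g, g ∉ M := by
    by_contra! h
    exact hMco.1 (eq_top_iff.2 fun x _ => h x)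
  obtain ⟨a, haM, ha, hC⟩ := exists_A hp hG hR M hM
  obtain ⟨r, hr, hgr⟩ := exists_r hp hG a ha g
  -- character identities
  obtain ⟨n, hn, h2⟩ := conv_self φ hφ
  have hnk : (n : k) ≠ 0 := by exact_mod_cast hn
  let U : FDRep k H := FDRep.of (ψ.ρ.comp H.subtype)
  have hUc : ∀ h : H, U.character h = ψ.character h := fun h => rfl
  have hUW : ∀ h : H, U.character h = φ.character h + W.character h := by
    intro h
    have := congrFun hW h
    rw [hUc]
    simpa [resChar] using this
  have h3 : ∀ h, (n : k) * ∑ x : H, φ.character x⁻¹ * U.character (x * h) =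
      (Fintype.card H : ℕ) * φ.character h := by
    intro h
    simp only [hUW, mul_add, Finset.sum_add_distrib, conv_zero φ W hφ hno, add_zero]
    exact h2 h
  have hUr : ∀ h, U.character (h ^ r) = U.character h := by
    intro h
    rw [hUc, hUc]
    by_cases hh : (h : G) ∈ Subgroup.zpowers a
    · rw [Subgroup.coe_pow, ← hgr _ hh]
      have := FDRep.char_conj ψ h g⁻¹
      simpa using this
    · have hz : ∀ y ∈ M, y ∉ Subgroup.zpowers a → ψ.character y = 0 := by
        intro y hyM hy
        have := vanish ψ.ρ hψ' hf a ha y (fun h => hy (hC y hyM h)) 1 (by simp)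
        rw [one_mul] at this
        exact this
      rw [hz _ (hHM h.2) hh, hz _ (hHM (h ^ r).2)]
      rw [Subgroup.coe_pow, pow_mem_cop r hr]
      exact hh
  have hcl : ∀ x y, φ.character (x * y) = φ.character (y * x) := fun x y => FDRep.char_mul_comm φ y x
  have h5 : φ.character 1 ≠ 0 := by
    rw [char_one_fd]
    exact_mod_cast Module.finrank_pos.ne'
  have h4 : (Fintype.card H : k) * Module.finrank k ψ = Fintype.card G * φ.character 1 := by
    have h6 := congrFun hind 1
    rw [char_one_fd, indChar, finsum_eq_sum_of_fintype] at h6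
    have h7 : ∀ x : G, (if h : x⁻¹ * 1 * x ∈ H then φ.character ⟨x⁻¹ * 1 * x, h⟩ else 0) =
        φ.character 1 := by
      intro x
      have hx : x⁻¹ * 1 * x = 1 := by group
      rw [dif_pos (by rw [hx]; exact H.one_mem)]
      congr 1
      exact Subtype.ext hx
    simp only [h7, Finset.sum_const, Finset.card_univ, nsmul_eq_mul, Nat.card_eq_fintype_card] at h6
    rw [h6, mul_inv_cancel_left₀ hcardH]
  obtain ⟨hgc, h2', h3'⟩ := gal_transfer φ U (Fintype.card G) Fintype.card_ne_zero
    (fun h => Subtype.ext (by simp)) r hr hUr n (Fintype.card H) h2 h3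
  set lam : k := (Fintype.card H : k) / n with hlam
  have hl : lam ≠ 0 := div_ne_zero hcardH hnk
  have hconv : ∀ A B : k, (n : k) * A = (Fintype.card H : k) * B → A = lam * B := by
    intro A B h
    rw [hlam]
    field_simp
    linear_combination h
  have hclr : ∀ x y : H, φ.character ((x * y) ^ r) = φ.character ((y * x) ^ r) := by
    intro x y
    have h8 : (x * y) ^ r = x * (y * x) ^ r * x⁻¹ := by
      rw [← conj_pow]; congr 1; group
    rw [h8, FDRep.char_conj]
  obtain ⟨hirr, hocc⟩ := eF_irrChar ψ.ρ H (fun h => φ.character (h ^ r)) lam hψ' hl hclr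
    (fun h => hconv _ _ (h2' h)) (fun h => hconv _ _ (h3' h)) (by simpa using h4) (by simpa using h5)
  have hfr := congrFun (hgalc _ hirr hgc hocc)
  have h2l : ∀ h, ∑ x : H, φ.character x⁻¹ * φ.character (x * h) = lam * φ.character h :=
    fun h => hconv _ _ (h2 h)
  have h3l : ∀ h : H, ∑ x : H, φ.character x⁻¹ * LinearMap.trace k ψ (ψ.ρ (x * h)) =
      lam * φ.character h := fun h => hconv _ _ (h3 h)
  obtain ⟨hne, h0⟩ := eF_all ψ.ρ H φ.character lam hψ' hl hcl h2l h3l h4 h5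
  exact final_contra ψ.ρ hψ' hf M hM H hHM g hg a haM ha hC r hr hgr φ.character lam _ rfl
    (eF_idem ψ.ρ H φ.character lam hl hcl h2l) (eF_comm ψ.ρ H φ.character lam hcl) h0 hne
    (eF_trace ψ.ρ H φ.character lam hl h3l) hfr

theorem bwd_top (ψ : FDRep k G) (hf : IsFaithfulRep ψ) (K : Subgroup (⊤ : Subgroup G)) [hKn : K.Normal]
    (hK : K ≠ ⊥) (f : ((⊤ : Subgroup G) ⧸ K) → k)
    (h : ψ.character = indChar ⊤ (fun h => f (QuotientGroup.mk h))) : False := by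
  have h1 : ∀ y ∈ K.map (⊤ : Subgroup G).subtype, ψ.character y = ψ.character 1 := by
    rintro _ ⟨κ, hκ, rfl⟩
    rw [h, indChar, indChar]
    congr 2
    ext x
    rw [dif_pos (Subgroup.mem_top _), dif_pos (Subgroup.mem_top _)]
    congr 1
    have hx : ∀ y ∈ K, (QuotientGroup.mk (⟨x⁻¹ * (y : G) * x, Subgroup.mem_top _⟩ : (⊤ : Subgroup G)) :
        (⊤ : Subgroup G) ⧸ K) = 1 := by
      intro y hy
      rw [QuotientGroup.eq_one_iff]
      have := hKn.conj_mem y hy ⟨x⁻¹, Subgroup.mem_top _⟩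
      convert this using 1
      apply Subtype.ext
      simp
    exact (hx κ hκ).trans (hx 1 K.one_mem).symm
  have h2 := triv_of_trace ψ.ρ (K.map (⊤ : Subgroup G).subtype) (fun y hy => by
    rw [← char_one_fd, ← h1 y hy]; rfl)
  apply hK
  rw [eq_bot_iff]
  intro κ hκ
  have h3 := mul_avgN ψ.ρ (K.map (⊤ : Subgroup G).subtype) κ ⟨κ, hκ, rfl⟩
  rw [h2, mul_one, ← map_one ψ.ρ] at h3
  exact Subtype.ext (hf h3)

end fin
end Genotype

namespace Genotype

/-- A `𝕂G`-irrep `ψ` is not tightly induced from any strict subquotient of `G` if and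
only if `G` is a Roquette `p`-group and `ψ` is faithful. (A subquotient `H/K` is strict
if `H < G` or `K ≠ 1`.) -/
theorem not_tightly_induced_iff_roquette_faithful (p : ℕ) (hp : p.Prime)
    (G : Type) [Group G] [Fintype G] (hG : IsPGroup p G)
    (k : Type) [Field k] [CharZero k] (ψ : FDRep k G) (hψ : IsIrr ψ) :
    (¬ ∃ (H : Subgroup G) (K : Subgroup H) (_ : K.Normal) (φ : FDRep k (H ⧸ K)),
        (H ≠ ⊤ ∨ K ≠ ⊥) ∧ IsIrr φ ∧ TightIndSub H K ψ.character φ.character) ↔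
      (IsRoquette G ∧ IsFaithfulRep ψ) := by
  constructor
  · intro h
    constructor
    · by_contra hf
      exact h (fwd_roquette ψ hψ hf)
    · by_contra hf
      exact h (fwd_faithful ψ hψ hf)
  · rintro ⟨hR, hf⟩ ⟨H, K, hK, φ, hs, hφ, hT⟩
    by_cases hH : H = ⊤
    · subst hH
      exact bwd_top ψ hf K (hs.resolve_left (fun h => h rfl)) φ.character hT.1
    · refine bwd_lt hp hG ψ hψ hR hf H hH (FDRep.of (φ.ρ.comp (QuotientGroup.mk' K))) ⟨hφ.1, ?_⟩ hT
      intro U hU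
      refine hφ.2 U fun q x hx => ?_
      obtain ⟨h, rfl⟩ := QuotientGroup.mk_surjective q
      exact hU h x hx

end Genotype
end
end

section
/- Suppose the finite p-group G is not Roquette and there exists a faithful 𝕂G-irrep ψ. Then there exists a normal subgroup E of G such that E ≅ C_p × C_p and E ∩ Z(G) ≅ C_p. For any such E, the centralizer T = C_G(E) is a maximal subgroup of G, and for any 𝕂T-irrep φ that overlaps with ψ, the irrep ψ is tightly induced from φ. -/
open scoped Classical

noncomputable section

namespace Genotype

open scoped commutatorElement

theorem normal_inf_center_aux {G : Type} [Group G] [Group.IsNilpotent G] (N : Subgroup G)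
    (hN : N.Normal) (h : ∀ g ∈ N, g ∈ Subgroup.center G → g = 1) : N = ⊥ := by
  have key : ∀ n : ℕ, ∀ g ∈ N, g ∈ Subgroup.upperCentralSeries G n → g = 1 := by
    intro n
    induction n with
    | zero => intro g _ hg; simpa using hg
    | succ n ih =>
      intro g hgN hg
      apply h g hgN
      rw [Subgroup.mem_center_iff]
      intro y
      have h1 := ih ⁅g, y⁆ (by
        rw [commutatorElement_def]
        have := N.mul_mem hgN (hN.conj_mem _ (N.inv_mem hgN) y)
        simpa [mul_assoc] using this) (Subgroup.mem_upperCentralSeries_succ_iff.mp hg y)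
      exact (commutatorElement_eq_one_iff_mul_comm.mp h1).symm
  obtain ⟨n, hn⟩ := Group.IsNilpotent.nilpotent G
  rw [eq_bot_iff]
  intro g hg
  exact key n g hg (by rw [hn]; trivial)

theorem exists_second_center {G : Type} [Group G] [Group.IsNilpotent G] (N : Subgroup G)
    (hN : N.Normal) (h : ¬ N ≤ Subgroup.center G) :
    ∃ b ∈ N, b ∉ Subgroup.center G ∧ ∀ y : G, ⁅b, y⁆ ∈ Subgroup.center G := by
  by_contra! hcon
  apply h
  have key : ∀ n : ℕ, ∀ g ∈ N, g ∈ Subgroup.upperCentralSeries G n → g ∈ Subgroup.center G := by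
    intro n
    induction n with
    | zero => intro g _ hg; have : g = 1 := by simpa using hg
              rw [this]; exact one_mem _
    | succ n ih =>
      intro g hgN hg
      by_contra hgc
      obtain ⟨y, hy⟩ := hcon g hgN hgc
      apply hy
      exact ih ⁅g, y⁆ (by
        rw [commutatorElement_def]
        have := N.mul_mem hgN (hN.conj_mem _ (N.inv_mem hgN) y)
        simpa [mul_assoc] using this) (Subgroup.mem_upperCentralSeries_succ_iff.mp hg y)
  obtain ⟨n, hn⟩ := Group.IsNilpotent.nilpotent G
  intro g hg
  exact key n g hg (by rw [hn]; trivial)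

theorem cyclic_of_torsion (p : ℕ) (hp : p.Prime) (A : Type) [CommGroup A] [Finite A]
    (hA : IsPGroup p A) (h : Nat.card (powMonoidHom p : A →* A).ker ≤ p) : IsCyclic A := by
  have := Fact.mk hp
  have key : ∀ n : ℕ, Nat.card (powMonoidHom (p ^ n) : A →* A).ker ≤ p ^ n := by
    intro n
    induction n with
    | zero =>
      have : (powMonoidHom (p ^ 0) : A →* A).ker = ⊥ := by
        ext x; simp
      rw [this]; simp
    | succ n ih =>
      let K := (powMonoidHom (p ^ (n+1)) : A →* A).ker
      let f : K →* A := (powMonoidHom p : A →* A).comp K.subtype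
      have h1 := Subgroup.card_mul_index f.ker
      rw [Subgroup.index_ker] at h1
      have h2 : Nat.card f.ker ≤ p := by
        refine le_trans ?_ h
        refine Nat.card_le_card_of_injective
          (fun x => ⟨x.1.1, ?_⟩ : f.ker → (powMonoidHom p : A →* A).ker) ?_
        · exact x.2
        · intro x y hxy
          have h5 := congrArg Subtype.val hxy
          exact Subtype.ext (Subtype.ext h5)
      have h3 : Nat.card f.range ≤ p ^ n := by
        refine le_trans ?_ ih
        refine Nat.card_le_card_of_injective (Subgroup.inclusion ?_) (Subgroup.inclusion_injective _)
        rintro _ ⟨x, rfl⟩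
        have := x.2
        simp only [K, MonoidHom.mem_ker, powMonoidHom_apply] at this
        simp only [f, MonoidHom.mem_ker, powMonoidHom_apply, MonoidHom.comp_apply]
        rw [← pow_mul, ← pow_succ']
        exact this
      change Nat.card K ≤ _
      rw [← h1, pow_succ']
      exact Nat.mul_le_mul h2 h3
  obtain ⟨n, hn⟩ := isPGroup_iff_exponent_eq_pow.mp hA
  apply IsCyclic.of_exponent_eq_card
  apply le_antisymm
  · exact Nat.le_of_dvd Nat.card_pos (Group.exponent_dvd_nat_card)
  · rw [hn]
    refine le_trans (le_of_eq ?_) (key n)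
    have : (powMonoidHom (p ^ n) : A →* A).ker = ⊤ := by
      rw [eq_top_iff]; intro x _
      simp only [MonoidHom.mem_ker, powMonoidHom_apply, ← hn]
      exact Monoid.pow_exponent_eq_one x
    rw [this]; simp

/-- the big-subgroup lemma -/
theorem big_subgroup (p : ℕ) (hp : p.Prime) {G : Type} [Group G] [Finite G] (E C H : Subgroup G)
    (hE : Nat.card E = p ^ 2) (hEC : Nat.card (E ⊓ C : Subgroup G) = p)
    (hH : E ⊓ C ≤ H) (a : G) (haE : a ∈ E) (haC : a ∉ C) (haH : a ∈ H) : E ≤ H := by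
  have h1 : E ⊓ C ≤ E ⊓ H := le_inf inf_le_left hH
  have h2 : Nat.card (E ⊓ H : Subgroup G) ∣ p ^ 2 := hE ▸ Subgroup.card_dvd_of_le inf_le_left
  obtain ⟨m, hm, hm'⟩ := (Nat.dvd_prime_pow hp).mp h2
  have h3 := Subgroup.card_dvd_of_le h1
  have : m = 2 := by
    interval_cases m
    · rw [hEC, hm'] at h3
      simp at h3; exact absurd h3 hp.ne_one
    · exfalso
      have : E ⊓ C = E ⊓ H := Subgroup.eq_of_le_of_card_ge h1 (by rw [hm', hEC]; simp)
      have h4 : a ∈ E ⊓ C := this ▸ ⟨haE, haH⟩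
      exact haC h4.2
    · rfl
  subst this
  have : E ⊓ H = E := Subgroup.eq_of_le_of_card_ge inf_le_left (by rw [hm', hE])
  exact inf_eq_left.mp this

structure GoodE (p : ℕ) {G : Type} [Group G] (E : Subgroup G) : Prop where
  normal : E.Normal
  comm : ∀ x ∈ E, ∀ y ∈ E, x * y = y * x
  pow : ∀ x ∈ E, x ^ p = 1
  card : Nat.card E = p ^ 2
  cardC : Nat.card (E ⊓ Subgroup.center G : Subgroup G) = p

theorem goodE_of (p : ℕ) (hp : p.Prime) {G : Type} [Group G] (E : Subgroup G) (hE : E.Normal)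
    (e1 : E ≃* (Multiplicative (ZMod p) × Multiplicative (ZMod p)))
    (e2 : (E ⊓ Subgroup.center G : Subgroup G) ≃* Multiplicative (ZMod p)) : GoodE p E := by
  have := Fact.mk hp
  refine ⟨hE, ?_, ?_, ?_, ?_⟩
  · intro x hx y hy
    have : (⟨x, hx⟩ : E) * ⟨y, hy⟩ = ⟨y, hy⟩ * ⟨x, hx⟩ := by
      apply e1.injective; rw [map_mul, map_mul, mul_comm]
    simpa using congrArg Subtype.val this
  · intro x hx
    have : (⟨x, hx⟩ : E) ^ p = 1 := by
      apply e1.injective; rw [map_pow, map_one]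
      have h : ∀ z : Multiplicative (ZMod p), z ^ p = 1 := by
        intro z
        apply Multiplicative.toAdd.injective
        simp
      ext1
      · exact h _
      · exact h _
    simpa using congrArg Subtype.val this
  · rw [Nat.card_congr e1.toEquiv, Nat.card_prod]; simp [sq]
  · rw [Nat.card_congr e2.toEquiv]; simp

theorem GoodE.le_second {p : ℕ} (hp : p.Prime) {G : Type} [Group G] [Finite G]
    [Group.IsNilpotent G]
    {E : Subgroup G} (h : GoodE p E) : ∀ a ∈ E, ∀ y : G, ⁅a, y⁆ ∈ Subgroup.center G := by
  have hnot : ¬ E ≤ Subgroup.center G := by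
    intro hle
    have h1 := h.cardC
    rw [inf_eq_left.mpr hle, h.card] at h1
    have := hp.one_lt
    nlinarith
  obtain ⟨b, hb, hbc, hby⟩ := exists_second_center E h.normal hnot
  have h2 : E ≤ Subgroup.upperCentralSeries G 2 := by
    refine big_subgroup p hp E (Subgroup.center G) _ h.card h.cardC ?_ b hb hbc ?_
    · refine le_trans inf_le_right ?_
      rw [← Subgroup.upperCentralSeries_one]
      exact Subgroup.upperCentralSeries_mono G (by norm_num)
    · rw [Subgroup.mem_upperCentralSeries_succ_iff]
      intro y; rw [Subgroup.upperCentralSeries_one]; exact hby y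
  intro a ha y
  have := Subgroup.mem_upperCentralSeries_succ_iff.mp (h2 ha) y
  rwa [Subgroup.upperCentralSeries_one] at this

theorem GoodE.mem_centralizer {p : ℕ} (hp : p.Prime) {G : Type} [Group G] [Finite G]
    {E : Subgroup G} (h : GoodE p E) {a : G} (ha : a ∈ E) (hac : a ∉ Subgroup.center G) {x : G} :
    x ∈ Subgroup.centralizer (E : Set G) ↔ a * x = x * a := by
  constructor
  · intro hx; exact Subgroup.mem_centralizer_iff.mp hx a ha
  · intro hx
    have := big_subgroup p hp E (Subgroup.center G) (Subgroup.centralizer {x}) h.card h.cardC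
      (inf_le_right.trans (Subgroup.center_le_centralizer _)) a ha hac
      (by rw [Subgroup.mem_centralizer_iff]; simpa using hx.symm)
    rw [Subgroup.mem_centralizer_iff]
    intro y hy
    have := Subgroup.mem_centralizer_iff.mp (this hy) x rfl
    exact this.symm

theorem GoodE.coatom {p : ℕ} (hp : p.Prime) {G : Type} [Group G] [Finite G]
    [Group.IsNilpotent G]
    {E : Subgroup G} (h : GoodE p E) : IsCoatom (Subgroup.centralizer (E : Set G)) := by
  have hnot : ¬ E ≤ Subgroup.center G := by
    intro hle
    have h1 := h.cardC
    rw [inf_eq_left.mpr hle, h.card] at h1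
    have := hp.one_lt
    nlinarith
  obtain ⟨a, ha, hac⟩ := Set.not_subset.mp hnot
  have hc : ∀ y : G, ⁅a, y⁆ ∈ E ⊓ Subgroup.center G := fun y =>
    ⟨by
        rw [commutatorElement_def]
        have := E.mul_mem ha (h.normal.conj_mem _ (E.inv_mem ha) y)
        simpa [mul_assoc] using this, h.le_second hp a ha y⟩
  let f : G →* (E ⊓ Subgroup.center G : Subgroup G) := MonoidHom.mk' (fun y => ⟨⁅a, y⁆, hc y⟩) (by
    intro x y
    ext
    simp only [Subgroup.coe_mul]
    have h1 := Subgroup.mem_center_iff.mp (hc y).2 x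
    have : ⁅a, x * y⁆ = ⁅a, x⁆ * (x * ⁅a, y⁆ * x⁻¹) := by
      simp only [commutatorElement_def]; group
    rw [this, h1]; group)
  have hker : f.ker = Subgroup.centralizer (E : Set G) := by
    ext x
    rw [h.mem_centralizer hp ha hac, MonoidHom.mem_ker]
    simp only [f, MonoidHom.mk'_apply]
    rw [← commutatorElement_eq_one_iff_mul_comm, Subtype.ext_iff]
    rfl
  have hidx : (Subgroup.centralizer (E : Set G)).index ∣ p := by
    rw [← hker, Subgroup.index_ker, ← h.cardC]
    exact Subgroup.card_subgroup_dvd_card _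
  have hne : (Subgroup.centralizer (E : Set G)) ≠ ⊤ := by
    intro htop
    apply hac
    refine Subgroup.mem_center_iff.mpr ?_
    intro g
    exact ((h.mem_centralizer hp ha hac).mp (htop ▸ Subgroup.mem_top g)).symm
  have hidx' : (Subgroup.centralizer (E : Set G)).index = p := by
    rcases (Nat.dvd_prime hp).mp hidx with h1 | h1
    · exact absurd (Subgroup.index_eq_one.mp h1) hne
    · exact h1
  refine ⟨hne, fun K hK => ?_⟩
  have h1 := Subgroup.relIndex_mul_index hK.le
  rw [hidx'] at h1
  have h2 : K.index ∣ p := ⟨_, by rw [← h1, mul_comm]⟩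
  rcases (Nat.dvd_prime hp).mp h2 with h3 | h3
  · exact Subgroup.index_eq_one.mp h3
  · exfalso
    rw [h3] at h1
    have h4 : (Subgroup.centralizer (E : Set G)).relIndex K = 1 :=
      Nat.eq_of_mul_eq_mul_right hp.pos (by rw [h1, one_mul])
    exact hK.not_ge (Subgroup.relIndex_eq_one.mp h4)

theorem exists_E (p : ℕ) (hp : p.Prime) {G : Type} [Group G] [Finite G] [Group.IsNilpotent G]
    (hG : IsPGroup p G) (hnR : ¬ IsRoquette G) (hZ : IsCyclic (Subgroup.center G)) :
    ∃ E : Subgroup G, E.Normal ∧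
        Nonempty (E ≃* (Multiplicative (ZMod p) × Multiplicative (ZMod p))) ∧
        Nonempty ((E ⊓ Subgroup.center G : Subgroup G) ≃* Multiplicative (ZMod p)) := by
  have := Fact.mk hp
  simp only [IsRoquette, not_forall] at hnR
  obtain ⟨A, hA, hcomm, hcyc⟩ := hnR
  let Om : Subgroup G :=
    { carrier := {x | x ∈ A ∧ x ^ p = 1}
      one_mem' := ⟨A.one_mem, one_pow _⟩
      mul_mem' := by
        rintro x y ⟨hx, hx'⟩ ⟨hy, hy'⟩
        refine ⟨A.mul_mem hx hy, ?_⟩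
        rw [(show Commute x y from hcomm x hx y hy).mul_pow, hx', hy', one_mul]
      inv_mem' := by
        rintro x ⟨hx, hx'⟩
        exact ⟨A.inv_mem hx, by rw [inv_pow, hx', inv_one]⟩ }
  have hOmN : Om.Normal := ⟨by
    rintro x ⟨hx, hx'⟩ g
    exact ⟨hA.conj_mem x hx g, by rw [conj_pow, hx']; simp⟩⟩
  have hcard : ∀ H : Subgroup G, H ≤ Om → IsCyclic H → Nat.card H ∣ p := by
    intro H hH hHc
    rw [← IsCyclic.exponent_eq_card]
    apply Monoid.exponent_dvd_of_forall_pow_eq_one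
    intro x
    ext
    simpa using (hH x.2).2
  have hOmZ : ¬ Om ≤ Subgroup.center G := by
    intro hle
    have hc : IsCyclic Om := Subgroup.isCyclic_of_le hle
    have h1 := Nat.le_of_dvd hp.pos (hcard Om le_rfl hc)
    apply hcyc
    let _ : CommGroup A := { (inferInstance : Group A) with
      mul_comm := fun x y => Subtype.ext (hcomm x x.2 y y.2) }
    refine cyclic_of_torsion p hp A (hG.to_subgroup A) (le_trans ?_ h1)
    refine Nat.card_le_card_of_injective (fun x => ⟨x.1.1, x.1.2, ?_⟩) ?_
    · have := x.2
      simp only [MonoidHom.mem_ker, powMonoidHom_apply] at this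
      simpa using congrArg Subtype.val this
    · intro x y hxy
      have h5 := congrArg Subtype.val hxy
      exact Subtype.ext (Subtype.ext h5)
  obtain ⟨b, hb, hbc, hby⟩ := exists_second_center Om hOmN hOmZ
  obtain ⟨z, hzO, hzc, hz1⟩ : ∃ z ∈ Om, z ∈ Subgroup.center G ∧ z ≠ 1 := by
    by_contra! hcon
    exact hOmZ (by rw [normal_inf_center_aux Om hOmN hcon]; exact bot_le)
  have hpow : ∀ (x : G), x ^ p = 1 → x ≠ 1 → orderOf x = p := fun x h1 h2 =>
    orderOf_eq_prime h1 h2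
  have hzo : Nat.card (Subgroup.zpowers z) = p := by
    rw [Nat.card_zpowers]; exact hpow z hzO.2 hz1
  have hb1 : b ≠ 1 := by rintro rfl; exact hbc (one_mem _)
  have hbo : Nat.card (Subgroup.zpowers b) = p := by
    rw [Nat.card_zpowers]; exact hpow b hb.2 hb1
  have hcM : Nat.card (Multiplicative (ZMod p)) = p := by simp
  let e1 := mulEquivOfPrimeCardEq hcM hzo
  let e2 := mulEquivOfPrimeCardEq hcM hbo
  let f1 : Multiplicative (ZMod p) →* G := (Subgroup.zpowers z).subtype.comp e1.toMonoidHom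
  let f2 : Multiplicative (ZMod p) →* G := (Subgroup.zpowers b).subtype.comp e2.toMonoidHom
  have hf1Z : ∀ x, f1 x ∈ Subgroup.center G := fun x =>
    (Subgroup.zpowers_le.mpr hzc) (e1 x).2
  have hf1O : ∀ x, f1 x ∈ Om := fun x => (Subgroup.zpowers_le.mpr hzO) (e1 x).2
  have hf2O : ∀ x, f2 x ∈ Om := fun x => (Subgroup.zpowers_le.mpr hb) (e2 x).2
  have hf1i : Function.Injective f1 := Subtype.val_injective.comp e1.injective
  have hf2i : Function.Injective f2 := Subtype.val_injective.comp e2.injective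
  have hcomm12 : ∀ x y, Commute (f1 x) (f2 y) := fun x y =>
    (Subgroup.mem_center_iff.mp (hf1Z x) (f2 y)).symm
  let f := f1.noncommCoprod f2 hcomm12
  have hzb : ∀ y, f2 y ∈ Subgroup.center G → f2 y = 1 := by
    intro y hy
    by_contra hne
    apply hbc
    have h1 : b ∈ Subgroup.zpowers (f2 y) := by
      have h2 : (⟨b, Subgroup.mem_zpowers b⟩ : Subgroup.zpowers b) ∈ Subgroup.zpowers (e2 y) :=
        mem_zpowers_of_prime_card hbo (by
          intro h; apply hne
          change ((e2 y : Subgroup.zpowers b) : G) = 1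
          rw [h]; rfl)
      obtain ⟨n, hn⟩ := Subgroup.mem_zpowers_iff.mp h2
      exact Subgroup.mem_zpowers_iff.mpr ⟨n, by
        have h4 := congrArg Subtype.val hn
        rw [Subgroup.coe_zpow] at h4
        exact h4⟩
    exact (Subgroup.zpowers_le.mpr hy) h1
  have hfi : Function.Injective f := by
    rw [injective_iff_map_eq_one]
    rintro ⟨x, y⟩ hxy
    have hxy' : f1 x * f2 y = 1 := hxy
    have h2 : f2 y = 1 := by
      apply hzb
      rw [← inv_eq_of_mul_eq_one_right hxy']
      exact inv_mem (hf1Z x)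
    rw [h2, mul_one] at hxy'
    ext1
    · exact hf1i (hxy'.trans (map_one f1).symm)
    · exact hf2i (h2.trans (map_one f2).symm)
  have hEO : f.range ≤ Om := by
    rintro _ ⟨⟨x, y⟩, rfl⟩
    exact Om.mul_mem (hf1O x) (hf2O y)
  have hOZ : Nat.card (Om ⊓ Subgroup.center G : Subgroup G) ∣ p :=
    hcard _ inf_le_left (Subgroup.isCyclic_of_le inf_le_right)
  have hzOZ : Subgroup.zpowers z = Om ⊓ Subgroup.center G := by
    refine Subgroup.eq_of_le_of_card_ge (Subgroup.zpowers_le.mpr ⟨hzO, hzc⟩) ?_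
    rw [hzo]; exact Nat.le_of_dvd hp.pos hOZ
  have hzE : Subgroup.zpowers z ≤ f.range := by
    intro x hx
    refine ⟨(e1.symm ⟨x, hx⟩, 1), ?_⟩
    change f1 _ * f2 1 = x
    simp [f1]
  have hbE : Subgroup.zpowers b ≤ f.range := by
    intro x hx
    refine ⟨(1, e2.symm ⟨x, hx⟩), ?_⟩
    change f1 1 * f2 _ = x
    simp [f2]
  refine ⟨f.range, ?_, ⟨(MonoidHom.ofInjective hfi).symm⟩, ?_⟩
  · constructor
    rintro _ ⟨⟨x, y⟩, rfl⟩ g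
    have h1 : g * f (x, y) * g⁻¹ = f1 x * (g * f2 y * g⁻¹) := by
      change g * (f1 x * f2 y) * g⁻¹ = _
      rw [← mul_assoc, Subgroup.mem_center_iff.mp (hf1Z x) g]; group
    rw [h1]
    refine Subgroup.mul_mem _ (hzE (e1 x).2) ?_
    obtain ⟨n, hn⟩ := Subgroup.mem_zpowers_iff.mp (e2 y).2
    have h2 : f2 y = b ^ n := hn.symm
    rw [h2, ← conj_zpow]
    apply Subgroup.zpow_mem
    have h3 : g * b * g⁻¹ = ⁅b, g⁆⁻¹ * b := by
      simp only [commutatorElement_def]; group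
    rw [h3]
    refine Subgroup.mul_mem _ (hzE ?_) (hbE (Subgroup.mem_zpowers b))
    rw [hzOZ]
    refine inv_mem ⟨?_, hby g⟩
    rw [commutatorElement_def]
    have := Om.mul_mem hb (hOmN.conj_mem _ (Om.inv_mem hb) g)
    simpa [mul_assoc] using this
  · have h1 : f.range ⊓ Subgroup.center G = Subgroup.zpowers z := by
      apply le_antisymm
      · rw [hzOZ]; exact inf_le_inf_right _ hEO
      · exact le_inf hzE (Subgroup.zpowers_le.mpr hzc)
    rw [h1]
    exact ⟨e1.symm⟩

end Genotype
namespace Genotype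

section Core

variable {k V W : Type} [Field k] [AddCommGroup V] [Module k V]
  [AddCommGroup W] [Module k W]

/-- a finite group of commuting operators on an irreducible module is cyclic -/
theorem cyclic_of_central {G C : Type} [Group G] [Group C] [Finite C] (ρ : G →* Module.End k V)
    (hnt : Nontrivial V)
    (hirr : ∀ U : Submodule k V, (∀ g : G, ∀ x ∈ U, ρ g x ∈ U) → U = ⊥ ∨ U = ⊤)
    (u : C →* G) (hu : ∀ c g, u c * g = g * u c) (hinj : Function.Injective (fun c => ρ (u c))) :
    IsCyclic C := by
  let S : Set (Module.End k V) := Set.range (fun c => ρ (u c))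
  have hS : ∀ x ∈ S, ∀ y ∈ S, x * y = y * x := by
    rintro _ ⟨c, rfl⟩ _ ⟨d, rfl⟩
    show ρ (u c) * ρ (u d) = ρ (u d) * ρ (u c)
    rw [← map_mul ρ, ← map_mul ρ, hu]
  have hcomm := Algebra.isMulCommutative_adjoin k hS
  let R := Algebra.adjoin k S
  have hR : ∀ r ∈ R, ∀ g, r * ρ g = ρ g * r := by
    intro r hr g
    have h1 : R ≤ Subalgebra.centralizer k {ρ g} := by
      apply Algebra.adjoin_le
      rintro _ ⟨c, rfl⟩
      rw [SetLike.mem_coe, Subalgebra.mem_centralizer_iff]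
      rintro _ rfl
      rw [← map_mul ρ, ← map_mul ρ, hu]
    have := (Subalgebra.mem_centralizer_iff k).mp (h1 hr) (ρ g) rfl
    exact this.symm
  have hker : ∀ r ∈ R, r ≠ 0 → LinearMap.ker r = ⊥ := by
    intro r hr hr0
    rcases hirr (LinearMap.ker r) (by
      intro g x hx
      rw [LinearMap.mem_ker] at hx ⊢
      have := LinearMap.congr_fun (hR r hr g) x
      simp only [Module.End.mul_apply] at this
      rw [this, hx, map_zero]) with h | h
    · exact h
    · exact absurd (LinearMap.ker_eq_top.mp h) hr0
  let _ : CommRing R := { (inferInstance : Ring R) with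
    mul_comm := fun a b => hcomm.is_comm.comm a b }
  have : IsDomain R := by
    have : Nontrivial R := inferInstance
    have : NoZeroDivisors R := ⟨by
      intro a b hab
      by_contra! hcon
      have ha : (a : Module.End k V) ≠ 0 := fun h => hcon.1 (Subtype.ext h)
      have h1 := LinearMap.ker_eq_bot.mp (hker a a.2 ha)
      apply hcon.2
      apply Subtype.ext
      ext v
      apply h1
      have h2 := congrArg Subtype.val hab
      have h3 := LinearMap.congr_fun h2 v
      simpa using h3⟩
    exact NoZeroDivisors.to_isDomain R
  let f : C →* R :=
    { toFun := fun c => ⟨ρ (u c), Algebra.subset_adjoin ⟨c, rfl⟩⟩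
      map_one' := by ext1; simp
      map_mul' := by intro a b; ext1; simp }
  refine isCyclic_of_injective_ringHom f ?_
  intro a b hab
  exact hinj (congrArg Subtype.val hab)

/-- averaging idempotent -/
def avg (p : ℕ) (A : Module.End k V) : Module.End k V :=
  (p : k)⁻¹ • ∑ i ∈ Finset.range p, A ^ i

theorem avg_fix [CharZero k] {p : ℕ} (hp : p ≠ 0) (A : Module.End k V) (v : V) (hv : A v = v) :
    avg p A v = v := by
  have h1 : ∀ i : ℕ, (A ^ i) v = v := by
    intro i
    induction i with
    | zero => simp
    | succ n ih => rw [pow_succ, Module.End.mul_apply, hv, ih]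
  have : (p : k) ≠ 0 := by exact_mod_cast hp
  simp only [avg, LinearMap.smul_apply, LinearMap.sum_apply, h1, Finset.sum_const,
    Finset.card_range]
  rw [← Nat.cast_smul_eq_nsmul k, smul_smul, inv_mul_cancel₀ this, one_smul]

theorem mul_avg {p : ℕ} (A : Module.End k V) (hA : A ^ p = 1) : A * avg p A = avg p A := by
  simp only [avg, mul_smul_comm, Finset.mul_sum]
  congr 1
  have h1 := Finset.sum_range_succ (fun i => A ^ i) p
  have h2 := Finset.sum_range_succ' (fun i => A ^ i) p
  simp only [pow_zero, hA] at h1 h2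
  have h3 := h2.symm.trans h1
  simp only [← pow_succ']
  exact add_right_cancel h3

theorem avg_comm {p : ℕ} (A B : Module.End k V) (h : A * B = B * A) :
    avg p A * B = B * avg p A := by
  simp only [avg, mul_smul_comm, smul_mul_assoc, Finset.mul_sum, Finset.sum_mul]
  congr 1
  refine Finset.sum_congr rfl fun i _ => ?_
  exact ((show Commute A B from h).pow_left i).eq

theorem avg_idem [CharZero k] {p : ℕ} (hp : p ≠ 0) (A : Module.End k V) (hA : A ^ p = 1) :
    IsIdempotentElem (avg p A) := by
  ext v
  rw [Module.End.mul_apply]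
  apply avg_fix hp
  rw [← Module.End.mul_apply, mul_avg A hA]

theorem avg_trace_nat [FiniteDimensional k V] [CharZero k] {p : ℕ} (hp : p ≠ 0)
    (A : Module.End k V) (hA : A ^ p = 1) :
    LinearMap.trace k V (avg p A) = (Module.finrank k (LinearMap.range (avg p A)) : k) :=
  ((LinearMap.isProj_range_iff_isIdempotentElem _).mpr (avg_idem hp A hA)).trace

theorem eq_one_of_trace_s15 [FiniteDimensional k V] [CharZero k] {p : ℕ} (hp : p ≠ 0)
    (A : Module.End k V) (hA : A ^ p = 1)
    (h : LinearMap.trace k V (avg p A) = (Module.finrank k V : k)) : A = 1 := by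
  rw [avg_trace_nat hp A hA] at h
  have h1 : LinearMap.range (avg p A) = ⊤ := Submodule.eq_top_of_finrank_eq (by exact_mod_cast h)
  ext v
  obtain ⟨w, rfl⟩ := LinearMap.range_eq_top.mp h1 v
  rw [← Module.End.mul_apply, mul_avg A hA]
  rfl

variable {G : Type} [Group G] (ρ : G →* Module.End k V) (T : Subgroup G)
  (a : G) (p : ℕ)

theorem core_zero [CharZero k] (hap : a ^ p = 1)
    (hcc : ∀ x, a * (x * a * x⁻¹) = (x * a * x⁻¹) * a)
    (hx : ∀ x, x ∉ T → ∀ v, ρ a v = v → ρ (x * a * x⁻¹) v = v → v = 0)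
    (x : G) (hxT : x ∉ T) : avg p (ρ a) * ρ x * avg p (ρ a) = 0 := by
  have hA : ρ a ^ p = 1 := by rw [← map_pow, hap, map_one]
  ext v
  apply hx x hxT
  · rw [← Module.End.mul_apply, ← mul_assoc, ← mul_assoc, mul_avg _ hA]
  · rw [← Module.End.mul_apply]
    have h1 := avg_comm (p := p) (ρ a) (ρ (x * a * x⁻¹)) (by rw [← map_mul, hcc, map_mul])
    rw [← mul_assoc, ← mul_assoc, ← h1, mul_assoc (avg p (ρ a)), ← map_mul]
    have : x * a * x⁻¹ * x = x * a := by group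
    rw [this, map_mul, ← mul_assoc, mul_assoc _ (ρ a), mul_avg _ hA]

theorem core_sum [CharZero k] [Fintype G] (hp : p ≠ 0)
    (hirr : ∀ U : Submodule k V, (∀ g : G, ∀ x ∈ U, ρ g x ∈ U) → U = ⊥ ∨ U = ⊤)
    (hap : a ^ p = 1)
    (hT : ∀ t ∈ T, a * t = t * a)
    (hcc : ∀ x, a * (x * a * x⁻¹) = (x * a * x⁻¹) * a)
    (hx : ∀ x, x ∉ T → ∀ v, ρ a v = v → ρ (x * a * x⁻¹) v = v → v = 0)
    (v₀ : V) (hv₀ : v₀ ≠ 0) (hav₀ : ρ a v₀ = v₀) :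
    ∑ x : G, ρ x * avg p (ρ a) * ρ x⁻¹ = (Nat.card T : k) • (1 : Module.End k V) := by
  set e := avg p (ρ a) with he
  set F : Module.End k V := ∑ x : G, ρ x * e * ρ x⁻¹ with hF
  have hA : ρ a ^ p = 1 := by rw [← map_pow, hap, map_one]
  have hee : e * e = e := avg_idem hp (ρ a) hA
  have hFg : ∀ g, F * ρ g = ρ g * F := by
    intro g
    rw [hF, Finset.sum_mul, Finset.mul_sum]
    refine Fintype.sum_equiv (Equiv.mulLeft g⁻¹) _ _ fun x => ?_
    simp only [Equiv.coe_mulLeft]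
    rw [mul_assoc, ← map_mul, ← mul_assoc, ← mul_assoc, ← map_mul]
    simp
  have hFe : F * e = (Nat.card T : k) • e := by
    rw [hF, Finset.sum_mul]
    have h1 : ∀ x : G, ρ x * e * ρ x⁻¹ * e = if x ∈ T then e else 0 := by
      intro x
      split_ifs with hxT
      · have h2 := avg_comm (p := p) (ρ a) (ρ x) (by rw [← map_mul, hT x hxT, map_mul])
        rw [← he] at h2
        rw [← h2, mul_assoc e, ← map_mul, mul_inv_cancel, map_one, mul_one, hee]
      · have h2 := core_zero ρ T a p hap hcc hx x⁻¹ (by simpa using hxT)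
        rw [← he] at h2
        rw [mul_assoc (ρ x), mul_assoc (ρ x), h2, mul_zero]
    simp only [h1]
    rw [← Finset.sum_filter, Finset.sum_const, Nat.cast_smul_eq_nsmul]
    congr 1
    rw [Nat.card_eq_fintype_card, Fintype.card_subtype]
  have hU := hirr (LinearMap.ker (F - (Nat.card T : k) • (1 : Module.End k V))) (by
    intro g x hx
    rw [LinearMap.mem_ker] at hx ⊢
    have h1 : (F - (Nat.card T : k) • (1 : Module.End k V)) * ρ g
        = ρ g * (F - (Nat.card T : k) • (1 : Module.End k V)) := by
      rw [sub_mul, mul_sub, hFg]; simp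
    rw [← Module.End.mul_apply, h1, Module.End.mul_apply, hx, map_zero])
  rcases hU with h | h
  · exfalso
    apply hv₀
    have : v₀ ∈ LinearMap.ker (F - (Nat.card T : k) • (1 : Module.End k V)) := by
      rw [LinearMap.mem_ker]
      have h1 := LinearMap.congr_fun hFe v₀
      rw [Module.End.mul_apply, LinearMap.smul_apply, he, avg_fix hp _ _ hav₀] at h1
      rw [LinearMap.sub_apply, h1]; simp
    rw [h] at this
    simpa using this
  · exact sub_eq_zero.mp (LinearMap.ker_eq_top.mp h)

theorem core_range [CharZero k] [FiniteDimensional k V] [FiniteDimensional k W] (hp : p ≠ 0)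
    (hirr : ∀ U : Submodule k V, (∀ g : G, ∀ x ∈ U, ρ g x ∈ U) → U = ⊥ ∨ U = ⊤)
    (hap : a ^ p = 1)
    (hT : ∀ t ∈ T, a * t = t * a)
    (hcc : ∀ x, a * (x * a * x⁻¹) = (x * a * x⁻¹) * a)
    (hx : ∀ x, x ∉ T → ∀ v, ρ a v = v → ρ (x * a * x⁻¹) v = v → v = 0)
    (σ : T →* Module.End k W) (f : W →ₗ[k] V) (hf : Function.Injective f)
    (hfT : ∀ (t : T) w, f (σ t w) = ρ t (f w)) (haf : ∀ w, ρ a (f w) = f w)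
    (hW : Nontrivial W) (t : T) :
    LinearMap.trace k V (ρ t * avg p (ρ a)) = LinearMap.trace k W (σ t) := by
  set e := avg p (ρ a) with he
  have hef : ∀ w, e (f w) = f w := fun w => avg_fix hp _ _ (haf w)
  let U : Submodule k V := ⨅ x : G, Submodule.comap (e * ρ x) (LinearMap.range f)
  have hUmem : ∀ v, v ∈ U ↔ ∀ x, e (ρ x v) ∈ LinearMap.range f := by
    intro v; simp [U, Submodule.mem_iInf]
  have hUtop : U = ⊤ := by
    rcases hirr U (by
      intro g v hv
      rw [hUmem] at hv ⊢
      intro x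
      rw [← Module.End.mul_apply (ρ x), ← map_mul]
      exact hv _) with h | h
    · exfalso
      obtain ⟨w, hw⟩ := exists_ne (0 : W)
      apply hw
      apply hf
      rw [map_zero]
      have : f w ∈ U := by
        rw [hUmem]
        intro x
        by_cases hxT : x ∈ T
        · refine ⟨σ ⟨x, hxT⟩ w, ?_⟩
          rw [hfT]
          have := hef (σ ⟨x, hxT⟩ w)
          rw [hfT] at this
          exact this.symm
        · have h2 := core_zero ρ T a p hap hcc hx x hxT
          have h3 := LinearMap.congr_fun h2 (f w)
          rw [← he, Module.End.mul_apply, Module.End.mul_apply, hef] at h3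
          rw [h3]; exact Submodule.zero_mem _
      rw [h] at this
      simpa using this
    · exact h
  have her : ∀ v, e v ∈ LinearMap.range f := by
    intro v
    have : v ∈ U := hUtop ▸ Submodule.mem_top
    have := (hUmem v).mp this 1
    simpa using this
  obtain ⟨g, hg⟩ := LinearMap.exists_leftInverse_of_injective f (LinearMap.ker_eq_bot.mpr hf)
  have h1 : ρ t * e = f ∘ₗ (σ t ∘ₗ g ∘ₗ e) := by
    ext v
    obtain ⟨w, hw⟩ := her v
    have : g (f w) = w := LinearMap.congr_fun hg w
    simp only [Module.End.mul_apply, LinearMap.comp_apply, ← hw, this, hfT]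
  have h2 : (σ t ∘ₗ g ∘ₗ e) ∘ₗ f = σ t := by
    ext w
    have : g (f w) = w := LinearMap.congr_fun hg w
    simp only [LinearMap.comp_apply, hef, this]
  rw [h1, LinearMap.trace_comp_comm', h2]

end Core

end Genotype
namespace Genotype

open scoped commutatorElement

theorem exists_hom {k H Y : Type} [Field k] [CharZero k] [Group H] [Finite H]
    [AddCommGroup Y] [Module k Y] [FiniteDimensional k Y]
    (V : FDRep k H) (τ : H →* Module.End k Y) (hV : IsIrr V)
    (h : CharOccurs V.character (fun h => LinearMap.trace k Y (τ h))) :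
    ∃ f : V →ₗ[k] Y, Function.Injective f ∧ ∀ h w, f (V.ρ h w) = τ h (f w) := by
  have := Fintype.ofFinite H
  have hne : (Nat.card H : k) ≠ 0 := by exact_mod_cast Nat.card_pos.ne'
  let _ : Invertible (Nat.card H : k) := invertibleOfNonzero hne
  obtain ⟨W, hW⟩ := h
  have h1 := Representation.card_inv_mul_sum_char_mul_char_eq_finrank (k := k) (G := H) V.ρ τ
  have h2 := Representation.card_inv_mul_sum_char_mul_char_eq_finrank (k := k) (G := H) V.ρ V.ρ
  have h3 := Representation.card_inv_mul_sum_char_mul_char_eq_finrank (k := k) (G := H) V.ρ W.ρ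
  have h4 : ∀ g, Representation.character τ g
      = Representation.character V.ρ g + Representation.character W.ρ g := fun g =>
    congrFun hW g
  have h5 : Module.finrank k (Representation.IntertwiningMap V.ρ τ)
      = Module.finrank k (Representation.IntertwiningMap V.ρ V.ρ)
      + Module.finrank k (Representation.IntertwiningMap V.ρ W.ρ) := by
    have : (Module.finrank k (Representation.IntertwiningMap V.ρ τ) : k)
      = Module.finrank k (Representation.IntertwiningMap V.ρ V.ρ)
      + Module.finrank k (Representation.IntertwiningMap V.ρ W.ρ) := by
      rw [← h1, ← h2, ← h3, ← mul_add, ← Finset.sum_add_distrib]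
      simp only [h4, add_mul]
    exact_mod_cast this
  have hnt : Nontrivial V := hV.1
  have h6 : 0 < Module.finrank k (Representation.IntertwiningMap V.ρ V.ρ) := by
    have : Module.Finite k (Representation.IntertwiningMap V.ρ V.ρ) :=
      Module.Finite.equiv (Representation.invariantsEquivIntertwiningMap V.ρ V.ρ)
    have : Nontrivial (Representation.IntertwiningMap V.ρ V.ρ) := by
      refine ⟨0, Representation.IntertwiningMap.id V.ρ, ?_⟩
      intro h0
      obtain ⟨v, hv⟩ := exists_ne (0 : V)
      apply hv
      have := congrArg (fun F => F.toLinearMap v) h0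
      exact this.symm
    exact Module.finrank_pos
  have h7 : ∃ F : Representation.IntertwiningMap V.ρ τ, F ≠ 0 := by
    by_contra! hcon
    have : Subsingleton (Representation.IntertwiningMap V.ρ τ) :=
      ⟨fun x y => by rw [hcon x, hcon y]⟩
    rw [Module.finrank_zero_of_subsingleton] at h5
    omega
  obtain ⟨F, hF⟩ := h7
  have hFi : ∀ h w, F.toLinearMap (V.ρ h w) = τ h (F.toLinearMap w) := fun h w =>
    LinearMap.congr_fun (F.isIntertwining' h) w
  refine ⟨F.toLinearMap, ?_, hFi⟩
  rcases hV.2 (LinearMap.ker F.toLinearMap) (by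
    intro g x hx
    rw [LinearMap.mem_ker] at hx ⊢
    rw [hFi, hx, map_zero]) with h | h
  · exact LinearMap.ker_eq_bot.mp h
  · exfalso
    apply hF
    have h8 := LinearMap.ker_eq_top.mp h
    ext v
    exact LinearMap.congr_fun h8 v

theorem main_aux (p : ℕ) (hp : p.Prime)
    (G : Type) [Group G] [Fintype G] [Group.IsNilpotent G]
    (k : Type) [Field k] [CharZero k]
    (ψ : FDRep k G) (hψ : IsIrr ψ) (hψf : IsFaithfulRep ψ) (E : Subgroup G) (hE : GoodE p E)
    (T : Subgroup G) (hTdef : T = Subgroup.centralizer (E : Set G))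
    (φ : FDRep k T) (hφ : IsIrr φ)
    (hocc : CharOccurs φ.character (resChar T ψ.character)) :
    TightInd T ψ.character φ.character := by
  have hp0 : p ≠ 0 := hp.ne_zero
  have hpk : (p : k) ≠ 0 := by exact_mod_cast hp0
  have hmemT : ∀ x, x ∈ T ↔ x ∈ Subgroup.centralizer (E : Set G) := by
    intro x; rw [hTdef]
  have hTN : T.Normal := by
    have := hE.normal
    rw [hTdef]
    exact Subgroup.normal_centralizer
  have hET : E ≤ T := fun x hx =>
    (hmemT x).mpr (Subgroup.mem_centralizer_iff.mpr fun y hy => hE.comm y hy x hx)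
  let τ : T →* Module.End k ψ := ψ.ρ.comp T.subtype
  obtain ⟨f, hf, hfT⟩ := exists_hom φ τ hφ hocc
  have hfix : ∀ c ∈ Subgroup.center G, c ≠ 1 → ∀ v, ψ.ρ c v = v → v = 0 := by
    intro c hc hc1 v hv
    rcases hψ.2 (LinearMap.ker (ψ.ρ c - 1)) (by
      intro g x hx
      rw [LinearMap.mem_ker, LinearMap.sub_apply, sub_eq_zero] at hx ⊢
      rw [← Module.End.mul_apply, ← map_mul, ← Subgroup.mem_center_iff.mp hc g, map_mul,
        Module.End.mul_apply, hx]
      rfl) with h | h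
    · have : v ∈ LinearMap.ker (ψ.ρ c - 1) := by
        rw [LinearMap.mem_ker, LinearMap.sub_apply, hv]; simp
      rw [h] at this
      simpa using this
    · exfalso
      apply hc1
      apply hψf
      rw [sub_eq_zero.mp (LinearMap.ker_eq_top.mp h), map_one]
  have ha : ∃ a, ∃ haE : a ∈ E, a ≠ 1 ∧ φ.ρ ⟨a, hET haE⟩ = 1 := by
    by_contra! hcon
    have hcyc : IsCyclic E := by
      refine cyclic_of_central φ.ρ hφ.1 hφ.2 (Subgroup.inclusion hET) ?_ ?_
      · intro c g
        ext
        exact Subgroup.mem_centralizer_iff.mp ((hmemT _).mp g.2) c c.2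
      · have hi : Function.Injective (φ.ρ.comp (Subgroup.inclusion hET)) := by
          rw [injective_iff_map_eq_one]
          rintro ⟨x, hx⟩ hx1
          by_contra hne
          exact hcon x hx (fun h => hne (Subtype.ext h)) hx1
        exact hi
    have h1 := IsCyclic.exponent_eq_card (α := E)
    have h2 : Monoid.exponent E ∣ p := by
      apply Monoid.exponent_dvd_of_forall_pow_eq_one
      intro x
      ext
      simpa using hE.pow x x.2
    rw [h1, hE.card] at h2
    have h3 := Nat.le_of_dvd hp.pos h2
    have := hp.one_lt
    nlinarith
  obtain ⟨a, haE, ha1, haφ⟩ := ha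
  have hap : a ^ p = 1 := hE.pow a haE
  obtain ⟨w₀, hw₀⟩ := @exists_ne _ hφ.1 (0 : φ)
  have haf : ∀ w, ψ.ρ a (f w) = f w := by
    intro w
    have := hfT ⟨a, hET haE⟩ w
    rw [haφ] at this
    exact this.symm
  have hfw₀ : f w₀ ≠ 0 := fun h => hw₀ (hf (by rw [h, map_zero]))
  have hac : a ∉ Subgroup.center G := fun hc => hfw₀ (hfix a hc ha1 _ (haf w₀))
  have hT : ∀ t ∈ T, a * t = t * a := fun t ht => (hE.mem_centralizer hp haE hac).mp ((hmemT _).mp ht)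
  have hcc : ∀ x, a * (x * a * x⁻¹) = (x * a * x⁻¹) * a := fun x =>
    hE.comm a haE _ (hE.normal.conj_mem a haE x)
  have hx : ∀ x, x ∉ T → ∀ v, ψ.ρ a v = v → ψ.ρ (x * a * x⁻¹) v = v → v = 0 := by
    intro x hxT v hv hv'
    have hc := hE.le_second hp a haE x
    refine hfix _ hc ?_ v ?_
    · intro h
      exact hxT ((hmemT _).mpr
        ((hE.mem_centralizer hp haE hac).mpr (commutatorElement_eq_one_iff_mul_comm.mp h)))
    · have h1 : ⁅a, x⁆ * (x * a * x⁻¹) = a := by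
        rw [commutatorElement_def]; group
      have h2 : ψ.ρ (⁅a, x⁆ * (x * a * x⁻¹)) v = v := by rw [h1, hv]
      rwa [map_mul, Module.End.mul_apply, hv'] at h2
  have hA : ψ.ρ a ^ p = 1 := by rw [← map_pow, hap, map_one]
  have hee : avg p (ψ.ρ a) * avg p (ψ.ρ a) = avg p (ψ.ρ a) := avg_idem hp0 _ hA
  have htr := core_range ψ.ρ T a p hp0 hψ.2 hap hT hcc hx φ.ρ f hf hfT haf hφ.1
  have haT : ∀ i : ℕ, a ^ i ∈ T := fun i => T.pow_mem (hET haE) i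
  have htre : LinearMap.trace k ψ (avg p (ψ.ρ a))
      = (p : k)⁻¹ * ∑ i ∈ Finset.range p, ψ.character (a ^ i) := by
    simp only [avg, map_smul, map_sum, smul_eq_mul, FDRep.character, map_pow]
  have htrV : ∀ (V : FDRep k T), LinearMap.trace k V (avg p (V.ρ ⟨a, hET haE⟩))
      = (p : k)⁻¹ * ∑ i ∈ Finset.range p, V.character ⟨a ^ i, haT i⟩ := by
    intro V
    simp only [avg, map_smul, map_sum, smul_eq_mul, FDRep.character]
    congr 1
    refine Finset.sum_congr rfl fun i _ => ?_
    rw [← map_pow]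
    rfl
  have hVA : ∀ (V : FDRep k T), V.ρ ⟨a, hET haE⟩ ^ p = 1 := by
    intro V
    rw [← map_pow]
    have : (⟨a, hET haE⟩ : T) ^ p = 1 := by ext; simpa using hap
    rw [this, map_one]
  refine ⟨?_, ?_, ?_⟩
  · -- induced character
    ext g
    have hsum := core_sum ψ.ρ T a p hp0 hψ.2 hap hT hcc hx (f w₀) hfw₀ (haf w₀)
    have hcT : (Nat.card T : k) ≠ 0 := by exact_mod_cast Nat.card_pos.ne'
    have h1 : (Nat.card T : k) * ψ.character g
        = ∑ x : G, LinearMap.trace k ψ (ψ.ρ (x⁻¹ * g * x) * avg p (ψ.ρ a)) := by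
      have h2 : (Nat.card T : k) • ψ.ρ g
          = ∑ x : G, ψ.ρ g * (ψ.ρ x * avg p (ψ.ρ a) * ψ.ρ x⁻¹) := by
        rw [← Finset.mul_sum, hsum]; simp
      have h3 := congrArg (LinearMap.trace k ψ) h2
      rw [map_smul, smul_eq_mul, map_sum] at h3
      refine h3.trans (Finset.sum_congr rfl fun x _ => ?_)
      rw [← mul_assoc, LinearMap.trace_mul_comm, ← mul_assoc, ← mul_assoc, ← map_mul, ← map_mul]
    have h4 : ∀ h : G, LinearMap.trace k ψ (ψ.ρ h * avg p (ψ.ρ a))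
        = if hh : h ∈ T then φ.character ⟨h, hh⟩ else 0 := by
      intro h
      split_ifs with hh
      · exact htr ⟨h, hh⟩
      · rw [← hee, ← mul_assoc, LinearMap.trace_mul_comm, ← mul_assoc,
          core_zero ψ.ρ T a p hap hcc hx h hh, map_zero]
    rw [indChar, finsum_eq_sum_of_fintype, eq_inv_mul_iff_mul_eq₀ hcT, h1]
    exact Finset.sum_congr rfl fun x _ => h4 _
  · -- multiplicity one
    obtain ⟨W, hW⟩ := hocc
    refine ⟨W, by rw [hW, one_smul], ?_⟩
    rintro ⟨W', hW'⟩
    have h1 := htr 1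
    rw [OneMemClass.coe_one, map_one, one_mul, map_one, LinearMap.trace_one, htre] at h1
    have h2 : ∀ i, ψ.character (a ^ i) = φ.character ⟨a ^ i, haT i⟩ +
        (φ.character ⟨a ^ i, haT i⟩ + W'.character ⟨a ^ i, haT i⟩) := by
      intro i
      have := congrFun hW ⟨a ^ i, haT i⟩
      rw [hW'] at this
      exact this
    simp only [h2, Finset.sum_add_distrib, mul_add] at h1
    rw [← htrV, ← htrV, haφ, avg_trace_nat hp0 _ (hVA W')] at h1
    have h3 : avg p (1 : Module.End k φ) = 1 := by
      ext v; exact avg_fix hp0 _ v rfl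
    rw [h3, LinearMap.trace_one] at h1
    have h4 : Module.finrank k φ + (Module.finrank k φ +
      Module.finrank k (LinearMap.range (avg p (W'.ρ ⟨a, hET haE⟩)))) = Module.finrank k φ := by
      exact_mod_cast h1
    have h5 : 0 < Module.finrank k φ := by
      have := hφ.1
      exact Module.finrank_pos
    omega
  · rintro cφ' ⟨V', hV', rfl⟩ ⟨M, _, _, _, i, j, α, hα⟩ hocc'
    obtain ⟨f', hf', hfT'⟩ := exists_hom V' τ hV' hocc'
    have hch : ∀ n, φ.character ⟨a ^ n, haT n⟩ = φ.character 1 := by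
      intro n
      have : (⟨a ^ n, haT n⟩ : T) = ⟨a, hET haE⟩ ^ n := rfl
      rw [this]
      simp only [FDRep.character, map_pow, haφ, one_pow, map_one]
    have hch' : ∀ n, V'.character ⟨a ^ n, haT n⟩ = V'.character 1 := by
      intro n
      have h1 := hα ⟨a ^ n, haT n⟩
      have h2 := hα 1
      have h3 : (⟨φ.character ⟨a ^ n, haT n⟩, mem_charField _ _⟩ : charField φ.character)
        = ⟨φ.character 1, mem_charField _ _⟩ := Subtype.ext (hch n)
      rw [h3, h2] at h1
      exact (congrArg Subtype.val (j.injective h1)).symm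
    have haV' : V'.ρ ⟨a, hET haE⟩ = 1 := by
      apply eq_one_of_trace_s15 hp0 _ (hVA V')
      rw [htrV]
      simp only [hch', Finset.sum_const, Finset.card_range, nsmul_eq_mul, FDRep.char_one]
      rw [inv_mul_cancel_left₀ hpk]
    have haf' : ∀ w, ψ.ρ a (f' w) = f' w := by
      intro w
      have := hfT' ⟨a, hET haE⟩ w
      rw [haV'] at this
      exact this.symm
    have htr' := core_range ψ.ρ T a p hp0 hψ.2 hap hT hcc hx V'.ρ f' hf' hfT' haf' hV'.1
    ext t
    exact (htr' t).symm.trans (htr t)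

end Genotype

namespace Genotype

/-- Suppose the finite `p`-group `G` is not Roquette and has a faithful `𝕂G`-irrep `ψ`.
Then there is a normal subgroup `E ⊴ G` with `E ≅ C_p × C_p` and `E ∩ Z(G) ≅ C_p`; for
any such `E`, the centralizer `T = C_G(E)` is a maximal subgroup of `G` and `ψ` is
tightly induced from any `𝕂T`-irrep overlapping with it. -/
theorem tight_induction_step (p : ℕ) (hp : p.Prime)
    (G : Type) [Group G] [Fintype G] (hG : IsPGroup p G)
    (k : Type) [Field k] [CharZero k] (hnR : ¬ IsRoquette G)
    (ψ : FDRep k G) (hψ : IsIrr ψ) (hψf : IsFaithfulRep ψ) :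
    (∃ E : Subgroup G, E.Normal ∧
        Nonempty (E ≃* (Multiplicative (ZMod p) × Multiplicative (ZMod p))) ∧
        Nonempty ((E ⊓ Subgroup.center G : Subgroup G) ≃* Multiplicative (ZMod p))) ∧
    ∀ E : Subgroup G, E.Normal →
      Nonempty (E ≃* (Multiplicative (ZMod p) × Multiplicative (ZMod p))) →
      Nonempty ((E ⊓ Subgroup.center G : Subgroup G) ≃* Multiplicative (ZMod p)) →
      IsCoatom (Subgroup.centralizer (E : Set G)) ∧
      ∀ φ : FDRep k (Subgroup.centralizer (E : Set G)), IsIrr φ →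
        CharOccurs φ.character (resChar (Subgroup.centralizer (E : Set G)) ψ.character) →
        TightInd (Subgroup.centralizer (E : Set G)) ψ.character φ.character := by
  have hnil : Group.IsNilpotent G := by
    have := Fact.mk hp
    exact hG.isNilpotent
  have hZ : IsCyclic (Subgroup.center G) := by
    refine cyclic_of_central ψ.ρ hψ.1 hψ.2 (Subgroup.center G).subtype ?_ ?_
    · intro c g
      exact (Subgroup.mem_center_iff.mp c.2 g).symm
    · intro c d hcd
      exact Subtype.ext (hψf hcd)
  refine ⟨exists_E p hp hG hnR hZ, ?_⟩
  rintro E hE ⟨e1⟩ ⟨e2⟩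
  have hgood := goodE_of p hp E hE e1 e2
  exact ⟨hgood.coatom hp, fun φ hφ hocc => main_aux p hp G k ψ hψ hψf E hgood _ rfl φ hφ hocc⟩

end Genotype
end
end

section
/- Let A be a self-centralizing normal cyclic subgroup of the finite p-group G, and let H be a subgroup with A ≤ H < G. Then no faithful 𝕂G-irrep is tightly induced from any 𝕂H-irrep. -/
open scoped Classical

noncomputable section

namespace Genotype
open Module in
lemma trace_roots_aux {L : Type} [Field L] [IsAlgClosed L] [CharZero L] {W : Type}
    [AddCommGroup W] [Module L W]
    [FiniteDimensional L W] (f : Module.End L W) (n : ℕ) (hn : 0 < n) (hfn : f ^ n = 1) :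
    ∃ (t : Finset L) (c : L → ℕ), (∀ x ∈ t, x ^ n = 1) ∧
      ∀ m : ℕ, LinearMap.trace L W (f ^ m) = ∑ x ∈ t, (c x : L) * x ^ m := by
  have hss : f.IsSemisimple := by
    refine Module.End.isSemisimple_of_squarefree_aeval_eq_zero (p := Polynomial.X ^ n - 1) ?_ ?_
    · apply Polynomial.Separable.squarefree
      exact Polynomial.separable_X_pow_sub_C (1 : L) (by exact_mod_cast hn.ne') one_ne_zero
    · simp [hfn]
  have htop := hss.iSup_eigenspace_eq_top
  have hint : DirectSum.IsInternal f.eigenspace :=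
    (DirectSum.isInternal_submodule_iff_iSupIndep_and_iSup_eq_top _).2
      ⟨f.eigenspaces_iSupIndep, htop⟩
  have hfin : {μ | f.eigenspace μ ≠ ⊥}.Finite :=
    WellFoundedGT.finite_ne_bot_of_iSupIndep f.eigenspaces_iSupIndep
  have hpow : ∀ (μ : L) (m : ℕ) (x), x ∈ f.eigenspace μ → (f ^ m) x = μ ^ m • x := by
    intro μ m x hx
    rw [Module.End.mem_eigenspace_iff] at hx
    induction m with
    | zero => simp
    | succ m ih => rw [pow_succ', Module.End.mul_apply, ih, map_smul, hx, smul_smul, pow_succ]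
  refine ⟨hfin.toFinset, fun μ => finrank L (f.eigenspace μ), ?_, ?_⟩
  · intro μ hμ
    rw [Set.Finite.mem_toFinset] at hμ
    obtain ⟨x, hx, hx0⟩ := Submodule.exists_mem_ne_zero_of_ne_bot hμ
    have := hpow μ n x hx
    rw [hfn, Module.End.one_apply] at this
    have h2 : (μ ^ n - 1) • x = 0 := by
      rw [sub_smul (μ ^ n) 1 x, ← this, one_smul, sub_self]
    rcases smul_eq_zero.1 h2 with h | h
    · exact sub_eq_zero.1 h
    · exact absurd h hx0
  · intro m
    have hmaps : ∀ μ, Set.MapsTo (f ^ m) (f.eigenspace μ) (f.eigenspace μ) := by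
      intro μ x hx
      rw [hpow μ m x hx]
      exact Submodule.smul_mem _ _ hx
    rw [LinearMap.trace_eq_sum_trace_restrict' hint hfin hmaps]
    refine Finset.sum_congr rfl fun μ _ => ?_
    have : (f ^ m).restrict (hmaps μ) = μ ^ m • (LinearMap.id) := by
      ext x
      exact hpow μ m x x.2
    rw [this, map_smul, smul_eq_mul, mul_comm]
    congr 1
    exact LinearMap.trace_id L (f.eigenspace μ)

open Module in
lemma trace_roots {k : Type} [Field k] [CharZero k] {L : Type} [Field L] [IsAlgClosed L] [CharZero L]
    [Algebra k L] {V : Type} [AddCommGroup V] [Module k V]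
    [FiniteDimensional k V] (T : Module.End k V) (n : ℕ) (hn : 0 < n) (hT : T ^ n = 1) :
    ∃ (t : Finset L) (c : L → ℕ), (∀ x ∈ t, x ^ n = 1) ∧
      ∀ m : ℕ, algebraMap k L (LinearMap.trace k V (T ^ m)) =
        ∑ x ∈ t, (c x : L) * x ^ m := by
  set f : Module.End L (TensorProduct k L V) := LinearMap.baseChange L T with hf
  have hfp : ∀ m : ℕ, LinearMap.baseChange L (T ^ m) = f ^ m := fun m => by
    rw [hf, LinearMap.baseChange_pow]
  have hfn : f ^ n = 1 := by
    rw [← hfp, hT]; exact LinearMap.baseChange_one _ _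
  obtain ⟨t, c, h1, h2⟩ := trace_roots_aux f n hn hfn
  refine ⟨t, c, h1, fun m => ?_⟩
  rw [← LinearMap.trace_baseChange, hfp, h2]

lemma galConj_of {k : Type} [Field k] [CharZero k] {L : Type} [Field L] [IsAlgClosed L] [CharZero L]
    [Algebra k L] {X : Type} (f f' : X → k) (n r : ℕ)
    (hn : 0 < n) (hr : r.Coprime n)
    (h : ∀ x, ∃ (t : Finset L) (c : L → ℕ),
      (∀ x ∈ t, x ^ n = 1) ∧
      algebraMap k L (f x) = ∑ y ∈ t, (c y : L) * y ∧
      algebraMap k L (f' x) = ∑ y ∈ t, (c y : L) * y ^ r) :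
    IsGaloisConj f f' := by
  have : NeZero n := ⟨hn.ne'⟩
  have : NeZero (n : L) := ⟨by exact_mod_cast hn.ne'⟩
  obtain ⟨ζ, hζ⟩ := HasEnoughRootsOfUnity.exists_primitiveRoot L n
  let M := IntermediateField.adjoin ℚ ({ζ} : Set L)
  have hcyc : IsCyclotomicExtension {n} ℚ M :=
    (IntermediateField.isCyclotomicExtension_singleton_iff_eq_adjoin n ℚ L _ hζ).2 rfl
  have hζM : ζ ∈ M := IntermediateField.mem_adjoin_simple_self ℚ ζ
  have hζ' : IsPrimitiveRoot (⟨ζ, hζM⟩ : M) n := by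
    rw [← IsPrimitiveRoot.coe_submonoidClass_iff]; exact hζ
  have hirr := Polynomial.cyclotomic.irreducible_rat hn
  let z := IsCyclotomicExtension.zeta n ℚ M
  have hz : IsPrimitiveRoot z n := IsCyclotomicExtension.zeta_spec n ℚ M
  have hzr : IsPrimitiveRoot (z ^ r) n := hz.pow_of_coprime r hr
  let α : M ≃ₐ[ℚ] M := IsCyclotomicExtension.fromZetaAut hzr hirr
  have hα : α z = z ^ r := IsCyclotomicExtension.fromZetaAut_spec hzr hirr
  have hα' : ∀ y : M, y ^ n = 1 → α y = y ^ r := by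
    intro y hy
    obtain ⟨i, -, rfl⟩ := hz.eq_pow_of_pow_eq_one hy
    rw [map_pow, hα, ← pow_mul, ← pow_mul, mul_comm]
  have hroot : ∀ y : L, y ^ n = 1 → y ∈ M := by
    intro y hy
    obtain ⟨i, -, rfl⟩ := hζ.eq_pow_of_pow_eq_one hy
    exact pow_mem hζM i
  have hmem : ∀ x, algebraMap k L (f x) ∈ M := by
    intro x
    obtain ⟨t, c, ht, h1, h2⟩ := h x
    rw [h1]
    exact sum_mem fun y hy => mul_mem (natCast_mem _ _) (hroot y (ht y hy))
  have hmem' : ∀ x, algebraMap k L (f' x) ∈ M := by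
    intro x
    obtain ⟨t, c, ht, h1, h2⟩ := h x
    rw [h2]
    exact sum_mem fun y hy => mul_mem (natCast_mem _ _) (pow_mem (hroot y (ht y hy)) _)
  have key : ∀ g : X → k, (∀ x, algebraMap k L (g x) ∈ M) → ∀ y ∈ charField g,
      algebraMap k L y ∈ M := by
    intro g hg y hy
    have : charField g ≤ M.toSubfield.comap (algebraMap k L) := by
      refine Subfield.closure_le.2 ?_
      rintro _ ⟨x, rfl⟩
      exact hg x
    exact this hy
  let i : charField f →+* M := ((algebraMap k L).comp (charField f).subtype).codRestrict M
    (fun y => key f hmem y y.2)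
  let j : charField f' →+* M := ((algebraMap k L).comp (charField f').subtype).codRestrict M
    (fun y => key f' hmem' y y.2)
  refine ⟨M, inferInstance, inferInstance, IsCyclotomicExtension.isGalois {n} ℚ M, i, j,
    α.toRingEquiv, ?_⟩
  intro x
  obtain ⟨t, c, ht, h1, h2⟩ := h x
  have e1 : i ⟨f x, mem_charField f x⟩ =
      ∑ y ∈ t.attach, (c y : M) * (⟨y, hroot y (ht y y.2)⟩ : M) := by
    apply Subtype.ext
    change algebraMap k L (f x) = _
    rw [h1, ← Finset.sum_attach]
    push_cast
    rfl
  have e2 : j ⟨f' x, mem_charField f' x⟩ =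
      ∑ y ∈ t.attach, (c y : M) * (⟨y, hroot y (ht y y.2)⟩ : M) ^ r := by
    apply Subtype.ext
    change algebraMap k L (f' x) = _
    rw [h2, ← Finset.sum_attach]
    push_cast
    rfl
  rw [e1, e2]
  change α _ = _
  rw [map_sum]
  refine Finset.sum_congr rfl fun y _ => ?_
  rw [map_mul, map_natCast, hα']
  apply Subtype.ext
  exact ht y y.2
end Genotype
namespace Genotype
open Module

section
variable {k : Type} [Field k] [CharZero k] {P : Type} [Group P]

/-- Pullback of a representation along a group homomorphism. -/
def pull {Q : Type} [Group Q] (V : FDRep k P) (f : Q →* P) : FDRep k Q :=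
  FDRep.of (V := V) (V.ρ.comp f)

lemma pull_char {Q : Type} [Group Q] (V : FDRep k P) (f : Q →* P) (q : Q) :
    (pull V f).character q = V.character (f q) := rfl

lemma pull_irr {Q : Type} [Group Q] (V : FDRep k P) (hV : IsIrr V) (f : Q →* P)
    (hf : Function.Surjective f) : IsIrr (pull V f) := by
  refine ⟨hV.1, fun U hU => hV.2 U fun g x hx => ?_⟩
  obtain ⟨q, rfl⟩ := hf g
  exact hU q x hx

lemma sum_pow_mul {R : Type} [Ring R] (T : R) (n : ℕ) (hT : T ^ n = 1) :
    T * ∑ i ∈ Finset.range n, T ^ i = ∑ i ∈ Finset.range n, T ^ i := by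
  have h := mul_geom_sum T n
  rw [hT, sub_self, sub_mul, one_mul, sub_eq_zero] at h
  exact h

lemma trace_vanish [Finite P] (V : FDRep k P) (hV : IsIrr V) (h c : P)
    (hc : ∀ i : ℕ, V.character (h * c ^ i) = V.character h)
    (hnorm : ∀ x : P, ∃ m : ℕ, x⁻¹ * c * x = c ^ m) (hne : V.ρ c ≠ 1) : V.character h = 0 := by
  set n := orderOf c with hn
  have hn0 : 0 < n := orderOf_pos c
  have hTn : V.ρ c ^ n = 1 := by rw [← map_pow, hn, pow_orderOf_eq_one, map_one]
  set e : Module.End k V := ∑ i ∈ Finset.range n, V.ρ c ^ i with he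
  have hce : V.ρ c * e = e := sum_pow_mul _ n hTn
  have he0 : e = 0 := by
    have hU := hV.2 (LinearMap.ker (V.ρ c - 1)) (by
      intro x v hv
      rw [LinearMap.mem_ker, LinearMap.sub_apply, Module.End.one_apply, sub_eq_zero] at hv ⊢
      obtain ⟨m, hm⟩ := hnorm x
      have h1 : c * x = x * c ^ m := by rw [← hm]; group
      have h2 : ∀ m : ℕ, (V.ρ c ^ m) v = v := by
        intro m
        induction m with
        | zero => simp
        | succ m ih => rw [pow_succ, Module.End.mul_apply, hv, ih]
      rw [← Module.End.mul_apply, ← map_mul, h1, map_mul, Module.End.mul_apply, map_pow, h2])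
    rcases hU with hU | hU
    · refine LinearMap.ext fun v => ?_
      have : e v ∈ LinearMap.ker (V.ρ c - 1) := by
        rw [LinearMap.mem_ker, LinearMap.sub_apply, Module.End.one_apply, sub_eq_zero,
          ← Module.End.mul_apply, hce]
      rw [hU, Submodule.mem_bot] at this
      exact this
    · exact absurd (sub_eq_zero.1 (LinearMap.ker_eq_top.1 hU)) hne
  have h3 : (n : k) * V.character h = LinearMap.trace k V (V.ρ h * e) := by
    rw [he, Finset.mul_sum, map_sum]
    have : ∀ i ∈ Finset.range n, LinearMap.trace k V (V.ρ h * V.ρ c ^ i) = V.character h := by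
      intro i _
      rw [← hc i, FDRep.character, map_mul V.ρ, map_pow V.ρ]
    rw [Finset.sum_congr rfl this, Finset.sum_const, Finset.card_range, nsmul_eq_mul]
  rw [he0, mul_zero, map_zero] at h3
  exact (mul_eq_zero.1 h3).resolve_left (by exact_mod_cast hn0.ne')

lemma trivial_of_char [Finite P] (V : FDRep k P) (c : P)
    (hc : ∀ i : ℕ, V.character (c ^ i) = V.character 1) : V.ρ c = 1 := by
  set n := orderOf c with hn
  have hn0 : (n : k) ≠ 0 := by exact_mod_cast (orderOf_pos c).ne'
  have hTn : V.ρ c ^ n = 1 := by rw [← map_pow, hn, pow_orderOf_eq_one, map_one]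
  set e : Module.End k V := ∑ i ∈ Finset.range n, V.ρ c ^ i with he
  have hce : V.ρ c * e = e := sum_pow_mul _ n hTn
  have hproj : LinearMap.IsProj (LinearMap.ker (V.ρ c - 1)) ((n : k)⁻¹ • e) := by
    constructor
    · intro v
      rw [LinearMap.smul_apply]
      apply Submodule.smul_mem
      rw [LinearMap.mem_ker, LinearMap.sub_apply, Module.End.one_apply, sub_eq_zero,
          ← Module.End.mul_apply, hce]
    · intro v hv
      rw [LinearMap.mem_ker, LinearMap.sub_apply, Module.End.one_apply, sub_eq_zero] at hv
      have h2 : ∀ m : ℕ, (V.ρ c ^ m) v = v := by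
        intro m
        induction m with
        | zero => simp
        | succ m ih => rw [pow_succ, Module.End.mul_apply, hv, ih]
      rw [LinearMap.smul_apply, he, LinearMap.sum_apply, Finset.sum_congr rfl (fun i _ => h2 i),
        Finset.sum_const, Finset.card_range, ← Nat.cast_smul_eq_nsmul k, smul_smul,
        inv_mul_cancel₀ hn0, one_smul]
  have htr := hproj.trace
  have h3 : LinearMap.trace k V e = (n : k) * finrank k V := by
    rw [he, map_sum]
    have : ∀ i ∈ Finset.range n, LinearMap.trace k V (V.ρ c ^ i) = finrank k V := by
      intro i _
      rw [← FDRep.char_one, ← hc i, FDRep.character, map_pow V.ρ]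
    rw [Finset.sum_congr rfl this, Finset.sum_const, Finset.card_range, nsmul_eq_mul]
  rw [map_smul, h3, smul_eq_mul, inv_mul_cancel_left₀ hn0] at htr
  have h4 : finrank k (LinearMap.ker (V.ρ c - 1)) = finrank k V := by exact_mod_cast htr.symm
  exact sub_eq_zero.1 (LinearMap.ker_eq_top.1 (Submodule.eq_top_of_finrank_eq h4))

lemma scalar_nat [Fintype P] (V W : FDRep k P) :
    ∑ g : P, W.character g * V.character g⁻¹ =
      (Nat.card P : k) * (finrank k (Representation.IntertwiningMap V.ρ W.ρ) : k) := by
  have h0 : (Nat.card P : k) ≠ 0 := by exact_mod_cast Nat.card_pos.ne'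
  let _ : Invertible (Nat.card P : k) := invertibleOfNonzero h0
  rw [← Representation.card_inv_mul_sum_char_mul_char_eq_finrank, mul_inv_cancel_left₀ h0]
  rfl

lemma scalar_self_ne [Fintype P] (V : FDRep k P) (hV : Nontrivial V) :
    ∑ g : P, V.character g * V.character g⁻¹ ≠ 0 := by
  have h0 : (Nat.card P : k) ≠ 0 := by exact_mod_cast Nat.card_pos.ne'
  rw [scalar_nat]
  refine mul_ne_zero h0 ?_
  have := Module.Finite.equiv (Representation.invariantsEquivIntertwiningMap V.ρ V.ρ)
  have : Nontrivial (Representation.IntertwiningMap V.ρ V.ρ) := by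
    refine ⟨Representation.IntertwiningMap.id V.ρ, 0, fun h => ?_⟩
    obtain ⟨v, hv⟩ := exists_ne (0 : V)
    exact hv (congrArg (fun F : Representation.IntertwiningMap V.ρ V.ρ => F.toLinearMap v) h)
  exact_mod_cast (finrank_pos (R := k) (M := Representation.IntertwiningMap V.ρ V.ρ)).ne'

lemma occurs_of_ne [Fintype P] (V W : FDRep k P) (hV : IsIrr V)
    (h : ∑ g : P, W.character g * V.character g⁻¹ ≠ 0) :
    CharOccurs V.character W.character := by
  have h0 : (Nat.card P : k) ≠ 0 := by exact_mod_cast Nat.card_pos.ne'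
  have : NeZero (Nat.card P : k) := ⟨h0⟩
  rw [scalar_nat] at h
  have h1 : finrank k (Representation.IntertwiningMap V.ρ W.ρ) ≠ 0 := by
    intro h2
    rw [h2] at h
    simp at h
  have h2 : Nontrivial (Representation.IntertwiningMap V.ρ W.ρ) := by
    by_contra hn
    rw [not_nontrivial_iff_subsingleton] at hn
    exact h1 finrank_zero_of_subsingleton
  obtain ⟨F, hF⟩ := exists_ne (0 : Representation.IntertwiningMap V.ρ W.ρ)
  let f : V →ₗ[k] W := F.toLinearMap
  have hf : ∀ g v, f (V.ρ g v) = W.ρ g (f v) := fun g v =>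
    LinearMap.congr_fun (F.isIntertwining' g) v
  have hinj : Function.Injective f := by
    rcases hV.2 (LinearMap.ker f) (by
      intro g x hx
      rw [LinearMap.mem_ker] at hx ⊢
      rw [hf, hx, map_zero]) with h | h
    · exact LinearMap.ker_eq_bot.1 h
    · exfalso
      apply hF
      have : f = 0 := LinearMap.ker_eq_top.1 h
      ext v
      exact LinearMap.congr_fun this v
  let R : Subrepresentation W.ρ := ⟨LinearMap.range f, by
    rintro g _ ⟨v, rfl⟩
    exact ⟨V.ρ g v, hf g v⟩⟩
  obtain ⟨Q, hQ⟩ := exists_isCompl R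
  have hQ' : IsCompl (LinearMap.range f) Q.toSubmodule := by
    constructor
    · rw [disjoint_iff]
      exact congrArg Subrepresentation.toSubmodule hQ.inf_eq_bot
    · rw [codisjoint_iff]
      exact congrArg Subrepresentation.toSubmodule hQ.sup_eq_top
  let e : (V × Q.toSubmodule) ≃ₗ[k] W :=
    ((LinearEquiv.ofInjective f hinj).prodCongr (LinearEquiv.refl k _)).trans
      (Submodule.prodEquivOfIsCompl _ _ hQ')
  refine ⟨FDRep.of (V := Q.toSubmodule) Q.toRepresentation, ?_⟩
  funext g
  change LinearMap.trace k W (W.ρ g) = LinearMap.trace k V (V.ρ g) +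
    LinearMap.trace k Q.toSubmodule (Q.toRepresentation g)
  rw [← LinearMap.trace_prodMap', ← LinearMap.trace_conj' _ e]
  congr 1
  ext w
  obtain ⟨⟨v, q⟩, rfl⟩ := e.surjective w
  rw [LinearEquiv.conj_apply_apply, LinearEquiv.symm_apply_apply]
  change W.ρ g (f v + q) = f (V.ρ g v) + W.ρ g q
  rw [map_add, hf]
end
end Genotype
namespace Genotype

/-- Conjugation by `x⁻¹` as a homomorphism from one subgroup to another. -/
def conjHom {G : Type} [Group G] (B H : Subgroup G) (x : G) (h : ∀ b ∈ B, x⁻¹ * b * x ∈ H) :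
    B →* H where
  toFun b := ⟨x⁻¹ * b * x, h b b.2⟩
  map_one' := by ext; simp
  map_mul' a b := by ext; simp [mul_assoc]

/-- Let `A` be a self-centralizing normal cyclic subgroup of the finite `p`-group `G`, and
let `A ≤ H < G`. Then no faithful `𝕂G`-irrep is tightly induced from any `𝕂H`-irrep. -/
theorem no_tight_induction_above_self_centralizing (p : ℕ) (hp : p.Prime)
    (G : Type) [Group G] [Fintype G] (hG : IsPGroup p G)
    (k : Type) [Field k] [CharZero k]
    (A : Subgroup G) (hAn : A.Normal) (hAc : IsCyclic A)
    (hsc : Subgroup.centralizer (A : Set G) = A)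
    (H : Subgroup G) (hAH : A ≤ H) (hHG : H ≠ ⊤)
    (ψ : FDRep k G) (hψ : IsIrr ψ) (hψf : IsFaithfulRep ψ)
    (φ : FDRep k H) (hφ : IsIrr φ) :
    ¬ TightInd H ψ.character φ.character := by
  rintro ⟨hind, ⟨W, hW, hWn⟩, htight⟩
  rw [one_smul] at hW
  have hp' : Fact p.Prime := ⟨hp⟩
  -- the normalizer grows
  have hnil : Group.IsNilpotent G := hG.isNilpotent
  obtain ⟨g, hgN, hgH⟩ : ∃ g, g ∈ Subgroup.normalizer (H : Set G) ∧ g ∉ H := by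
    have := Group.normalizerCondition_of_isNilpotent (G := G) H (lt_top_iff_ne_top.2 hHG)
    exact SetLike.exists_of_lt this
  have hgN' : ∀ h, h ∈ H ↔ g⁻¹ * h * g ∈ H := Subgroup.mem_normalizer_iff''.1 hgN
  have hconjA : ∀ x : G, ∀ a ∈ A, x⁻¹ * a * x ∈ A := by
    intro x a ha
    simpa using hAn.conj_mem a ha x⁻¹
  -- conjugation acts by powers
  obtain ⟨⟨a0, ha0⟩, hgen⟩ := IsCyclic.exists_monoid_generator (α := A)
  have hgen' : ∀ a ∈ A, ∃ i : ℕ, a0 ^ i = a := by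
    intro a ha
    obtain ⟨i, hi⟩ := hgen ⟨a, ha⟩
    exact ⟨i, congrArg Subtype.val hi⟩
  have hpow : ∀ x : G, ∃ m : ℕ, ∀ a ∈ A, x⁻¹ * a * x = a ^ m := by
    intro x
    obtain ⟨m, hm⟩ := hgen' _ (hconjA x a0 ha0)
    refine ⟨m, fun a ha => ?_⟩
    obtain ⟨i, rfl⟩ := hgen' a ha
    rw [← pow_mul, mul_comm, pow_mul, hm]
    simpa using (conj_pow (i := i) (a := x⁻¹) (b := a0)).symm
  have hcomm : ∀ a ∈ A, ∀ b ∈ A, a * b = b * a := by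
    intro a ha b hb
    obtain ⟨i, rfl⟩ := hgen' a ha
    obtain ⟨j, rfl⟩ := hgen' b hb
    rw [← pow_add, ← pow_add, add_comm]
  -- the induced character on A
  have hψA : ∀ a (ha : a ∈ A), ψ.character a =
      (Nat.card H : k)⁻¹ * ∑ x : G, φ.character ⟨x⁻¹ * a * x, hAH (hconjA x a ha)⟩ := by
    intro a ha
    rw [hind, indChar, finsum_eq_sum_of_fintype]
    congr 1
    refine Finset.sum_congr rfl fun x _ => ?_
    rw [dif_pos]
  -- φ is faithful on A
  have hfaith : ∀ c (hc : c ∈ A), c ≠ 1 → φ.ρ ⟨c, hAH hc⟩ ≠ 1 := by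
    intro c hc hc1 hρ
    apply hc1
    apply hψf
    rw [map_one]
    apply trivial_of_char
    intro i
    rw [hψA _ (pow_mem hc i), hψA 1 (one_mem A)]
    congr 1
    refine Finset.sum_congr rfl fun x _ => ?_
    obtain ⟨m, hm⟩ := hpow x
    have e1 : (⟨x⁻¹ * c ^ i * x, hAH (hconjA x _ (pow_mem hc i))⟩ : H) =
        (⟨c, hAH hc⟩ : H) ^ (i * m) := by
      ext
      simp [hm _ (pow_mem hc i), pow_mul]
    have e2 : (⟨x⁻¹ * 1 * x, hAH (hconjA x _ (one_mem A))⟩ : H) = 1 := by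
      ext
      simp
    rw [e1, e2, FDRep.character, FDRep.character, map_pow φ.ρ, hρ, one_pow, map_one φ.ρ]
  -- φ vanishes off A
  have hvan : ∀ h : H, (h : G) ∉ A → φ.character h = 0 := by
    intro h hh
    rw [← hsc, Subgroup.mem_centralizer_iff] at hh
    push Not at hh
    obtain ⟨a, ha, hah⟩ := hh
    have haA : a ∈ A := ha
    let aH : H := ⟨a, hAH haA⟩
    have hb : h⁻¹ * a * h ∈ A := hconjA h a haA
    have hcA : (h : G)⁻¹ * a * h * a⁻¹ ∈ A := mul_mem hb (inv_mem haA)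
    have hc1 : (h : G)⁻¹ * a * h * a⁻¹ ≠ 1 := by
      intro hc
      apply hah
      rw [mul_inv_eq_one] at hc
      nth_rewrite 2 [← hc]
      group
    have hcc : (⟨_, hAH hcA⟩ : H) = h⁻¹ * aH * h * aH⁻¹ := rfl
    refine trace_vanish φ hφ h ⟨_, hAH hcA⟩ ?_ ?_ (hfaith _ hcA hc1)
    · intro i
      have hcom : Commute (h⁻¹ * aH * h) aH⁻¹ := by
        apply Commute.inv_right
        apply Subtype.ext
        exact hcomm _ hb a haA
      have : h * (⟨_, hAH hcA⟩ : H) ^ i = aH ^ i * h * (aH ^ i)⁻¹ := by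
        have hcp : (h⁻¹ * aH * h) ^ i = h⁻¹ * aH ^ i * h := by
          simpa using (conj_pow (i := i) (a := h⁻¹) (b := aH))
        rw [hcc, hcom.mul_pow, hcp, inv_pow]
        group
      rw [this, FDRep.char_conj]
    · intro x
      obtain ⟨m, hm⟩ := hpow x
      refine ⟨m, Subtype.ext ?_⟩
      exact hm _ hcA
  -- the conjugate of φ
  let σ : H →* H := conjHom H H g (fun b hb => (hgN' b).1 hb)
  have hσ : Function.Surjective σ := by
    intro h
    have : g⁻¹ * (g * h * g⁻¹) * g = h := by group
    refine ⟨⟨g * h * g⁻¹, (hgN' _).2 (by rw [this]; exact h.2)⟩, Subtype.ext this⟩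
  have hφσ : (pull φ σ).character = φ.character := by
    refine htight _ ⟨pull φ σ, pull_irr φ hφ σ hσ, rfl⟩ ?_ ⟨pull W σ, ?_⟩
    · obtain ⟨r, hr⟩ := hpow g
      have hcop : r.Coprime (orderOf a0) := by
        have h1 : orderOf (a0 ^ r) = orderOf a0 := by
          rw [← hr a0 ha0]
          have := (MulAut.conj g⁻¹).orderOf_eq a0
          simpa using this
        rw [orderOf_pow, Nat.div_eq_self] at h1
        rcases h1 with h1 | h1
        · exact absurd h1 (orderOf_pos a0).ne'
        · exact Nat.Coprime.symm h1
      have hchar : CharZero (AlgebraicClosure k) :=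
        charZero_of_injective_algebraMap (algebraMap k (AlgebraicClosure k)).injective
      refine galConj_of (L := AlgebraicClosure k) _ _ (orderOf a0) r (orderOf_pos a0) hcop ?_
      intro h
      by_cases hhA : (h : G) ∈ A
      · have hn : h ^ orderOf a0 = 1 := by
          obtain ⟨i, hi⟩ := hgen' _ hhA
          apply Subtype.ext
          rw [Subgroup.coe_pow, ← hi, ← pow_mul, mul_comm, pow_mul, pow_orderOf_eq_one, one_pow]
          rfl
        obtain ⟨t, c, h1, h2⟩ := trace_roots (L := AlgebraicClosure k) (φ.ρ h) (orderOf a0)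
          (orderOf_pos a0) (by rw [← map_pow, hn, map_one])
        refine ⟨t, c, h1, ?_, ?_⟩
        · have := h2 1
          simp only [pow_one] at this
          exact this
        · rw [← h2 r, ← map_pow φ.ρ]
          have : σ h = h ^ r := Subtype.ext (hr _ hhA)
          rw [pull_char, this]
          rfl
      · refine ⟨∅, fun _ => 0, by simp, ?_, ?_⟩
        · rw [hvan h hhA]; simp
        · rw [pull_char, hvan (σ h)]
          · simp
          · intro h'
            apply hhA
            have h3 := hAn.conj_mem _ h' g
            have h4 : g * (σ h : G) * g⁻¹ = h := by
              change g * (g⁻¹ * h * g) * g⁻¹ = h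
              group
            rwa [h4] at h3
    · funext h
      have := congrFun hW (σ h)
      rw [Pi.add_apply] at this ⊢
      rw [pull_char, pull_char, ← this]
      change ψ.character h = ψ.character (g⁻¹ * h * g)
      have h5 := FDRep.char_conj ψ (h : G) g⁻¹
      rw [inv_inv] at h5
      exact h5.symm
  -- multiplicity
  apply hWn
  apply occurs_of_ne φ W hφ
  have hres : ∀ F : H → k, ∑ h : H, F h * φ.character h⁻¹ =
      ∑ a : A, F (Subgroup.inclusion hAH a) * φ.character (Subgroup.inclusion hAH a)⁻¹ := by
    intro F
    symm
    refine Fintype.sum_of_injective (Subgroup.inclusion hAH)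
      (Subgroup.inclusion_injective hAH) _ _ ?_ (fun _ => rfl)
    intro h hh
    rw [hvan h⁻¹, mul_zero]
    intro hA
    exact hh ⟨⟨h, by simpa using hA⟩, rfl⟩
  let V0 : FDRep k A := pull φ (Subgroup.inclusion hAH)
  let Vx : G → FDRep k A := fun x => pull φ (conjHom A H x fun a ha => hAH (hconjA x a ha))
  let T : G → k := fun x => ∑ a : A, (Vx x).character a * V0.character a⁻¹
  have hT : ∀ x, ∃ n : ℕ, T x = (Nat.card A : k) * n := fun x => ⟨_, scalar_nat V0 (Vx x)⟩
  choose n hn using hT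
  have hTH : ∀ x, (∀ a : A, (Vx x).character a = V0.character a) → T x = T 1 := by
    intro x hx
    have h1 : ∀ a : A, (Vx 1).character a = V0.character a := by
      intro a
      change φ.character _ = φ.character _
      congr 1
      apply Subtype.ext
      change 1⁻¹ * (a : G) * 1 = a
      simp
    change ∑ a : A, _ = ∑ a : A, _
    refine Finset.sum_congr rfl fun a _ => ?_
    rw [hx, h1]
  have hA0 : (Nat.card A : k) ≠ 0 := by exact_mod_cast Nat.card_pos.ne'
  have hH0 : (Nat.card H : k) ≠ 0 := by exact_mod_cast Nat.card_pos.ne'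
  have hTn : ∀ x, T x = T 1 → n x = n 1 := by
    intro x hx
    rw [hn, hn] at hx
    exact_mod_cast mul_left_cancel₀ hA0 hx
  have hnH : ∀ x ∈ H, n x = n 1 := by
    intro x hx
    apply hTn
    apply hTH
    intro a
    have := FDRep.char_conj φ (Subgroup.inclusion hAH a) (⟨x, hx⟩ : H)⁻¹
    rw [inv_inv] at this
    exact this
  have hng : n g = n 1 := by
    apply hTn
    apply hTH
    intro a
    exact congrFun hφσ (Subgroup.inclusion hAH a)
  have hφφ : ∑ h : H, φ.character h * φ.character h⁻¹ = T 1 := by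
    rw [hres]
    change _ = ∑ a : A, _
    refine Finset.sum_congr rfl fun a _ => ?_
    congr 1
    change φ.character _ = φ.character _
    congr 1
    apply Subtype.ext
    change (a : G) = 1⁻¹ * (a : G) * 1
    simp
  have hn1 : 0 < n 1 := by
    have := scalar_self_ne φ hφ.1
    rw [hφφ, hn] at this
    rw [Nat.pos_iff_ne_zero]
    intro h
    rw [h] at this
    simp at this
  have hψφ : ∑ h : H, ψ.character h * φ.character h⁻¹ = (Nat.card H : k)⁻¹ * ∑ x : G, T x := by
    rw [hres (fun h => ψ.character h)]
    have : ∀ a : A, ψ.character (Subgroup.inclusion hAH a : H) *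
        φ.character (Subgroup.inclusion hAH a)⁻¹ =
        ∑ x : G, (Nat.card H : k)⁻¹ * ((Vx x).character a * V0.character a⁻¹) := by
      intro a
      rw [← Finset.mul_sum, ← Finset.sum_mul, ← mul_assoc]
      congr 1
      exact hψA a a.2
    rw [Finset.sum_congr rfl fun a _ => this a, Finset.sum_comm, Finset.mul_sum]
    refine Finset.sum_congr rfl fun x _ => ?_
    rw [← Finset.mul_sum]
  have hWφ : ∑ h : H, W.character h * φ.character h⁻¹ =
      (Nat.card H : k)⁻¹ * ∑ x : G, T x - T 1 := by
    rw [← hψφ, ← hφφ, ← Finset.sum_sub_distrib]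
    refine Finset.sum_congr rfl fun h _ => ?_
    have : ψ.character h = φ.character h + W.character h := congrFun hW h
    rw [this]
    ring
  rw [hWφ]
  intro hzero
  have hlt : Nat.card H * n 1 < ∑ x : G, n x := by
    let S : Finset G := Finset.univ.filter (· ∈ H)
    have hS : g ∉ S := by simp [S, hgH]
    have hcard : S.card = Nat.card H := by
      rw [Nat.card_eq_fintype_card, Fintype.card_subtype]
    have h1 : ∑ x ∈ insert g S, n x ≤ ∑ x : G, n x :=
      Finset.sum_le_sum_of_subset (Finset.subset_univ _)
    rw [Finset.sum_insert hS, hng, Finset.sum_congr rfl (fun x hx => hnH x (by simpa [S] using hx)),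
      Finset.sum_const, hcard, smul_eq_mul] at h1
    omega
  have heq : (Nat.card A : k) * (∑ x : G, (n x : k)) = (Nat.card A : k) * (Nat.card H * n 1) := by
    rw [Finset.mul_sum]
    rw [sub_eq_zero, inv_mul_eq_iff_eq_mul₀ hH0] at hzero
    simp_rw [hn] at hzero
    rw [hzero]
    ring
  have heq' := mul_left_cancel₀ hA0 heq
  have : ∑ x : G, n x = Nat.card H * n 1 := by exact_mod_cast heq'
  omega
end Genotype
end
end
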